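/- Let p be a prime, F a field of characteristic p, and A a central simple F-algebra with exp A = p. Let K/F be a finite purely inseparable field extension and assume that A_K is not split. Then λ_p(A) ≤ [K:F]·λ_p(A_K). -/

import Mathlib

open scoped TensorProduct

/-- A finite-dimensional central simple algebra over a field `F`. -/
def IsCSA (F A : Type) [Field F] [Ring A] [Algebra F A] : Prop :=
  Algebra.IsCentral F A ∧ IsSimpleRing A ∧ FiniteDimensional F A

/-- An `F`-algebra is split if it is isomorphic to a matrix algebra over `F`. -/
def IsSplitAlg (F A : Type) [Field F] [Ring A] [Algebra F A] : Prop :=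
  ∃ n : ℕ, 0 < n ∧ Nonempty (A ≃ₐ[F] Matrix (Fin n) (Fin n) F)

/-- Brauer equivalence of two algebras over a field `F`. -/
def IsBrauerEquiv (F A B : Type) [Field F] [Ring A] [Algebra F A] [Ring B] [Algebra F B] :
    Prop :=
  ∃ n m : ℕ, 0 < n ∧ 0 < m ∧
    Nonempty ((Matrix (Fin n) (Fin n) A) ≃ₐ[F] (Matrix (Fin m) (Fin m) B))

/-- `A` has exponent `e`: `e` is the least positive integer such that the `e`-fold tensor
power of `A` over `F` is split. -/
def HasExponent (F A : Type) [Field F] [Ring A] [Algebra F A] (e : ℕ) : Prop :=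
  0 < e ∧ IsSplitAlg F (⨂[F] _ : Fin e, A) ∧
    ∀ k : ℕ, 0 < k → IsSplitAlg F (⨂[F] _ : Fin k, A) → e ≤ k

/-- `A` has (Schur) index `d`: `A` is isomorphic to a matrix algebra over a division
algebra of dimension `d ^ 2` over `F`. -/
def HasIndex (F A : Type) [Field F] [Ring A] [Algebra F A] (d : ℕ) : Prop :=
  ∃ (D : Type) (_ : DivisionRing D) (_ : Algebra F D) (m : ℕ), 0 < m ∧
    Nonempty (A ≃ₐ[F] Matrix (Fin m) (Fin m) D) ∧ Module.finrank F D = d ^ 2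

/-- The (Schur) index of `A` is at most `d`. -/
def IndexLE (F A : Type) [Field F] [Ring A] [Algebra F A] (d : ℕ) : Prop :=
  ∃ e : ℕ, e ≤ d ∧ HasIndex F A e

/-- `A` is the cyclic (symbol) algebra `[a, b)_{p,F}` of degree `p` in characteristic `p`:
it has dimension `p ^ 2` over `F` and is generated by elements `i`, `j` subject to
`i ^ p - i = a`, `j ^ p = b`, `j * i = (i - 1) * j`. -/
def IsCyclicAlgWith (p : ℕ) (F A : Type) [Field F] [Ring A] [Algebra F A] (a b : F) : Prop :=
  b ≠ 0 ∧ Module.finrank F A = p ^ 2 ∧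
    ∃ i j : A, i ^ p - i = algebraMap F A a ∧ j ^ p = algebraMap F A b ∧
      j * i = (i - 1) * j ∧ Algebra.adjoin F {i, j} = ⊤

/-- `A` is a cyclic algebra of degree `p`, i.e. of the form `[a, b)_{p,F}`. -/
def IsCyclicPAlg (p : ℕ) (F A : Type) [Field F] [Ring A] [Algebra F A] : Prop :=
  ∃ a b : F, IsCyclicAlgWith p F A a b

/-- The `p`-symbol length of `A` is at most `m`: `A` is Brauer equivalent to a tensor
product of at most `m` cyclic `F`-algebras of degree `p`. -/
def SymbolLengthLE (p : ℕ) (F A : Type) [Field F] [Ring A] [Algebra F A] (m : ℕ) : Prop :=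
  ∃ k : ℕ, k ≤ m ∧ ∃ (D : Fin k → Type) (_ : ∀ i, Ring (D i)) (_ : ∀ i, Algebra F (D i)),
    (∀ i, IsCyclicPAlg p F (D i)) ∧ IsBrauerEquiv F A (⨂[F] i, D i)

/-- `M` is a compositum `LK` of `L` and `K` over `F`: it is generated as an `F`-algebra by
the images of `L` and `K`. -/
def IsCompositum (F L K M : Type) [Field F] [Field L] [Field K] [Field M]
    [Algebra F L] [Algebra F K] [Algebra F M] [Algebra L M] [Algebra K M]
    [IsScalarTower F L M] [IsScalarTower F K M] : Prop :=
  (IsScalarTower.toAlgHom F L M).range ⊔ (IsScalarTower.toAlgHom F K M).range = ⊤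

/-- A cyclic algebra of degree `m` over `F`: a central simple `F`-algebra of degree `m`
containing a cyclic field extension of `F` of degree `m` (as a maximal subfield). -/
def IsCyclicAlgebra (F A : Type) [Field F] [Ring A] [Algebra F A] (m : ℕ) : Prop :=
  IsCSA F A ∧ Module.finrank F A = m ^ 2 ∧
  ∃ (L : Type) (_ : Field L) (_ : Algebra F L), IsGalois F L ∧ IsCyclic (L ≃ₐ[F] L) ∧
    Module.finrank F L = m ∧ Nonempty (L →ₐ[F] A)

/-- `L/F` is a `p`-extension: there is a tower of intermediate fields from `F` to `L`
each step of which is a cyclic extension of degree `p`. -/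
def IsPExtension (p : ℕ) (F L : Type) [Field F] [Field L] [Algebra F L] : Prop :=
  ∃ (n : ℕ) (T : Fin (n + 1) → IntermediateField F L),
    T 0 = ⊥ ∧ T (Fin.last n) = ⊤ ∧
    ∀ i : Fin n, ∃ h : T i.castSucc ≤ T i.succ,
      IsGalois (T i.castSucc) (IntermediateField.extendScalars h) ∧
      IsCyclic ((IntermediateField.extendScalars h) ≃ₐ[T i.castSucc]
        (IntermediateField.extendScalars h)) ∧
      Module.finrank (T i.castSucc) (IntermediateField.extendScalars h) = p

/-- `F` is `p`-cyclic reducible: for every central simple `F`-algebra `A` of exponent `p`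
and every purely inseparable extension `K/F` with `K ^ p ⊆ F`, either `A_K` is split, or
there is a separable extension `L/F` of degree `ind (A_K) / p` such that `A_{LK}` is
Brauer equivalent to a cyclic `LK`-algebra of degree `p`. -/
def IsPCyclicReducible (p : ℕ) (F : Type) [Field F] : Prop :=
  ∀ (A : Type) [Ring A] [Algebra F A], IsCSA F A → HasExponent F A p →
  ∀ (K : Type) [Field K] [Algebra F K], IsPurelyInseparable F K →
    (∀ z : K, z ^ p ∈ (algebraMap F K).range) →
    IsSplitAlg K (K ⊗[F] A) ∨
    ∃ d : ℕ, HasIndex K (K ⊗[F] A) (p * d) ∧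
      ∃ (L : Type) (_ : Field L) (_ : Algebra F L), Algebra.IsSeparable F L ∧
        Module.finrank F L = d ∧
        ∃ (M : Type) (_ : Field M) (_ : Algebra F M) (_ : Algebra L M) (_ : Algebra K M)
          (_ : IsScalarTower F L M) (_ : IsScalarTower F K M),
          IsCompositum F L K M ∧
          ∃ (C : Type) (_ : Ring C) (_ : Algebra M C),
            IsCyclicPAlg p M C ∧ IsBrauerEquiv M (M ⊗[F] A) C

/-- `F` is `p`-reducible: for every central simple `F`-algebra `A` of exponent `p`
and every purely inseparable extension `K/F` with `K ^ p ⊆ F`, either `A_K` is split, or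
there is a separable extension `L/F` of degree `ind (A_K) / p` with `ind A_{LK} = p`. -/
def IsPReducible (p : ℕ) (F : Type) [Field F] : Prop :=
  ∀ (A : Type) [Ring A] [Algebra F A], IsCSA F A → HasExponent F A p →
  ∀ (K : Type) [Field K] [Algebra F K], IsPurelyInseparable F K →
    (∀ z : K, z ^ p ∈ (algebraMap F K).range) →
    IsSplitAlg K (K ⊗[F] A) ∨
    ∃ d : ℕ, HasIndex K (K ⊗[F] A) (p * d) ∧
      ∃ (L : Type) (_ : Field L) (_ : Algebra F L), Algebra.IsSeparable F L ∧
        Module.finrank F L = d ∧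
        ∃ (M : Type) (_ : Field M) (_ : Algebra F M) (_ : Algebra L M) (_ : Algebra K M)
          (_ : IsScalarTower F L M) (_ : IsScalarTower F K M),
          IsCompositum F L K M ∧ HasIndex M (M ⊗[F] A) p

section TensorSimple

variable (F A : Type*) [Field F] [Ring A] [Algebra F A]

/-- Every linear endomorphism of a central simple algebra is a sum of two-sided multiplications. -/
theorem mulLeftRight_surjective [Algebra.IsCentral F A] [IsSimpleRing A] [FiniteDimensional F A] :
    Function.Surjective (AlgHom.mulLeftRight F A) := by
  set R := (AlgHom.mulLeftRight F A).range with hR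
  have hmem : ∀ a b : A, AlgHom.mulLeftRight F A (a ⊗ₜ MulOpposite.op b) ∈ R := fun a b => ⟨_, rfl⟩
  have hsmul : ∀ a b x : A, (⟨_, hmem a b⟩ : R) • x = a * x * b := fun a b x => by
    change AlgHom.mulLeftRight F A (a ⊗ₜ MulOpposite.op b) x = _
    simp
  have hsimple : IsSimpleModule R A := by
    rw [isSimpleModule_iff, isSimpleOrder_iff_isCoatom_bot] 
    refine ⟨?_, fun N hN => ?_⟩
    · intro h
      have : (1 : A) ∈ (⊥ : Submodule R A) := h ▸ Submodule.mem_top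
      exact one_ne_zero ((Submodule.mem_bot R).1 this)
    · obtain ⟨x, hx, hx0⟩ := (Submodule.ne_bot_iff _).1 hN.ne'
      let I : TwoSidedIdeal A := TwoSidedIdeal.mk' (N : Set A) N.zero_mem (fun h h' => N.add_mem h h')
        (fun {x} h => by
          have := N.smul_mem (⟨_, hmem (-1) 1⟩ : R) h
          rwa [hsmul, mul_one, neg_one_mul] at this)
        (fun {x y} h => by
          have := N.smul_mem (⟨_, hmem x 1⟩ : R) h
          rwa [hsmul, mul_one] at this)
        (fun {x y} h => by
          have := N.smul_mem (⟨_, hmem 1 y⟩ : R) h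
          rwa [hsmul, one_mul] at this)
      have hI : ∀ y, y ∈ I ↔ y ∈ N := fun y => by
        simp [I]
      have hI1 : I = ⊤ := (eq_bot_or_eq_top I).resolve_left fun h => hx0 <| by
        have := (hI x).2 hx
        rw [h] at this
        simpa using this
      rw [eq_top_iff]
      intro y _
      rw [← hI, hI1]
      trivial
  intro f
  have hend : ∀ g : Module.End R A, ∃ c : F, ∀ x, g x = c • x := by
    intro g
    have h1 : ∀ x, g x = x * g 1 := fun x => by
      have := g.map_smul (⟨_, hmem x 1⟩ : R) 1
      rwa [hsmul, hsmul, mul_one, mul_one, mul_one] at this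
    have h2 : ∀ x, g x = g 1 * x := fun x => by
      have := g.map_smul (⟨_, hmem 1 x⟩ : R) 1
      rwa [hsmul, hsmul, mul_one, one_mul, one_mul] at this
    have h3 : g 1 ∈ Subalgebra.center F A := by
      rw [Subalgebra.mem_center_iff]
      intro b
      rw [← h1, ← h2]
    obtain ⟨c, hc⟩ := Algebra.mem_bot.1 (Algebra.IsCentral.out h3)
    exact ⟨c, fun x => by rw [h2, ← hc, Algebra.smul_def]⟩
  let f' : Module.End (Module.End R A) A :=
    { toFun := f
      map_add' := f.map_add
      map_smul' := fun g x => by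
        obtain ⟨c, hc⟩ := hend g
        simp [hc] }
  obtain ⟨s, hs⟩ := Module.Finite.fg_top (R := F) (M := A)
  obtain ⟨⟨r, hr⟩, h⟩ := jacobson_density (R := R) f' s
  obtain ⟨t, rfl⟩ := hr
  refine ⟨t, ?_⟩
  refine (LinearMap.ext_on (s := (s : Set A)) hs fun x hx => ?_).symm
  exact h x hx

variable (B : Type*) [Ring B] [Algebra F B]

/-- The tensor product of a central simple algebra and a simple algebra is simple. -/
instance isSimpleRing_tensorProduct [Algebra.IsCentral F A] [IsSimpleRing A] [FiniteDimensional F A]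
    [IsSimpleRing B] : IsSimpleRing (A ⊗[F] B) := by
  have hstab : ∀ (I : TwoSidedIdeal (A ⊗[F] B)) (φ : Module.End F A) (x : A ⊗[F] B), x ∈ I →
      TensorProduct.map φ LinearMap.id x ∈ I := by
    intro I φ x hx
    obtain ⟨t, rfl⟩ := mulLeftRight_surjective F A φ
    induction t with
    | zero => simp
    | add t u ht hu =>
      rw [map_add, TensorProduct.map_add_left]
      exact I.add_mem ht hu
    | tmul a b =>
      have : TensorProduct.map (AlgHom.mulLeftRight F A (a ⊗ₜ b)) LinearMap.id x =
          (a ⊗ₜ 1) * x * (b.unop ⊗ₜ 1) := by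
        clear hx
        induction x with
        | zero => simp
        | add x y hx hy => rw [map_add, mul_add, add_mul, hx, hy]
        | tmul x y => simp
      rw [this]
      exact I.mul_mem_right _ _ (I.mul_mem_left _ _ hx)
  rw [isSimpleRing_iff, isSimpleOrder_iff_isCoatom_bot]
  refine ⟨?_, fun I hI => ?_⟩
  · intro h
    have : (1 : A ⊗[F] B) ∈ (⊥ : TwoSidedIdeal (A ⊗[F] B)) := by rw [h]; trivial
    exact one_ne_zero ((TwoSidedIdeal.mem_bot _).1 this)
  · obtain ⟨x, hx, hx0⟩ : ∃ x ∈ I, x ≠ 0 := by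
      by_contra! hc
      exact hI.ne' (le_bot_iff.1 fun x hx => (TwoSidedIdeal.mem_bot _).2 (hc x hx))
    let b := Module.Free.chooseBasis F A
    obtain ⟨i, hi⟩ : ∃ i, TensorProduct.equivFinsuppOfBasisLeft (N := B) b x i ≠ 0 := by
      by_contra! hc
      exact hx0 ((TensorProduct.equivFinsuppOfBasisLeft (N := B) b).map_eq_zero_iff.1
        (Finsupp.ext hc))
    have key := hstab I ((LinearMap.toSpanSingleton F A 1).comp (b.coord i)) x hx
    have heq : TensorProduct.map ((LinearMap.toSpanSingleton F A 1).comp (b.coord i))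
        LinearMap.id x = (1 : A) ⊗ₜ[F] TensorProduct.equivFinsuppOfBasisLeft (N := B) b x i := by
      clear hx hx0 hi key
      induction x with
      | zero => simp
      | add x y hx hy => rw [map_add, map_add, Finsupp.add_apply, TensorProduct.tmul_add, hx, hy]
      | tmul x y => simp [TensorProduct.smul_tmul]
    rw [heq] at key
    let J : TwoSidedIdeal B :=
      TwoSidedIdeal.comap (Algebra.TensorProduct.includeRight : B →ₐ[F] A ⊗[F] B) I
    have hJ : J = ⊤ := (eq_bot_or_eq_top J).resolve_left fun h => hi <| by
      have : TensorProduct.equivFinsuppOfBasisLeft (N := B) b x i ∈ J := by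
        rw [TwoSidedIdeal.mem_comap]
        exact key
      rwa [h, TwoSidedIdeal.mem_bot] at this
    have h1 : (1 : B) ∈ J := by rw [hJ]; trivial
    rw [TwoSidedIdeal.mem_comap, map_one] at h1
    exact I.one_mem_iff.1 h1

instance isCentral_tensorProduct [Algebra.IsCentral F A] [Algebra.IsCentral F B] :
    Algebra.IsCentral F (A ⊗[F] B) := by
  refine ⟨fun z hz => ?_⟩
  rw [Subalgebra.mem_center_iff] at hz
  let b := Module.Free.chooseBasis F B
  have hl : ∀ (a : A) (z : A ⊗[F] B) i, TensorProduct.equivFinsuppOfBasisRight (M := A) b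
      ((a ⊗ₜ 1) * z) i = a * TensorProduct.equivFinsuppOfBasisRight (M := A) b z i := by
    intro a z i
    induction z with
    | zero => simp
    | add x y hx hy => rw [mul_add, map_add, map_add, Finsupp.add_apply, Finsupp.add_apply, hx, hy,
        mul_add]
    | tmul x y => simp
  have hr : ∀ (a : A) (z : A ⊗[F] B) i, TensorProduct.equivFinsuppOfBasisRight (M := A) b
      (z * (a ⊗ₜ 1)) i = TensorProduct.equivFinsuppOfBasisRight (M := A) b z i * a := by
    intro a z i
    induction z with
    | zero => simp
    | add x y hx hy => rw [add_mul, map_add, map_add, Finsupp.add_apply, Finsupp.add_apply, hx, hy,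
        add_mul]
    | tmul x y => simp
  have hc : ∀ i, ∃ c : F, algebraMap F A c = TensorProduct.equivFinsuppOfBasisRight (M := A) b z i := by
    intro i
    refine Algebra.mem_bot.1 (Algebra.IsCentral.out (K := F) ?_)
    rw [Subalgebra.mem_center_iff]
    intro a
    rw [← hl, ← hr, hz]
  choose c hc using hc
  obtain ⟨y, rfl⟩ : ∃ y : B, z = 1 ⊗ₜ y := by
    have h := (TensorProduct.equivFinsuppOfBasisRight (M := A) b).symm_apply_apply z
    rw [TensorProduct.equivFinsuppOfBasisRight_symm_apply] at h
    refine ⟨(TensorProduct.equivFinsuppOfBasisRight (M := A) b z).sum fun i _ => c i • b i, ?_⟩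
    rw [Finsupp.sum, TensorProduct.tmul_sum]
    refine h.symm.trans ?_
    refine Finset.sum_congr rfl fun i _ => ?_
    rw [← hc, Algebra.algebraMap_eq_smul_one]
    exact TensorProduct.smul_tmul _ _ _
  nontriviality A ⊗[F] B
  have : Nontrivial A := by
    by_contra hA
    rw [not_nontrivial_iff_subsingleton] at hA
    exact not_subsingleton (A ⊗[F] B) inferInstance
  have hy : y ∈ Subalgebra.center F B := by
    rw [Subalgebra.mem_center_iff]
    intro x
    have := hz (1 ⊗ₜ x)
    rw [Algebra.TensorProduct.tmul_mul_tmul, Algebra.TensorProduct.tmul_mul_tmul] at this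
    exact Algebra.TensorProduct.includeRight_injective
      (FaithfulSMul.algebraMap_injective F A) (by simpa using this)
  obtain ⟨d, rfl⟩ := Algebra.mem_bot.1 (Algebra.IsCentral.out hy)
  exact Algebra.mem_bot.2 ⟨d, by
    rw [Algebra.TensorProduct.algebraMap_apply, Algebra.algebraMap_eq_smul_one,
      Algebra.algebraMap_eq_smul_one, TensorProduct.smul_tmul]⟩

end TensorSimple

section BaseChange

variable (F K A : Type*) [Field F] [Field K] [Algebra F K] [Ring A] [Algebra F A]

/-- Simplicity transfers along ring isomorphisms. -/
theorem isSimpleRing_of_ringEquiv {A B : Type*} [Ring A] [Ring B] [IsSimpleRing A] (e : A ≃+* B) :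
    IsSimpleRing B :=
  ⟨OrderIso.isSimpleOrder (RingEquiv.mapTwoSidedIdeal e).symm⟩

instance isSimpleRing_baseChange [Algebra.IsCentral F A] [IsSimpleRing A] [FiniteDimensional F A] :
    IsSimpleRing (K ⊗[F] A) :=
  isSimpleRing_of_ringEquiv (Algebra.TensorProduct.comm F A K).toRingEquiv

instance isCentral_baseChange [Algebra.IsCentral F A] : Algebra.IsCentral K (K ⊗[F] A) := by
  refine ⟨fun z hz => ?_⟩
  rw [Subalgebra.mem_center_iff] at hz
  let b := Module.Free.chooseBasis F K
  have hl : ∀ (a : A) (z : K ⊗[F] A) i, TensorProduct.equivFinsuppOfBasisLeft (N := A) b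
      ((1 ⊗ₜ a) * z) i = a * TensorProduct.equivFinsuppOfBasisLeft (N := A) b z i := by
    intro a z i
    induction z with
    | zero => simp
    | add x y hx hy => rw [mul_add, map_add, map_add, Finsupp.add_apply, Finsupp.add_apply, hx, hy,
        mul_add]
    | tmul x y => simp
  have hr : ∀ (a : A) (z : K ⊗[F] A) i, TensorProduct.equivFinsuppOfBasisLeft (N := A) b
      (z * (1 ⊗ₜ a)) i = TensorProduct.equivFinsuppOfBasisLeft (N := A) b z i * a := by
    intro a z i
    induction z with
    | zero => simp
    | add x y hx hy => rw [add_mul, map_add, map_add, Finsupp.add_apply, Finsupp.add_apply, hx, hy,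
        add_mul]
    | tmul x y => simp
  have hc : ∀ i, ∃ c : F,
      algebraMap F A c = TensorProduct.equivFinsuppOfBasisLeft (N := A) b z i := by
    intro i
    refine Algebra.mem_bot.1 (Algebra.IsCentral.out (K := F) ?_)
    rw [Subalgebra.mem_center_iff]
    intro a
    rw [← hl, ← hr, hz]
  choose c hc using hc
  have h := (TensorProduct.equivFinsuppOfBasisLeft (N := A) b).symm_apply_apply z
  rw [TensorProduct.equivFinsuppOfBasisLeft_symm_apply] at h
  refine Algebra.mem_bot.2
    ⟨(TensorProduct.equivFinsuppOfBasisLeft (N := A) b z).sum fun i _ => c i • b i, ?_⟩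
  rw [Algebra.TensorProduct.algebraMap_apply, Algebra.algebraMap_self, RingHom.id_apply,
    Finsupp.sum, TensorProduct.sum_tmul]
  refine Eq.trans ?_ h
  refine Finset.sum_congr rfl fun i _ => ?_
  change _ = b i ⊗ₜ[F] _
  rw [← hc, Algebra.algebraMap_eq_smul_one, ← TensorProduct.smul_tmul]

variable {F A}

/-- A homomorphism from a simple algebra to an algebra of the same dimension is bijective. -/
theorem bijective_of_finrank_eq {B : Type*} [Ring B] [Algebra F B] [IsSimpleRing A] [Nontrivial B]
    [FiniteDimensional F A] [FiniteDimensional F B]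
    (f : A →ₐ[F] B) (h : Module.finrank F A = Module.finrank F B) : Function.Bijective f := by
  have hi : Function.Injective f.toLinearMap := RingHom.injective (f : A →+* B)
  exact ⟨hi, (LinearMap.injective_iff_surjective_of_finrank_eq_finrank h).1 hi⟩

end BaseChange

section Br

variable (F : Type) [Field F]

/-- The Brauer group of a field, as a set of classes of central simple algebras. -/
def Br : Type 1 := BrauerGroup.{0, 0} F

variable (A B C : Type) [Ring A] [Algebra F A] [Ring B] [Algebra F B] [Ring C] [Algebra F C]
  [Algebra.IsCentral F A] [IsSimpleRing A] [FiniteDimensional F A]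
  [Algebra.IsCentral F B] [IsSimpleRing B] [FiniteDimensional F B]
  [Algebra.IsCentral F C] [IsSimpleRing C] [FiniteDimensional F C]

namespace Br

/-- The Brauer class of a central simple algebra. -/
def mk : Br F := Quotient.mk (Brauer.CSA_Setoid F) ⟨AlgCat.of F A⟩

variable {F A B C}

theorem mk_eq_iff : mk F A = mk F B ↔ IsBrauerEquiv F A B := by
  constructor
  · intro h
    obtain ⟨n, m, hn, hm, e⟩ := Quotient.exact h
    exact ⟨n, m, Nat.pos_of_ne_zero hn, Nat.pos_of_ne_zero hm, e⟩
  · rintro ⟨n, m, hn, hm, e⟩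
    exact Quotient.sound ⟨n, m, hn.ne', hm.ne', e⟩

theorem mk_congr (e : A ≃ₐ[F] B) : mk F A = mk F B :=
  mk_eq_iff.2 ⟨1, 1, one_pos, one_pos, ⟨e.mapMatrix⟩⟩

@[elab_as_elim]
theorem ind {P : Br F → Prop} (h : ∀ (A : Type) [Ring A] [Algebra F A] [Algebra.IsCentral F A]
    [IsSimpleRing A] [FiniteDimensional F A], P (mk F A)) (x : Br F) : P x := by
  induction x using Quotient.inductionOn with
  | h X => exact h X

theorem mk_matrix (n : Type) [Fintype n] [DecidableEq n] [Nonempty n] :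
    mk F (Matrix n n A) = mk F A := by
  refine mk_eq_iff.2 ⟨1, Fintype.card n, one_pos, Fintype.card_pos, ⟨?_⟩⟩
  exact (Matrix.compAlgEquiv (Fin 1) n A F).trans
    (Matrix.reindexAlgEquiv F A ((Equiv.uniqueProd n (Fin 1)).trans (Fintype.equivFin n)))

theorem isBrauerEquiv_tensor {A A' B B' : Type} [Ring A] [Ring A'] [Ring B] [Ring B']
    [Algebra F A] [Algebra F A'] [Algebra F B] [Algebra F B']
    (h : IsBrauerEquiv F A A') (h' : IsBrauerEquiv F B B') :
    IsBrauerEquiv F (A ⊗[F] B) (A' ⊗[F] B') := by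
  obtain ⟨n, m, hn, hm, ⟨e⟩⟩ := h
  obtain ⟨n', m', hn', hm', ⟨e'⟩⟩ := h'
  refine ⟨n * n', m * m', Nat.mul_pos hn hn', Nat.mul_pos hm hm', ⟨?_⟩⟩
  exact (Matrix.reindexAlgEquiv F _ finProdFinEquiv).symm.trans <|
    (Matrix.kroneckerTMulAlgEquiv (Fin n) (Fin n') F F A B).symm.trans <|
    (Algebra.TensorProduct.congr e e').trans <|
    (Matrix.kroneckerTMulAlgEquiv (Fin m) (Fin m') F F A' B').trans
    (Matrix.reindexAlgEquiv F _ finProdFinEquiv)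

noncomputable instance : Add (Br F) where
  add := Quotient.map₂ (fun A B => (⟨AlgCat.of F (A ⊗[F] B)⟩ : CSA F)) <| by
    intro A A' h B B' h'
    exact Quotient.exact (mk_eq_iff.2
      (isBrauerEquiv_tensor (mk_eq_iff.1 (Quotient.sound h : mk F A = mk F A'))
        (mk_eq_iff.1 (Quotient.sound h' : mk F B = mk F B'))))

theorem mk_add_mk : mk F A + mk F B = mk F (A ⊗[F] B) := rfl

noncomputable instance : Zero (Br F) where
  zero := mk F F

theorem mk_opposite_congr (h : mk F A = mk F B) : mk F Aᵐᵒᵖ = mk F Bᵐᵒᵖ := by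
  obtain ⟨n, m, hn, hm, ⟨e⟩⟩ := mk_eq_iff.1 h
  exact mk_eq_iff.2 ⟨n, m, hn, hm, ⟨AlgEquiv.mopMatrix.trans <| e.op.trans AlgEquiv.mopMatrix.symm⟩⟩

noncomputable instance : Neg (Br F) where
  neg := Quotient.map (fun A => (⟨AlgCat.of F Aᵐᵒᵖ⟩ : CSA F)) <| by
    intro A B h
    exact Quotient.exact (mk_opposite_congr (Quotient.sound h : mk F A = mk F B))

theorem neg_mk : -mk F A = mk F Aᵐᵒᵖ := rfl

theorem mk_matrix_self (n : Type) [Fintype n] [DecidableEq n] [Nonempty n] :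
    mk F (Matrix n n F) = 0 := mk_matrix n

theorem mk_eq_zero_of_matrix {n : Type} [Fintype n] [DecidableEq n] [Nonempty n]
    (e : A ≃ₐ[F] Matrix n n F) : mk F A = 0 :=
  (mk_congr e).trans (mk_matrix_self n)

theorem mk_eq_zero_of_end {V : Type} [AddCommGroup V] [Module F V] [FiniteDimensional F V]
    [Nontrivial V] (e : A ≃ₐ[F] Module.End F V) : mk F A = 0 :=
  have : Nonempty (Module.Free.ChooseBasisIndex F V) :=
    (Module.Free.chooseBasis F V).index_nonempty
  mk_eq_zero_of_matrix (e.trans (algEquivMatrix (Module.Free.chooseBasis F V)))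

/-- A central simple algebra acting on a vector space `V` with `dim A = (dim V) ^ 2` is split. -/
theorem mk_eq_zero_of_action {V : Type} [AddCommGroup V] [Module F V] [FiniteDimensional F V]
    [Nontrivial V] (f : A →ₐ[F] Module.End F V)
    (h : Module.finrank F A = Module.finrank F V ^ 2) : mk F A = 0 :=
  mk_eq_zero_of_end (AlgEquiv.ofBijective f (bijective_of_finrank_eq f (by
    rw [h, Module.finrank_linearMap, sq])))

noncomputable instance : AddCommGroup (Br F) where
  add_assoc x y z := by
    induction x using ind with | h A =>
    induction y using ind with | h B =>
    induction z using ind with | h C =>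
    simp only [mk_add_mk]
    exact mk_congr (Algebra.TensorProduct.assoc F F F A B C)
  zero_add x := by
    induction x using ind with | h A =>
    exact mk_congr (Algebra.TensorProduct.lid F A)
  add_zero x := by
    induction x using ind with | h A =>
    exact mk_congr (Algebra.TensorProduct.rid F F A)
  neg_add_cancel x := by
    induction x using ind with | h A =>
    rw [neg_mk, mk_add_mk, mk_congr (Algebra.TensorProduct.comm F Aᵐᵒᵖ A)]
    refine mk_eq_zero_of_action (V := A) (AlgHom.mulLeftRight F A) ?_
    rw [Module.finrank_tensorProduct, sq]
    congr 1
    exact (MulOpposite.opLinearEquiv F).symm.finrank_eq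
  add_comm x y := by
    induction x using ind with | h A =>
    induction y using ind with | h B =>
    exact mk_congr (Algebra.TensorProduct.comm F A B)
  nsmul := nsmulRec
  zsmul := zsmulRec

end Br

end Br

namespace Br

section Split

variable {F : Type} [Field F]

/-- If a matrix algebra over a division algebra `D` is split, then `D` is trivial. -/
theorem algebraMap_bijective_of_matrix_equiv {D : Type*} [DivisionRing D] [Algebra F D] {n m : ℕ}
    [NeZero m] (e : Matrix (Fin n) (Fin n) D ≃ₐ[F] Matrix (Fin m) (Fin m) F) :
    Function.Bijective (algebraMap F D) := by
  refine ⟨FaithfulSMul.algebraMap_injective F D, ?_⟩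
  let u : Matrix (Fin m) (Fin m) F := Matrix.single 0 0 1
  have hu : ∀ x, u * x * u = x 0 0 • u := fun x => by
    ext i j
    simp [u, Matrix.single_mul_mul_single, Matrix.single_apply]
  have hu0 : u ≠ 0 := fun h => one_ne_zero (α := F) (by simpa [u] using congrFun (congrFun h 0) 0)
  set v := e.symm u with hv
  have hv0 : v ≠ 0 := fun h => hu0 (by simpa [v] using h)
  have hvx : ∀ x, v * x * v = (e x) 0 0 • v := fun x => by
    apply e.injective
    simp [v, hu]
  obtain ⟨i, j, hij⟩ : ∃ i j, v i j ≠ 0 := by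
    by_contra! h
    exact hv0 (Matrix.ext h)
  have key : ∀ d : D, ∃ c : F, d = algebraMap F D c * (v i j)⁻¹ := by
    intro d
    have h := congrFun (congrFun (hvx (Matrix.single j i d)) i) j
    rw [Matrix.smul_apply, Matrix.mul_assoc, Matrix.mul_apply] at h
    rw [Finset.sum_eq_single j (by
      intro k _ hk
      rw [Matrix.single_mul_apply_of_ne _ _ _ _ _ hk, mul_zero]) (by simp)] at h
    rw [Matrix.single_mul_apply_same, Algebra.smul_def, ← mul_assoc] at h
    have h2 := mul_right_cancel₀ hij h
    refine ⟨e (Matrix.single j i d) 0 0, ?_⟩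
    rw [Algebra.commutes, ← h2, inv_mul_cancel_left₀ hij]
  obtain ⟨c, hc⟩ := key 1
  intro d
  obtain ⟨c', rfl⟩ := key d
  refine ⟨c' * c⁻¹, ?_⟩
  have : (v i j)⁻¹ = algebraMap F D c⁻¹ := by
    rw [map_inv₀]
    exact eq_inv_of_mul_eq_one_right hc.symm
  rw [this, map_mul]

variable {A : Type} [Ring A] [Algebra F A] [Algebra.IsCentral F A] [IsSimpleRing A]
  [FiniteDimensional F A]

theorem isSplitAlg_of_mk_eq_zero (h : mk F A = 0) : IsSplitAlg F A := by
  obtain ⟨N, m, hN, hm, ⟨e⟩⟩ := mk_eq_iff.1 h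
  have : IsArtinianRing A := IsArtinianRing.of_finite F A
  obtain ⟨k, hk, D, _, _, _, ⟨f⟩⟩ :=
    IsSimpleRing.exists_algEquiv_matrix_divisionRing_finite F A
  have : NeZero m := ⟨hm.ne'⟩
  have hb := algebraMap_bijective_of_matrix_equiv (D := D)
    ((Matrix.reindexAlgEquiv F D (finProdFinEquiv (m := N) (n := k))).symm.trans <|
      (Matrix.compAlgEquiv (Fin N) (Fin k) D F).symm.trans <| f.symm.mapMatrix.trans e)
  exact ⟨k, Nat.pos_of_ne_zero hk.1,
    ⟨f.trans (AlgEquiv.ofBijective (Algebra.ofId F D) hb).symm.mapMatrix⟩⟩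

end Split

section Res

variable {F K L : Type} [Field F] [Field K] [Field L]

theorem isBrauerEquiv_baseChange {F K A B : Type} [Field F] [Field K] [Algebra F K]
    [Ring A] [Ring B] [Algebra F A] [Algebra F B] (h : IsBrauerEquiv F A B) :
    IsBrauerEquiv K (K ⊗[F] A) (K ⊗[F] B) := by
  obtain ⟨n, m, hn, hm, ⟨e⟩⟩ := h
  have key : ∀ (C : Type) [Ring C] [Algebra F C] (k : ℕ),
      Nonempty (Matrix (Fin k) (Fin k) (K ⊗[F] C) ≃ₐ[K] K ⊗[F] Matrix (Fin k) (Fin k) C) := by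
    intro C _ _ k
    let a : K ≃ₐ[K] Matrix Unit Unit K := (Matrix.uniqueAlgEquiv (m := Unit) (R := K)).symm
    exact ⟨(Matrix.reindexAlgEquiv K (K ⊗[F] C) (Equiv.uniqueProd (Fin k) Unit)).symm.trans <|
      (Matrix.kroneckerTMulAlgEquiv Unit (Fin k) F K K C).symm.trans
      (Algebra.TensorProduct.congr a.symm AlgEquiv.refl)⟩
  exact ⟨n, m, hn, hm, ⟨(key A n).some.trans <|
    (Algebra.TensorProduct.congr AlgEquiv.refl e).trans (key B m).some.symm⟩⟩

/-- The map on Brauer groups given by extension of scalars along an algebra structure. -/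
noncomputable def resAlg (F K : Type) [Field F] [Field K] [Algebra F K] : Br F →+ Br K :=
  AddMonoidHom.mk' (Quotient.map (fun A => (⟨AlgCat.of K (K ⊗[F] A)⟩ : CSA K)) (by
      intro A B h
      exact Quotient.exact (mk_eq_iff.2
        (isBrauerEquiv_baseChange (mk_eq_iff.1 (Quotient.sound h : mk F A = mk F B)))))) (by
    intro x y
    induction x using ind with | h A =>
    induction y using ind with | h B =>
    change mk K (K ⊗[F] (A ⊗[F] B)) = mk K ((K ⊗[F] A) ⊗[K] (K ⊗[F] B))
    refine (mk_congr ?_).symm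
    exact (Algebra.TensorProduct.tensorTensorTensorComm F F K K K A K B).trans
      (Algebra.TensorProduct.congr (Algebra.TensorProduct.lid K K) AlgEquiv.refl))

/-- The map on Brauer groups induced by a homomorphism of fields. -/
noncomputable def res (f : F →+* K) : Br F →+ Br K :=
  letI := f.toAlgebra
  resAlg F K

theorem res_algebraMap [Algebra F K] : res (algebraMap F K) = resAlg F K := by
  have : (algebraMap F K).toAlgebra = ‹Algebra F K› := Algebra.algebra_ext _ _ fun _ => rfl
  unfold res
  rw [this]

theorem res_mk [Algebra F K] (A : Type) [Ring A] [Algebra F A] [Algebra.IsCentral F A]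
    [IsSimpleRing A] [FiniteDimensional F A] :
    res (algebraMap F K) (mk F A) = mk K (K ⊗[F] A) := by
  rw [res_algebraMap]
  rfl

theorem res_comp (f : F →+* K) (g : K →+* L) (x : Br F) : res (g.comp f) x = res g (res f x) := by
  let := f.toAlgebra
  let := g.toAlgebra
  let := (g.comp f).toAlgebra
  have : IsScalarTower F K L := IsScalarTower.of_algebraMap_eq fun _ => rfl
  induction x using ind with | h A =>
  change res (algebraMap F L) _ = res (algebraMap K L) (res (algebraMap F K) _)
  rw [res_mk, res_mk, res_mk]
  exact mk_congr ((Algebra.TensorProduct.congr (Algebra.TensorProduct.rid K L L).symm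
    AlgEquiv.refl).trans (Algebra.TensorProduct.assoc F K L L K A))

end Res

end Br

namespace Br

section PiTensor

variable {F : Type*} [Field F]

theorem finrank_piTensorProduct {ι : Type*} [Fintype ι] (D : ι → Type*) [∀ i, AddCommGroup (D i)]
    [∀ i, Module F (D i)] [∀ i, FiniteDimensional F (D i)] :
    Module.finrank F (⨂[F] i, D i) = ∏ i, Module.finrank F (D i) := by
  classical
  rw [Module.finrank_eq_card_basis
    (Basis.piTensorProduct fun i => Module.finBasis F (D i)), Fintype.card_pi]
  simp

instance finiteDimensional_piTensorProduct {ι : Type*} [Finite ι] (D : ι → Type*)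
    [∀ i, AddCommGroup (D i)] [∀ i, Module F (D i)] [∀ i, FiniteDimensional F (D i)] :
    FiniteDimensional F (⨂[F] i, D i) :=
  Module.Finite.of_basis (Basis.piTensorProduct fun i => Module.finBasis F (D i))

/-- Splitting off the first factor of a tensor product of algebras. -/
noncomputable def piTensorSucc {k : ℕ} (D : Fin (k + 1) → Type*) [∀ i, Ring (D i)]
    [∀ i, Algebra F (D i)] :
    (⨂[F] i, D i) →ₐ[F] D 0 ⊗[F] (⨂[F] i : Fin k, D i.succ) :=
  PiTensorProduct.liftAlgHom
    (LinearMap.uncurryLeft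
      { toFun := fun a => (TensorProduct.mk F (D 0) (⨂[F] i : Fin k, D i.succ) a).compMultilinearMap
          (PiTensorProduct.tprod F)
        map_add' := fun a b => by ext; simp
        map_smul' := fun c a => by ext; simp [TensorProduct.smul_tmul'] })
    rfl
    (fun x y => by
      simp only [LinearMap.uncurryLeft_apply, LinearMap.coe_mk, AddHom.coe_mk,
        LinearMap.compMultilinearMap_apply, TensorProduct.mk_apply,
        Algebra.TensorProduct.tmul_mul_tmul, PiTensorProduct.tprod_mul_tprod]
      rfl)

theorem piTensorSucc_tprod {k : ℕ} (D : Fin (k + 1) → Type*) [∀ i, Ring (D i)]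
    [∀ i, Algebra F (D i)] (x : ∀ i, D i) :
    piTensorSucc (F := F) D (PiTensorProduct.tprod F x) =
      x 0 ⊗ₜ PiTensorProduct.tprod F (Fin.tail x) := by
  exact PiTensorProduct.lift.tprod _

theorem piTensorSucc_bijective {k : ℕ} (D : Fin (k + 1) → Type*) [∀ i, Ring (D i)]
    [∀ i, Algebra F (D i)] [∀ i, FiniteDimensional F (D i)] :
    Function.Bijective (piTensorSucc (F := F) D) := by
  have hs : Function.Surjective (piTensorSucc (F := F) D).toLinearMap := by
    rw [← LinearMap.range_eq_top, eq_top_iff]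
    rintro z -
    induction z with
    | zero => exact zero_mem _
    | add x y hx hy => exact add_mem hx hy
    | tmul a y =>
      induction y using PiTensorProduct.induction_on with
      | add x y hx hy => rw [TensorProduct.tmul_add]; exact add_mem hx hy
      | smul_tprod r y =>
        rw [TensorProduct.tmul_smul]
        refine Submodule.smul_mem _ _ ⟨PiTensorProduct.tprod F (Fin.cons a y), ?_⟩
        exact (piTensorSucc_tprod D _).trans (by simp)
  refine ⟨(LinearMap.injective_iff_surjective_of_finrank_eq_finrank ?_).2 hs, hs⟩
  rw [finrank_piTensorProduct, Module.finrank_tensorProduct, finrank_piTensorProduct,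
    Fin.prod_univ_succ]

end PiTensor

variable {F : Type} [Field F]

theorem piTensor_csa : ∀ (k : ℕ) (D : Fin k → Type) [∀ i, Ring (D i)] [∀ i, Algebra F (D i)]
    [∀ i, Algebra.IsCentral F (D i)] [∀ i, IsSimpleRing (D i)] [∀ i, FiniteDimensional F (D i)],
    ∃ (_ : Algebra.IsCentral F (⨂[F] i, D i)) (_ : IsSimpleRing (⨂[F] i, D i)),
      mk F (⨂[F] i, D i) = ∑ i, mk F (D i) := by
  intro k
  induction k with
  | zero =>
    intro D _ _ _ _ _
    have hb : Function.Bijective (Algebra.ofId F (⨂[F] i, D i)) := by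
      have : Nontrivial (⨂[F] i, D i) := Module.nontrivial_of_finrank_pos (R := F) (by
        rw [finrank_piTensorProduct]; simp)
      refine bijective_of_finrank_eq _ ?_
      rw [finrank_piTensorProduct]
      simp
    let e := AlgEquiv.ofBijective _ hb
    have h1 : Algebra.IsCentral F (⨂[F] i, D i) := Algebra.IsCentral.of_algEquiv F _ _ e
    have h2 : IsSimpleRing (⨂[F] i, D i) := isSimpleRing_of_ringEquiv e.toRingEquiv
    refine ⟨h1, h2, ?_⟩
    rw [← mk_congr e, Finset.univ_eq_empty, Finset.sum_empty]
    rfl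
  | succ k ih =>
    intro D _ _ _ _ _
    obtain ⟨h1, h2, h3⟩ := ih fun i => D i.succ
    let e := (AlgEquiv.ofBijective _ (piTensorSucc_bijective (F := F) D)).symm
    have h1 : Algebra.IsCentral F (⨂[F] i, D i) := Algebra.IsCentral.of_algEquiv F _ _ e
    have h2 : IsSimpleRing (⨂[F] i, D i) := isSimpleRing_of_ringEquiv e.toRingEquiv
    refine ⟨h1, h2, ?_⟩
    rw [← mk_congr e, Fin.sum_univ_succ, ← h3, mk_add_mk]

end Br

open Polynomial in
/-- A polynomial of degree less than `p` in characteristic `p` that is invariant under the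
translation `X ↦ X - 1` is constant. -/
theorem Polynomial.eq_C_of_comp_X_sub_one {p : ℕ} [Fact p.Prime] {F : Type*} [Field F] [CharP F p]
    {f : F[X]} (hd : f.natDegree < p) (hf : f.comp (X - 1) = f) : f = C (f.eval 0) := by
  have h1 : ∀ x, f.eval (x + 1) = f.eval x := fun x => by
    conv_lhs => rw [← hf]
    simp
  have h2 : ∀ n : ℕ, f.eval (n : F) = f.eval 0 := fun n => by
    induction n with
    | zero => simp
    | succ n ih => rw [Nat.cast_succ, h1, ih]
  rw [← sub_eq_zero]
  refine eq_zero_of_natDegree_lt_card_of_eval_eq_zero _ (f := fun i : Fin p => ((i : ℕ) : F)) ?_ ?_ ?_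
  · intro i j hij
    exact Fin.ext (CharP.natCast_injOn_Iio F p i.2 j.2 hij)
  · intro i
    simp [h2]
  · rw [natDegree_sub_C, Fintype.card_fin]
    exact hd

/-- The defining relations of the cyclic algebra `[a, b)`, for a pair of elements of an algebra. -/
structure IsSymPair {F B : Type*} [Field F] [Ring B] [Algebra F B] (p : ℕ) (a b : F) (x y : B) :
    Prop where
  left : x ^ p - x = algebraMap F B a
  right : y ^ p = algebraMap F B b
  rel : y * x = (x - 1) * y

namespace IsSymPair

open Polynomial

variable {F B : Type*} [Field F] [Ring B] [Algebra F B] {p : ℕ} {a b : F} {x y : B}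

theorem map {C : Type*} [Ring C] [Algebra F C] (h : IsSymPair p a b x y) (f : B →ₐ[F] C) :
    IsSymPair p a b (f x) (f y) where
  left := by simpa using congrArg f h.left
  right := by simpa using congrArg f h.right
  rel := by simpa using congrArg f h.rel

theorem mul_aeval (h : IsSymPair p a b x y) (f : F[X]) :
    y * aeval x f = aeval x (f.comp (X - 1)) * y := by
  have h0 : SemiconjBy y x (x - 1) := h.rel
  rw [aeval_comp]
  simp only [map_sub, aeval_X, map_one]
  induction f using Polynomial.induction_on' with
  | add f g hf hg => simp [mul_add, add_mul, hf, hg]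
  | monomial n c =>
    rw [aeval_monomial, aeval_monomial, ← mul_assoc, ← Algebra.commutes, mul_assoc,
      (h0.pow_right n).eq, mul_assoc]

theorem pow_mul_left (h : IsSymPair p a b x y) (n : ℕ) : y ^ n * x = (x - n) * y ^ n := by
  induction n with
  | zero => simp
  | succ n ih =>
    rw [pow_succ', mul_assoc, ih, ← mul_assoc, mul_sub, h.rel, ← (Nat.cast_commute n y).eq,
      ← sub_mul, Nat.cast_succ, mul_assoc]
    congr 1
    abel

theorem comm_mul (h : IsSymPair p a b x y) (f : F[X]) (n : ℕ) :
    x * (aeval x f * y ^ n) - aeval x f * y ^ n * x = (n : F) • (aeval x f * y ^ n) := by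
  have hc : x * aeval x f = aeval x f * x := by
    simpa using ((Commute.all (X : F[X]) f).map (aeval x)).eq
  rw [mul_assoc, h.pow_mul_left, ← mul_assoc, hc, ← mul_assoc, ← sub_mul, mul_sub, sub_sub_cancel,
    ← (Nat.cast_commute _ _).eq, Algebra.smul_def, map_natCast, mul_assoc]

theorem isUnit_right [hp : Fact p.Prime] (h : IsSymPair p a b x y) (hb : b ≠ 0) : IsUnit y := by
  have h1 : IsUnit (y ^ p) := by
    rw [h.right]
    exact hb.isUnit.map _
  exact (isUnit_pow_iff hp.out.ne_zero).1 h1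

theorem aeval_poly (h : IsSymPair p a b x y) : aeval x (X ^ p - X - C a : F[X]) = 0 := by
  simp [h.left]

theorem monic_poly [hp : Fact p.Prime] (a : F) : (X ^ p - X - C a : F[X]).Monic := by
  rw [sub_sub]
  refine monic_X_pow_sub ?_
  rw [degree_X_add_C]
  exact_mod_cast hp.out.one_lt

theorem degree_poly [hp : Fact p.Prime] (a : F) : (X ^ p - X - C a : F[X]).degree = p := by
  rw [sub_sub, degree_sub_eq_left_of_degree_lt, degree_X_pow]
  rw [degree_X_add_C, degree_X_pow]
  exact_mod_cast hp.out.one_lt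

variable (F p) in
/-- The parametrisation of the subalgebra generated by `x` and `y`. -/
noncomputable def param (x y : B) : (Fin p → degreeLT F p) →ₗ[F] B :=
  ∑ l : Fin p, (LinearMap.mulRight F (y ^ (l : ℕ))) ∘ₗ (aeval x).toLinearMap ∘ₗ
    (degreeLT F p).subtype ∘ₗ LinearMap.proj l

theorem param_apply (x y : B) (c : Fin p → degreeLT F p) :
    param F p x y c = ∑ l : Fin p, aeval x (c l : F[X]) * y ^ (l : ℕ) := by
  simp [param, LinearMap.sum_apply]

theorem finrank_param_domain : Module.finrank F (Fin p → degreeLT F p) = p ^ 2 := by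
  have : Module.Finite F (degreeLT F p) := Module.Finite.equiv (degreeLTEquiv F p).symm
  rw [Module.finrank_pi_fintype, (degreeLTEquiv F p).finrank_eq]
  simp [sq]

variable [Fact p.Prime] [CharP F p]

theorem eq_zero_of_aeval_eq_zero [Nontrivial B] (h : IsSymPair p a b x y) (hb : b ≠ 0) {f : F[X]}
    (hf : f.degree < p) (h0 : aeval x f = 0) : f = 0 := by
  have hx : IsIntegral F x := ⟨_, monic_poly (p := p) a, h.aeval_poly⟩
  set q := minpoly F x with hq
  have hm : q.Monic := minpoly.monic hx
  by_contra hne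
  have hlt : q.natDegree < p :=
    (natDegree_le_of_dvd (minpoly.dvd F x h0) hne).trans_lt ((natDegree_lt_iff_degree_lt hne).2 hf)
  have hd : (q.comp (X - 1)).natDegree = q.natDegree := by
    rw [natDegree_comp, ← C_1, natDegree_X_sub_C, mul_one]
  have hm' : (q.comp (X - 1)).Monic := by
    rw [← C_1]
    exact hm.comp_X_sub_C 1
  have hdvd : q ∣ q.comp (X - 1) := by
    refine minpoly.dvd F x ?_
    have := h.mul_aeval q
    rw [hq, minpoly.aeval, mul_zero] at this
    exact ((h.isUnit_right hb).mul_left_eq_zero).1 this.symm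
  have heq := eq_C_of_comp_X_sub_one hlt (eq_of_monic_of_dvd_of_natDegree_le hm hm' hdvd hd.le)
  refine minpoly.ne_one F x (hm.natDegree_eq_zero.1 ?_)
  rw [heq, natDegree_C]

theorem eq_zero_of_sum [Nontrivial B] (h : IsSymPair p a b x y) (hb : b ≠ 0) (c : Fin p → F[X])
    (h0 : ∑ l : Fin p, aeval x (c l) * y ^ (l : ℕ) = 0) (l : Fin p) : aeval x (c l) = 0 := by
  let ad : Module.End F B := LinearMap.mulLeft F x - LinearMap.mulRight F x
  have hind := (Module.End.eigenspaces_iSupIndep ad).comp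
    (f := fun i : Fin p => ((i : ℕ) : F))
    (fun i j hij => Fin.ext (CharP.natCast_injOn_Iio F p i.2 j.2 hij))
  rw [iSupIndep_iff_finsetSum_eq_zero_imp_eq_zero] at hind
  have := hind Finset.univ (fun l => aeval x (c l) * y ^ (l : ℕ)) (fun i _ => ?_) h0 l
    (Finset.mem_univ l)
  · exact (((h.isUnit_right hb).pow _).mul_left_eq_zero).1 this
  · simp only [Function.comp_apply, Module.End.mem_eigenspace_iff, ad, LinearMap.sub_apply,
      LinearMap.mulLeft_apply, LinearMap.mulRight_apply]
    exact h.comm_mul _ _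

theorem param_injective [Nontrivial B] (h : IsSymPair p a b x y) (hb : b ≠ 0) :
    Function.Injective (param F p x y) := by
  rw [← LinearMap.ker_eq_bot, LinearMap.ker_eq_bot']
  intro c hc
  rw [param_apply] at hc
  funext l
  exact Subtype.ext (h.eq_zero_of_aeval_eq_zero hb (mem_degreeLT.1 (c l).2)
    (h.eq_zero_of_sum hb _ hc l))

omit [CharP F p] in
theorem param_surjective (h : IsSymPair p a b x y) (hadj : Algebra.adjoin F {x, y} = ⊤) :
    Function.Surjective (param F p x y) := by
  have hp : 0 < p := Nat.Prime.pos Fact.out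
  have : NeZero p := ⟨hp.ne'⟩
  have hmem : ∀ (f : F[X]) (l : ℕ), aeval x f * y ^ l ∈ LinearMap.range (param F p x y) := by
    intro f l
    wlog hl : l < p generalizing l f
    · have hl' : l = l % p + p * (l / p) := (Nat.mod_add_div l p).symm
      rw [hl', pow_add, pow_mul, h.right, ← map_pow, ← Algebra.commutes, ← Algebra.smul_def,
        mul_smul_comm]
      exact Submodule.smul_mem _ _ (this _ _ (Nat.mod_lt _ hp))
    refine ⟨Pi.single ⟨l, hl⟩ ⟨f %ₘ (X ^ p - X - C a), ?_⟩, ?_⟩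
    · rw [mem_degreeLT, ← degree_poly (p := p) a]
      exact degree_modByMonic_lt _ (monic_poly a)
    · rw [param_apply, Finset.sum_eq_single ⟨l, hl⟩]
      · rw [Pi.single_eq_same, aeval_modByMonic_eq_self_of_root h.aeval_poly]
      · intro m _ hm
        simp [Pi.single_eq_of_ne hm]
      · simp
  have hx : ∀ w ∈ LinearMap.range (param F p x y), x * w ∈ LinearMap.range (param F p x y) := by
    rintro _ ⟨c, rfl⟩
    rw [param_apply, Finset.mul_sum]
    refine Submodule.sum_mem _ fun l _ => ?_
    have := hmem (X * (c l).1) l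
    rwa [map_mul, aeval_X, mul_assoc] at this
  have hy : ∀ w ∈ LinearMap.range (param F p x y), y * w ∈ LinearMap.range (param F p x y) := by
    rintro _ ⟨c, rfl⟩
    rw [param_apply, Finset.mul_sum]
    refine Submodule.sum_mem _ fun l _ => ?_
    rw [← mul_assoc, h.mul_aeval, mul_assoc, ← pow_succ']
    exact hmem _ _
  have key : ∀ z ∈ Algebra.adjoin F {x, y}, ∀ w ∈ LinearMap.range (param F p x y),
      z * w ∈ LinearMap.range (param F p x y) := by
    intro z hz
    induction hz using Algebra.adjoin_induction with
    | mem z hz =>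
      rcases hz with rfl | rfl
      exacts [hx, hy]
    | algebraMap r =>
      intro w hw
      rw [← Algebra.smul_def]
      exact Submodule.smul_mem _ _ hw
    | add u v _ _ hu hv =>
      intro w hw
      rw [add_mul]
      exact Submodule.add_mem _ (hu w hw) (hv w hw)
    | mul u v _ _ hu hv =>
      intro w hw
      rw [mul_assoc]
      exact hu _ (hv w hw)
  intro z
  have := key z (hadj ▸ Algebra.mem_top) 1 (by simpa using hmem 1 0)
  rwa [mul_one] at this

theorem bijective_param [Nontrivial B] (h : IsSymPair p a b x y) (hb : b ≠ 0)
    (hadj : Algebra.adjoin F {x, y} = ⊤) : Function.Bijective (param F p x y) :=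
  ⟨h.param_injective hb, h.param_surjective hadj⟩

omit [CharP F p] in
theorem finiteDimensional (h : IsSymPair p a b x y) (hadj : Algebra.adjoin F {x, y} = ⊤) :
    FiniteDimensional F B := by
  have : Module.Finite F (degreeLT F p) := Module.Finite.equiv (degreeLTEquiv F p).symm
  exact Module.Finite.of_surjective _ (h.param_surjective hadj)

theorem finrank_eq [Nontrivial B] (h : IsSymPair p a b x y) (hb : b ≠ 0)
    (hadj : Algebra.adjoin F {x, y} = ⊤) : Module.finrank F B = p ^ 2 := by
  rw [← (LinearEquiv.ofBijective _ (h.bijective_param hb hadj)).finrank_eq, finrank_param_domain]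

theorem adjoin_eq_top [Nontrivial B] [FiniteDimensional F B] (h : IsSymPair p a b x y) (hb : b ≠ 0)
    (hd : Module.finrank F B = p ^ 2) : Algebra.adjoin F {x, y} = ⊤ := by
  have : Module.Finite F (degreeLT F p) := Module.Finite.equiv (degreeLTEquiv F p).symm
  have hs : Function.Surjective (param F p x y) :=
    (LinearMap.injective_iff_surjective_of_finrank_eq_finrank
      (by rw [hd, finrank_param_domain])).1 (h.param_injective hb)
  rw [eq_top_iff]
  intro z _
  obtain ⟨c, rfl⟩ := hs z
  rw [param_apply]
  have hx : x ∈ Algebra.adjoin F {x, y} := Algebra.subset_adjoin (by simp)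
  have hy : y ∈ Algebra.adjoin F {x, y} := Algebra.subset_adjoin (by simp)
  refine Subalgebra.sum_mem _ fun l _ => Subalgebra.mul_mem _ ?_ (Subalgebra.pow_mem _ hy _)
  exact Algebra.adjoin_mono (by simp) (aeval_mem_adjoin_singleton F x)

theorem isSimpleRing [Nontrivial B] (h : IsSymPair p a b x y) (hb : b ≠ 0)
    (hadj : Algebra.adjoin F {x, y} = ⊤) : IsSimpleRing B := by
  refine isSimpleRing_iff_isTwoSided_imp.2 ⟨inferInstance, fun I _ => ?_⟩
  by_cases hI : I = ⊤
  · exact Or.inr hI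
  left
  have : Nontrivial (B ⧸ I) := Ideal.Quotient.nontrivial_iff.2 hI
  let π : B →ₐ[F] B ⧸ I := Ideal.Quotient.mkₐ F I
  have h1 := (h.map π).param_injective hb
  rw [eq_bot_iff]
  intro z hz
  obtain ⟨c, rfl⟩ := h.param_surjective hadj z
  have h2 : param F p (π x) (π y) c = π (param F p x y c) := by
    simp [param_apply, map_sum, aeval_algHom_apply]
  have h3 : π (param F p x y c) = 0 := Ideal.Quotient.eq_zero_iff_mem.2 hz
  rw [h3] at h2
  rw [h1 (h2.trans (map_zero _).symm), map_zero]
  exact Submodule.zero_mem _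

theorem isCentral [Nontrivial B] (h : IsSymPair p a b x y) (hb : b ≠ 0)
    (hadj : Algebra.adjoin F {x, y} = ⊤) : Algebra.IsCentral F B := by
  have hp : 0 < p := Nat.Prime.pos Fact.out
  refine ⟨fun z hz => ?_⟩
  rw [Subalgebra.mem_center_iff] at hz
  obtain ⟨c, rfl⟩ := h.param_surjective hadj z
  have hx := hz x
  rw [param_apply, Finset.mul_sum, Finset.sum_mul, ← sub_eq_zero, ← Finset.sum_sub_distrib] at hx
  have h1 : ∀ l : Fin p, ((l : ℕ) : F) • (c l : F[X]) = 0 := by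
    intro l
    refine h.eq_zero_of_aeval_eq_zero hb ?_ (h.eq_zero_of_sum hb
      (fun l => ((l : ℕ) : F) • (c l : F[X])) ?_ l)
    · exact mem_degreeLT.1 (Submodule.smul_mem _ _ (c l).2)
    · refine Eq.trans (Finset.sum_congr rfl fun l _ => ?_) hx
      rw [h.comm_mul, map_smul, smul_mul_assoc]
  have h2 : ∀ l : Fin p, l ≠ ⟨0, hp⟩ → (c l : F[X]) = 0 := by
    intro l hl
    refine (smul_eq_zero.1 (h1 l)).resolve_left fun h0 => hl (Fin.ext ?_)
    exact Nat.eq_zero_of_dvd_of_lt ((CharP.cast_eq_zero_iff F p l).1 h0) l.2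
  have h3 : param F p x y c = aeval x (c ⟨0, hp⟩ : F[X]) := by
    rw [param_apply, Finset.sum_eq_single ⟨0, hp⟩]
    · simp
    · intro l _ hl
      simp [h2 l hl]
    · simp
  rw [h3] at hz ⊢
  set f : F[X] := (c ⟨0, hp⟩).1 with hf
  have hfd : f.degree < p := mem_degreeLT.1 (c ⟨0, hp⟩).2
  have hfn : f.natDegree < p := by
    by_cases h0 : f = 0
    · simpa [h0] using hp
    · exact (natDegree_lt_iff_degree_lt h0).2 hfd
  have hy := hz y
  rw [h.mul_aeval] at hy
  have h4 : aeval x (f.comp (X - 1) - f) = 0 := by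
    rw [map_sub, sub_eq_zero]
    exact (h.isUnit_right hb).mul_right_cancel hy
  have h5 : f.comp (X - 1) - f = 0 := by
    refine h.eq_zero_of_aeval_eq_zero hb ((degree_sub_le _ _).trans_lt (max_lt ?_ hfd)) h4
    refine degree_le_natDegree.trans_lt ?_
    rw [natDegree_comp, ← C_1, natDegree_X_sub_C, mul_one]
    exact_mod_cast hfn
  rw [eq_C_of_comp_X_sub_one hfn (sub_eq_zero.1 h5), aeval_C]
  exact Subalgebra.algebraMap_mem _ _

end IsSymPair

/-- The relations of the cyclic algebra `[a, b)`; the generators are indexed by `Bool`. -/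
inductive SymRel {F : Type*} [Field F] (p : ℕ) (a b : F) :
    FreeAlgebra F Bool → FreeAlgebra F Bool → Prop
  | left : SymRel p a b (FreeAlgebra.ι F true ^ p - FreeAlgebra.ι F true) (algebraMap F _ a)
  | right : SymRel p a b (FreeAlgebra.ι F false ^ p) (algebraMap F _ b)
  | rel : SymRel p a b (FreeAlgebra.ι F false * FreeAlgebra.ι F true)
      ((FreeAlgebra.ι F true - 1) * FreeAlgebra.ι F false)

/-- The algebra presented by the relations of the cyclic algebra `[a, b)`. -/
def SymbolAlg {F : Type*} [Field F] (p : ℕ) (a b : F) : Type _ := RingQuot (SymRel p a b)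

namespace SymbolAlg

section

variable {F : Type*} [Field F] (p : ℕ) (a b : F)

noncomputable instance : Ring (SymbolAlg p a b) := inferInstanceAs (Ring (RingQuot _))
noncomputable instance : Algebra F (SymbolAlg p a b) := inferInstanceAs (Algebra F (RingQuot _))

/-- The projection from the free algebra. -/
noncomputable def proj : FreeAlgebra F Bool →ₐ[F] SymbolAlg p a b :=
  RingQuot.mkAlgHom F (SymRel p a b)

variable {p a b} in
theorem proj_rel {u v : FreeAlgebra F Bool} (h : SymRel p a b u v) : proj p a b u = proj p a b v :=
  RingQuot.mkAlgHom_rel F h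

/-- The Artin-Schreier generator. -/
noncomputable def i : SymbolAlg p a b := proj p a b (FreeAlgebra.ι F true)

/-- The radical generator. -/
noncomputable def j : SymbolAlg p a b := proj p a b (FreeAlgebra.ι F false)

theorem isSymPair : IsSymPair p a b (i p a b) (j p a b) where
  left := by simpa [i, j] using proj_rel (SymRel.left (p := p) (a := a) (b := b))
  right := by simpa [i, j] using proj_rel (SymRel.right (p := p) (a := a) (b := b))
  rel := by simpa [i, j] using proj_rel (SymRel.rel (p := p) (a := a) (b := b))

theorem adjoin_eq_top : Algebra.adjoin F {i p a b, j p a b} = ⊤ := by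
  have h1 : (proj p a b).range = ⊤ :=
    (AlgHom.range_eq_top _).2 (RingQuot.mkAlgHom_surjective F _)
  rw [← Algebra.map_top, ← FreeAlgebra.adjoin_range_ι, AlgHom.map_adjoin, ← Set.range_comp] at h1
  refine Eq.trans (congrArg (Algebra.adjoin F) ?_) h1
  ext z
  simp only [Set.mem_insert_iff, Set.mem_singleton_iff, Set.mem_range, Bool.exists_bool, i, j,
    Function.comp_apply]
  rw [or_comm, eq_comm, eq_comm (a := z)]

variable {p a b} {B : Type*} [Ring B] [Algebra F B] {x y : B}

/-- The universal property of the cyclic algebra. -/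
noncomputable def lift (h : IsSymPair p a b x y) : SymbolAlg p a b →ₐ[F] B :=
  RingQuot.liftAlgHom F ⟨FreeAlgebra.lift F fun c => if c then x else y, by
    rintro _ _ (_ | _ | _)
    · simpa using h.left
    · simpa using h.right
    · simpa using h.rel⟩

theorem lift_i (h : IsSymPair p a b x y) : lift h (i p a b) = x := by
  rw [lift, i, proj]
  exact (RingQuot.liftAlgHom_mkAlgHom_apply _ _ _ _).trans (by simp)

theorem lift_j (h : IsSymPair p a b x y) : lift h (j p a b) = y := by
  rw [lift, j, proj]
  exact (RingQuot.liftAlgHom_mkAlgHom_apply _ _ _ _).trans (by simp)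

theorem lift_mem (h : IsSymPair p a b x y) (S : Subalgebra F B) (hx : x ∈ S) (hy : y ∈ S)
    (z : SymbolAlg p a b) : lift h z ∈ S := by
  have h1 : Algebra.adjoin F {i p a b, j p a b} ≤ S.comap (lift h) := by
    rw [Algebra.adjoin_le_iff]
    rintro _ (rfl | rfl)
    · simpa [lift_i] using hx
    · simpa [lift_j] using hy
  rw [adjoin_eq_top] at h1
  exact h1 Algebra.mem_top

end

end SymbolAlg

section Action

variable {F R : Type*} [Field F] [CommRing R] [Algebra F R] {p : ℕ} {a b : F}

theorem lmul_comp_pow_apply (σ : R →ₐ[F] R) (y : R) (n : ℕ) (r : R) :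
    ((Algebra.lmul F R y * σ.toLinearMap) ^ n) r = (∏ m ∈ Finset.range n, σ^[m] y) * σ^[n] r := by
  induction n with
  | zero => simp
  | succ n ih =>
    rw [pow_succ', Module.End.mul_apply, ih, Finset.prod_range_succ', Function.iterate_succ_apply']
    simp only [Module.End.mul_apply, AlgHom.toLinearMap_apply, map_mul, map_prod,
      Algebra.coe_lmul_eq_mul, LinearMap.mul_apply', Function.iterate_succ_apply', Function.iterate_zero, id]
    ring

/-- The standard action of a cyclic algebra on an algebra with an automorphism of order `p`. -/
theorem isSymPair_action (σ : R →ₐ[F] R) (x y : R) (hx : x ^ p - x = algebraMap F R a)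
    (hσx : σ x = x - 1) (hσ : ∀ r, σ^[p] r = r)
    (hy : ∏ m ∈ Finset.range p, σ^[m] y = algebraMap F R b) :
    IsSymPair p a b (Algebra.lmul F R x : Module.End F R)
      (Algebra.lmul F R y * σ.toLinearMap) where
  left := by
    rw [← map_pow, ← map_sub, hx]
    ext r
    simp [Algebra.smul_def]
  right := by
    refine LinearMap.ext fun r => ?_
    rw [lmul_comp_pow_apply, hσ, hy]
    simp [Algebra.smul_def]
  rel := by
    refine LinearMap.ext fun r => ?_
    simp only [Module.End.mul_apply, LinearMap.sub_apply, AlgHom.toLinearMap_apply,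
      Algebra.coe_lmul_eq_mul, LinearMap.mul_apply', map_mul, hσx, Module.End.one_apply]
    ring

/-- The action of a cyclic algebra whose first slot is of Artin-Schreier form. -/
theorem exists_isSymPair_pi [Fact p.Prime] {L : Type*} [Field L] [Algebra F L] [CharP L p] (x : L)
    (hx : x ^ p - x = algebraMap F L a) (b : F) :
    ∃ x y : Module.End F (ZMod p → L), IsSymPair p a b x y := by
  have : NeZero p := ⟨(Fact.out : p.Prime).ne_zero⟩
  let : Algebra (ZMod p) L := ZMod.algebra L p
  let σ : (ZMod p → L) →ₐ[F] (ZMod p → L) :=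
    { toFun := fun v k => v (k - 1)
      map_one' := rfl
      map_mul' := fun _ _ => rfl
      map_zero' := rfl
      map_add' := fun _ _ => rfl
      commutes' := fun _ => rfl }
  have hσ : ∀ (m : ℕ) (v : ZMod p → L) k, σ^[m] v k = v (k - m) := by
    intro m
    induction m with
    | zero => simp
    | succ m ih =>
      intro v k
      rw [Function.iterate_succ_apply']
      change σ^[m] v (k - 1) = _
      rw [ih]
      congr 1
      push_cast
      ring
  refine ⟨_, _, isSymPair_action σ (fun k => x + algebraMap (ZMod p) L k)
    (fun k => if k = 0 then algebraMap F L b else 1) ?_ ?_ ?_ ?_⟩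
  · funext k
    simp only [Pi.sub_apply, Pi.pow_apply, Pi.algebraMap_apply]
    rw [add_pow_char, ← map_pow, ZMod.pow_card, ← hx]
    ring
  · funext k
    change x + algebraMap (ZMod p) L (k - 1) = x + algebraMap (ZMod p) L k - 1
    rw [map_sub, map_one]
    ring
  · intro r
    funext k
    simp [hσ]
  · funext k
    rw [Finset.prod_apply, Finset.prod_eq_single k.val]
    · simp [hσ]
    · intro m hm hmk
      rw [hσ, if_neg]
      intro h0
      apply hmk
      rw [sub_eq_zero.1 h0, ZMod.val_cast_of_lt (Finset.mem_range.1 hm)]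
    · intro h
      exact absurd (Finset.mem_range.2 (ZMod.val_lt k)) h

end Action

namespace SymbolAlg

variable {F : Type*} [Field F] (p : ℕ) [Fact p.Prime] [CharP F p] (a b : F)

instance : Nontrivial (SymbolAlg p a b) := by
  have hp : p.Prime := Fact.out
  let L := AlgebraicClosure F
  have : CharP L p := charP_of_injective_algebraMap (algebraMap F L).injective p
  have : NeZero p := ⟨hp.ne_zero⟩
  obtain ⟨x, hx⟩ := IsAlgClosed.exists_aeval_eq_zero L (.X ^ p - .X - .C a : Polynomial F) (by
    rw [IsSymPair.degree_poly]
    exact_mod_cast hp.ne_zero)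
  obtain ⟨u, v, h⟩ := exists_isSymPair_pi x (sub_eq_zero.1 (by simpa using hx)) b
  exact (lift h).toRingHom.domain_nontrivial

instance [NeZero b] : IsSimpleRing (SymbolAlg p a b) :=
  (isSymPair p a b).isSimpleRing (NeZero.ne b) (adjoin_eq_top p a b)

instance [NeZero b] : Algebra.IsCentral F (SymbolAlg p a b) :=
  (isSymPair p a b).isCentral (NeZero.ne b) (adjoin_eq_top p a b)

instance : FiniteDimensional F (SymbolAlg p a b) :=
  (isSymPair p a b).finiteDimensional (adjoin_eq_top p a b)

theorem finrank [NeZero b] : Module.finrank F (SymbolAlg p a b) = p ^ 2 :=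
  (isSymPair p a b).finrank_eq (NeZero.ne b) (adjoin_eq_top p a b)

end SymbolAlg

namespace Br

section

variable {F : Type} [Field F] (p : ℕ) [Fact p.Prime] [CharP F p] {a b a' b' : F}

open Classical in
/-- The Brauer class of the cyclic algebra `[a, b)`, extended by `0` for `b = 0`. -/
noncomputable def sym (a b : F) : Br F :=
  if h : b = 0 then 0 else
    haveI : NeZero b := ⟨h⟩
    mk F (SymbolAlg p a b)

theorem sym_eq (a b : F) [NeZero b] : sym p a b = mk F (SymbolAlg p a b) :=
  dif_neg (NeZero.ne b)

variable {p} {B : Type} [Ring B] [Algebra F B]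
    [Algebra.IsCentral F B] [IsSimpleRing B] [FiniteDimensional F B]

theorem mk_eq_sym {x y : B} (h : IsSymPair p a b x y) (hb : b ≠ 0)
    (hd : Module.finrank F B = p ^ 2) : mk F B = sym p a b := by
  have : NeZero b := ⟨hb⟩
  rw [sym_eq]
  exact (mk_congr (AlgEquiv.ofBijective (SymbolAlg.lift h)
    (bijective_of_finrank_eq _ (by rw [hd, SymbolAlg.finrank])))).symm

theorem sym_eq_zero_of_action {V : Type} [AddCommGroup V] [Module F V] [FiniteDimensional F V]
    [Nontrivial V] {x y : Module.End F V} (h : IsSymPair p a b x y)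
    (hd : Module.finrank F V = p) : sym p a b = 0 := by
  by_cases hb : b = 0
  · exact dif_pos hb
  have : NeZero b := ⟨hb⟩
  rw [sym_eq]
  exact mk_eq_zero_of_action (SymbolAlg.lift h) (by rw [hd, SymbolAlg.finrank])

theorem sym_add_mk {A : Type} [Ring A] [Algebra F A]
    [Algebra.IsCentral F A] [IsSimpleRing A] [FiniteDimensional F A]
    {x y : B} (h : IsSymPair p a b x y) (hb : b ≠ 0) (f : A →ₐ[F] B)
    (hx : ∀ z, Commute x (f z)) (hy : ∀ z, Commute y (f z))
    (hd : Module.finrank F B = p ^ 2 * Module.finrank F A) : sym p a b + mk F A = mk F B := by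
  have : NeZero b := ⟨hb⟩
  rw [sym_eq, mk_add_mk]
  refine mk_congr (AlgEquiv.ofBijective (Algebra.TensorProduct.lift (SymbolAlg.lift h) f
    fun u v => ?_) (bijective_of_finrank_eq _ ?_))
  · have := SymbolAlg.lift_mem h (Subalgebra.centralizer F {f v}) (by
      rw [Subalgebra.mem_centralizer_iff]
      rintro _ rfl
      exact (hx v).eq.symm) (by
      rw [Subalgebra.mem_centralizer_iff]
      rintro _ rfl
      exact (hy v).eq.symm) u
    rw [Subalgebra.mem_centralizer_iff] at this
    exact (this _ rfl).symm
  · rw [Module.finrank_tensorProduct, hd, SymbolAlg.finrank]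

theorem mk_eq_sym_add_sym {x y x' y' : B} (h : IsSymPair p a b x y) (h' : IsSymPair p a' b' x' y')
    (hb : b ≠ 0) (hb' : b' ≠ 0) (hd : Module.finrank F B = p ^ 2 * p ^ 2)
    (h1 : Commute x x') (h2 : Commute x y') (h3 : Commute y x') (h4 : Commute y y') :
    mk F B = sym p a b + sym p a' b' := by
  have : NeZero b' := ⟨hb'⟩
  have key : ∀ w : B, Commute w x' → Commute w y' → ∀ z, Commute w (SymbolAlg.lift h' z) := by
    intro w hwx hwy z
    have := SymbolAlg.lift_mem h' (Subalgebra.centralizer F {w}) (by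
      rw [Subalgebra.mem_centralizer_iff]
      rintro _ rfl
      exact hwx.eq) (by
      rw [Subalgebra.mem_centralizer_iff]
      rintro _ rfl
      exact hwy.eq) z
    rw [Subalgebra.mem_centralizer_iff] at this
    exact this _ rfl
  rw [sym_eq p a' b', sym_add_mk h hb (SymbolAlg.lift h') (key x h1 h2) (key y h3 h4)
    (by rw [hd, SymbolAlg.finrank])]

end

end Br

open Polynomial in
theorem Polynomial.prod_range_X_sub_natCast (p : ℕ) [hp : Fact p.Prime] (F : Type*) [Field F]
    [CharP F p] : ∏ m ∈ Finset.range p, (X - C (m : F)) = (X ^ p - X : F[X]) := by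
  classical
  have hm := monic_prod_X_sub_C (fun m : ℕ => (m : F)) (Finset.range p)
  have hd : (∏ m ∈ Finset.range p, (X - C (m : F)) : F[X]).degree = p := by
    simp only [degree_prod, degree_X_sub_C, Finset.sum_const, Finset.card_range, nsmul_one]
  have hm' : (X ^ p - X : F[X]).Monic := by
    simpa using IsSymPair.monic_poly (p := p) (0 : F)
  have hd' : (X ^ p - X : F[X]).degree = p := by
    simpa using IsSymPair.degree_poly (p := p) (0 : F)
  refine eq_of_degree_sub_lt_of_eval_finset_eq ((Finset.range p).image fun m : ℕ => (m : F)) ?_ ?_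
  · rw [Finset.card_image_of_injOn, Finset.card_range, ← hd]
    · exact degree_sub_lt_left (hd.trans hd'.symm) hm.ne_zero (by rw [hm.leadingCoeff, hm'.leadingCoeff])
    · intro i hi j hj hij
      exact CharP.natCast_injOn_Iio F p (by simpa using hi) (by simpa using hj) hij
  · intro x hx
    obtain ⟨m, hm, rfl⟩ := Finset.mem_image.1 hx
    rw [eval_prod, Finset.prod_eq_zero hm (by simp)]
    have : (m : F) ^ p = m := map_natCast (frobenius F p) m
    simp [this]

namespace Br

section

variable {F : Type} [Field F] {p : ℕ} [hp : Fact p.Prime] [CharP F p] (a b a' b' : F)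

@[simp]
theorem sym_zero_right : sym p a 0 = 0 := dif_pos rfl

theorem sym_pow_sub_self (x : F) : sym p (x ^ p - x) b = 0 := by
  have : NeZero p := ⟨hp.out.ne_zero⟩
  obtain ⟨u, v, h⟩ := exists_isSymPair_pi (F := F) x rfl b
  exact sym_eq_zero_of_action h (by simp)

@[simp]
theorem sym_zero_left : sym p 0 b = 0 := by
  simpa [hp.out.ne_zero] using sym_pow_sub_self (p := p) b 0

section AdjoinRoot

open Polynomial

variable (p) in
/-- The Artin-Schreier algebra of `a`. -/
abbrev ASRoot : Type := AdjoinRoot (X ^ p - X - C a : F[X])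

omit hp [CharP F p] in
theorem root_pow_sub_root : (AdjoinRoot.root _ ^ p - AdjoinRoot.root _ : ASRoot p a) =
    algebraMap F (ASRoot p a) a := by
  have := AdjoinRoot.eval₂_root (X ^ p - X - C a : F[X])
  rw [eval₂_sub, eval₂_sub, eval₂_pow, eval₂_X, eval₂_C] at this
  exact sub_eq_zero.1 this

theorem sym_eq_zero_of_adjoinRoot (y : ASRoot p a)
    (hy : ∀ σ : ASRoot p a →ₐ[F] ASRoot p a,
      (∀ n : ℕ, σ^[n] (AdjoinRoot.root _) = AdjoinRoot.root _ - (n : ASRoot p a)) →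
      ∏ m ∈ Finset.range p, σ^[m] y = algebraMap F _ b) :
    sym p a b = 0 := by
  have hpoly : (X ^ p - X - C a : F[X]).natDegree = p :=
    natDegree_eq_of_degree_eq_some (IsSymPair.degree_poly a)
  have hd : Module.finrank F (ASRoot p a) = p := by
    rw [(AdjoinRoot.powerBasis' (IsSymPair.monic_poly (p := p) a)).finrank,
      AdjoinRoot.powerBasis'_dim, hpoly]
  have : FiniteDimensional F (ASRoot p a) :=
    FiniteDimensional.of_finrank_pos (by rw [hd]; exact hp.out.pos)
  have : Nontrivial (ASRoot p a) :=
    Module.nontrivial_of_finrank_pos (R := F) (by rw [hd]; exact hp.out.pos)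
  have : CharP (ASRoot p a) p :=
    charP_of_injective_algebraMap (algebraMap F (ASRoot p a)).injective p
  let σ : ASRoot p a →ₐ[F] ASRoot p a :=
    AdjoinRoot.liftAlgHom _ (Algebra.ofId F (ASRoot p a)) (AdjoinRoot.root _ - 1) (by
      have h0 : (Algebra.ofId F (ASRoot p a) : F →+* ASRoot p a) a =
        algebraMap F (ASRoot p a) a := rfl
      rw [eval₂_sub, eval₂_sub, eval₂_pow, eval₂_X, eval₂_C, sub_pow_char, one_pow, h0,
        ← root_pow_sub_root]
      ring)
  have hσx : σ (AdjoinRoot.root _) = AdjoinRoot.root _ - 1 := AdjoinRoot.liftAlgHom_root _ _ _ _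
  have hσn : ∀ n : ℕ, σ^[n] (AdjoinRoot.root _) = AdjoinRoot.root _ - (n : ASRoot p a) := by
    intro n
    induction n with
    | zero => simp
    | succ n ih =>
      rw [Function.iterate_succ_apply', ih, map_sub, hσx, map_natCast]
      push_cast
      ring
  have hσ : ∀ r, σ^[p] r = r := by
    have : σ ^ p = AlgHom.id F (ASRoot p a) := AdjoinRoot.algHom_ext (by
      rw [AlgHom.coe_pow, hσn p, CharP.cast_eq_zero, sub_zero, AlgHom.id_apply])
    intro r
    rw [← AlgHom.coe_pow, this, AlgHom.id_apply]
  exact sym_eq_zero_of_action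
    (isSymPair_action σ (AdjoinRoot.root _) y (root_pow_sub_root a) hσx hσ (hy σ hσn)) hd

theorem sym_pow_right (y : F) : sym p a (y ^ p) = 0 := by
  refine sym_eq_zero_of_adjoinRoot _ _ (algebraMap F _ y) fun σ _ => ?_
  have : ∀ n : ℕ, σ^[n] (algebraMap F _ y) = algebraMap F _ y := fun n =>
    (Function.IsFixedPt.iterate (σ.commutes y) n)
  simp only [this, Finset.prod_const, Finset.card_range, map_pow]

@[simp]
theorem sym_self : sym p a a = 0 := by
  refine sym_eq_zero_of_adjoinRoot _ _ (AdjoinRoot.root _) fun σ h => ?_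
  simp_rw [h]
  have := congrArg (aeval (AdjoinRoot.root (X ^ p - X - C a : F[X])))
    (prod_range_X_sub_natCast p F)
  simp only [map_prod, map_sub, map_pow, aeval_X, map_natCast] at this
  rw [this, root_pow_sub_root]

end AdjoinRoot

section Tensor

variable {A B : Type*} [Ring A] [Ring B] [Algebra F A] [Algebra F B]

omit hp [CharP F p] in
theorem isSymPair_tmul_one {x y : A} (h : IsSymPair p a b x y) :
    IsSymPair p a b (x ⊗ₜ[F] (1 : B)) (y ⊗ₜ[F] (1 : B)) :=
  h.map (Algebra.TensorProduct.includeLeft : A →ₐ[F] A ⊗[F] B)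

omit hp [CharP F p] in
theorem isSymPair_one_tmul {x y : B} (h : IsSymPair p a b x y) :
    IsSymPair p a b ((1 : A) ⊗ₜ[F] x) ((1 : A) ⊗ₜ[F] y) :=
  h.map (Algebra.TensorProduct.includeRight : B →ₐ[F] A ⊗[F] B)

theorem commute_tmul (u : A) (v : B) : Commute (u ⊗ₜ[F] (1 : B)) ((1 : A) ⊗ₜ[F] v) := by
  simp [commute_iff_eq]

end Tensor

section Pairs

variable {a b a' b'} {T : Type} [Ring T] [Algebra F T] [Algebra.IsCentral F T] [IsSimpleRing T]
  [FiniteDimensional F T] {x y x' y' : T}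


theorem mk_eq_sym_add_left (h : IsSymPair p a b x y) (h' : IsSymPair p a' b x' y') (hb : b ≠ 0)
    (cxx : Commute x x') (cxy : Commute x y') (cyx : Commute y x') (cyy : Commute y y')
    (hd : Module.finrank F T = p ^ 2 * p ^ 2) : mk F T = sym p (a + a') b := by
  have : CharP T p := charP_of_injective_algebraMap (algebraMap F T).injective p
  have hp1 : p - 1 + 1 = p := Nat.sub_add_cancel hp.out.one_le
  have h1 : IsSymPair p (a + a') b (x + x') y :=
    { left := by
        rw [add_pow_char_of_commute p cxx, map_add, ← h.left, ← h'.left]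
        abel
      right := h.right
      rel := by
        rw [mul_add, h.rel, cyx.eq]
        noncomm_ring }
  have h2 : IsSymPair p a' (b ^ p) x' (y ^ (p - 1) * y') :=
    { left := h'.left
      right := by
        rw [(cyy.pow_left _).mul_pow, ← pow_mul, mul_comm (p - 1), pow_mul, h.right, h'.right,
          ← map_pow, ← map_mul, ← pow_succ, hp1]
      rel := by
        rw [mul_assoc, h'.rel, ← mul_assoc, ← mul_assoc]
        congr 1
        exact ((cyx.pow_left _).sub_right (Commute.one_right _)).eq }
  have e := mk_eq_sym_add_sym h1 h2 hb (pow_ne_zero _ hb) hd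
    (cxx.add_left (Commute.refl _)) ?_ cyx
    (((Commute.refl y).pow_right _).mul_right cyy)
  · rw [sym_pow_right, add_zero] at e
    exact e
  · have e1 : y ^ (p - 1) * x = (x + 1) * y ^ (p - 1) := by
      rw [h.pow_mul_left, Nat.cast_sub hp.out.one_le, CharP.cast_eq_zero]
      simp
    have e2 : x' * y' = y' * x' + y' := by rw [h'.rel, sub_mul, one_mul, sub_add_cancel]
    have e3 : x * y ^ (p - 1) = y ^ (p - 1) * x - y ^ (p - 1) := by rw [e1]; noncomm_ring
    rw [commute_iff_eq, add_mul, ← mul_assoc, e3, ← mul_assoc, ← (cyx.pow_left _).eq,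
      mul_assoc _ x', e2, mul_add, sub_mul, mul_assoc, cxy.eq]
    noncomm_ring

theorem mk_eq_sym_mul_right (h : IsSymPair p a b x y) (h' : IsSymPair p a b' x' y') (hb : b ≠ 0)
    (hb' : b' ≠ 0)
    (cxx : Commute x x') (cxy : Commute x y') (cyx : Commute y x') (cyy : Commute y y')
    (hd : Module.finrank F T = p ^ 2 * p ^ 2) : mk F T = sym p a (b * b') := by
  have : CharP T p := charP_of_injective_algebraMap (algebraMap F T).injective p
  have h1 : IsSymPair p a (b * b') x (y * y') :=
    { left := h.left
      right := by rw [cyy.mul_pow, h.right, h'.right, map_mul]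
      rel := by rw [mul_assoc, ← cxy.eq, ← mul_assoc, h.rel, mul_assoc] }
  have h2 : IsSymPair p 0 b' (x' - x) y' :=
    { left := by
        rw [sub_pow_char_of_commute p cxx.symm, map_zero, sub_sub_sub_comm, h.left, h'.left,
          sub_self]
      right := h'.right
      rel := by
        rw [mul_sub, h'.rel, ← cxy.eq]
        noncomm_ring }
  have e := mk_eq_sym_add_sym h1 h2 (mul_ne_zero hb hb') hb' hd
    (cxx.sub_right (Commute.refl _)) cxy ?_ (cyy.mul_left (Commute.refl _))
  · rw [sym_zero_left, add_zero] at e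
    exact e
  · have e2 : y' * x' = x' * y' - y' := by rw [h'.rel, sub_mul, one_mul]
    have e3 : y * x = x * y - y := by rw [h.rel, sub_mul, one_mul]
    rw [commute_iff_eq, mul_sub, sub_mul, mul_assoc, mul_assoc, e2, ← cxy.eq, mul_sub, ← mul_assoc,
      ← mul_assoc, ← mul_assoc, ← mul_assoc, e3, cyx.eq]
    noncomm_ring

end Pairs

theorem sym_add_left : sym p (a + a') b = sym p a b + sym p a' b := by
  by_cases hb : b = 0
  · simp [hb]
  have : NeZero b := ⟨hb⟩
  rw [sym_eq p a, sym_eq p a', mk_add_mk]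
  exact (mk_eq_sym_add_left (isSymPair_tmul_one _ _ (SymbolAlg.isSymPair p a b))
    (isSymPair_one_tmul _ _ (SymbolAlg.isSymPair p a' b)) hb (commute_tmul _ _) (commute_tmul _ _)
    (commute_tmul _ _) (commute_tmul _ _)
    (by rw [Module.finrank_tensorProduct, SymbolAlg.finrank, SymbolAlg.finrank])).symm

theorem sym_mul_right {b b' : F} (hb : b ≠ 0) (hb' : b' ≠ 0) :
    sym p a (b * b') = sym p a b + sym p a b' := by
  have : NeZero b := ⟨hb⟩
  have : NeZero b' := ⟨hb'⟩
  rw [sym_eq p a b, sym_eq p a b', mk_add_mk]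
  exact (mk_eq_sym_mul_right (isSymPair_tmul_one _ _ (SymbolAlg.isSymPair p a b))
    (isSymPair_one_tmul _ _ (SymbolAlg.isSymPair p a b')) hb hb' (commute_tmul _ _)
    (commute_tmul _ _) (commute_tmul _ _) (commute_tmul _ _)
    (by rw [Module.finrank_tensorProduct, SymbolAlg.finrank, SymbolAlg.finrank])).symm

theorem sym_neg_left : sym p (-a) b = -sym p a b := by
  rw [eq_neg_iff_add_eq_zero, ← sym_add_left, neg_add_cancel, sym_zero_left]

theorem sym_sub_left : sym p (a - a') b = sym p a b - sym p a' b := by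
  rw [sub_eq_add_neg, sym_add_left, sym_neg_left, sub_eq_add_neg]

theorem sym_sum_left {ι : Type*} (s : Finset ι) (f : ι → F) :
    sym p (∑ i ∈ s, f i) b = ∑ i ∈ s, sym p (f i) b := by
  classical
  induction s using Finset.induction_on with
  | empty => simp
  | insert i s hi ih => rw [Finset.sum_insert hi, Finset.sum_insert hi, sym_add_left, ih]

theorem sym_pow_left : sym p (a ^ p) b = sym p a b := by
  rw [← sub_eq_zero, ← sym_sub_left, sym_pow_sub_self]

theorem sym_one_right : sym p a 1 = 0 := by
  simpa using sym_pow_right (p := p) a 1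

end

theorem res_sym {F K : Type} [Field F] [Field K] {p : ℕ} [Fact p.Prime] [CharP F p] [CharP K p]
    (f : F →+* K) (a b : F) : res f (sym p a b) = sym p (f a) (f b) := by
  by_cases hb : b = 0
  · simp [hb]
  have : NeZero b := ⟨hb⟩
  let := f.toAlgebra
  change res (algebraMap F K) _ = _
  rw [sym_eq, res_mk]
  have h := isSymPair_one_tmul (A := K) _ _ (SymbolAlg.isSymPair p a b)
  refine mk_eq_sym (a := f a) (b := f b) (x := (1 : K) ⊗ₜ[F] SymbolAlg.i p a b)
    (y := (1 : K) ⊗ₜ[F] SymbolAlg.j p a b) ⟨?_, ?_, h.rel⟩ ?_ ?_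
  · rw [h.left, Algebra.TensorProduct.algebraMap_apply, Algebra.TensorProduct.algebraMap_apply]
    rfl
  · rw [h.right, Algebra.TensorProduct.algebraMap_apply, Algebra.TensorProduct.algebraMap_apply]
    rfl
  · simpa using hb
  · rw [Module.finrank_baseChange, SymbolAlg.finrank]

end Br

namespace Br

section

variable {F : Type} [Field F] {p : ℕ} [hp : Fact p.Prime] [CharP F p]

theorem sym_mul_self (x y : F) : sym p (x * y) y = -sym p (x * y) x := by
  by_cases hx : x = 0
  · simp [hx]
  by_cases hy : y = 0
  · simp [hy]
  rw [eq_neg_iff_add_eq_zero, ← sym_mul_right _ hy hx, mul_comm, sym_self]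

/-- The symbol `[x y, y)`, which plays the role of `x dy`, is additive in `y`. -/
theorem sym_mul_sum_self {ι : Type*} (s : Finset ι) (x : F) (y : ι → F) :
    sym p (x * ∑ i ∈ s, y i) (∑ i ∈ s, y i) = ∑ i ∈ s, sym p (x * y i) (y i) := by
  simp_rw [sym_mul_self x, Finset.mul_sum, sym_sum_left, Finset.sum_neg_distrib]

theorem sym_pow_right_eq (a y : F) (n : ℕ) : sym p a (y ^ n) = sym p (n * a) y := by
  by_cases hy : y = 0
  · rcases n.eq_zero_or_pos with rfl | hn
    · simp [sym_one_right]
    · simp [hy, hn.ne']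
  induction n with
  | zero => simp [sym_one_right]
  | succ n ih =>
    rw [pow_succ, sym_mul_right _ (pow_ne_zero n hy) hy, ih, ← sym_add_left]
    congr 1
    push_cast
    ring

theorem sym_sum_pow_mul {ι : Type*} (s : Finset ι) (a t : F) (g : ι → F) (k : ι → ℕ) (ht : t ≠ 0)
    (hb : ∑ i ∈ s, g i ^ p * t ^ k i ≠ 0) :
    sym p a (∑ i ∈ s, g i ^ p * t ^ k i) = sym p (a / (∑ i ∈ s, g i ^ p * t ^ k i) *
      ∑ i ∈ s, (k i : F) * (g i ^ p * t ^ k i)) t := by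
  set b := ∑ i ∈ s, g i ^ p * t ^ k i with hbd
  have h1 : a = a / b * b := (div_mul_cancel₀ a hb).symm
  conv_lhs => rw [h1]
  rw [hbd, sym_mul_sum_self, ← hbd, Finset.mul_sum, sym_sum_left]
  refine Finset.sum_congr rfl fun i _ => ?_
  by_cases hg : g i = 0
  · simp [hg, hp.out.ne_zero]
  rw [sym_mul_right _ (pow_ne_zero _ hg) (pow_ne_zero _ ht), sym_pow_right, zero_add,
    sym_pow_right_eq]
  congr 1
  ring

end

end Br

section Irreducible

open Polynomial

theorem irreducible_X_pow_sub_X_sub_C {F : Type*} [Field F] {p : ℕ} [hp : Fact p.Prime] [CharP F p]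
    {w : F} (hw : ∀ x : F, x ^ p - x ≠ w) : Irreducible (X ^ p - X - C w : F[X]) := by
  have hm := IsSymPair.monic_poly (p := p) w
  have hdeg : (X ^ p - X - C w : F[X]).natDegree = p :=
    natDegree_eq_of_degree_eq_some (IsSymPair.degree_poly w)
  rw [hm.irreducible_iff_natDegree']
  refine ⟨fun h => ?_, fun f g hf hg hfg hgd => ?_⟩
  · rw [h, natDegree_one] at hdeg
    exact hp.out.ne_zero hdeg.symm
  rw [hdeg, Finset.mem_Ioc] at hgd
  let L := AlgebraicClosure F
  have : CharP L p := charP_of_injective_algebraMap (algebraMap F L).injective p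
  set G := g.map (algebraMap F L) with hG
  have hGm : G.Monic := hg.map _
  have hGs : G.Splits := IsAlgClosed.splits G
  have hroot : ∀ r ∈ G.roots, r ^ p - r = algebraMap F L w := by
    intro r hr
    have h0 : (X ^ p - X - C w : F[X]).eval₂ (algebraMap F L) r = 0 := by
      rw [← hfg, eval₂_mul, ← eval_map (p := g), (mem_roots'.1 hr).2, mul_zero]
    simpa [sub_eq_zero] using h0
  have hcard : G.roots.card = g.natDegree := by
    rw [← hGs.natDegree_eq_card_roots, natDegree_map]
  obtain ⟨α, hα⟩ : ∃ α, α ∈ G.roots := Multiset.card_pos_iff_exists_mem.1 (by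
    rw [hcard]
    exact hgd.1)
  have hdiff : ∀ r ∈ G.roots, r - α ∈ (algebraMap F L).range := by
    intro r hr
    have h1 := congrArg (eval (r - α)) (prod_range_X_sub_natCast p L)
    rw [eval_prod] at h1
    simp only [eval_sub, eval_pow, eval_X, eval_C] at h1
    have h2 : (r - α) ^ p - (r - α) = 0 := by
      rw [sub_pow_char, sub_sub_sub_comm, hroot r hr, hroot α hα, sub_self]
    rw [h2, Finset.prod_eq_zero_iff] at h1
    obtain ⟨m, -, hm⟩ := h1
    exact ⟨m, by rw [map_natCast, sub_eq_zero.1 hm]⟩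
  have hsum : G.roots.sum ∈ (algebraMap F L).range := by
    have := hGs.nextCoeff_eq_neg_sum_roots_of_monic hGm
    rw [← neg_eq_iff_eq_neg.2 this, hG, nextCoeff_map (algebraMap F L).injective]
    exact neg_mem ⟨_, rfl⟩
  have hsum' : (G.roots.map fun r => r - α).sum ∈ (algebraMap F L).range := by
    refine Subring.multiset_sum_mem _ _ fun z hz => ?_
    obtain ⟨r, hr, rfl⟩ := Multiset.mem_map.1 hz
    exact hdiff r hr
  rw [Multiset.sum_map_sub, Multiset.map_id', Multiset.map_const', Multiset.sum_replicate,
    hcard] at hsum'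
  have h3 : g.natDegree • α ∈ (algebraMap F L).range := by
    simpa using sub_mem hsum hsum'
  obtain ⟨c, hc⟩ := h3
  have hd0 : (g.natDegree : F) ≠ 0 := by
    intro h0
    have := Nat.le_of_dvd hgd.1 ((CharP.cast_eq_zero_iff F p _).1 h0)
    have := Nat.div_lt_self hp.out.pos one_lt_two
    omega
  refine hw (c / g.natDegree) ((algebraMap F L).injective ?_)
  have h4 : algebraMap F L (c / g.natDegree) = α := by
    rw [map_div₀, hc, map_natCast, nsmul_eq_mul, mul_div_cancel_left₀]
    rw [← map_natCast (algebraMap F L)]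
    exact (_root_.map_ne_zero _).2 hd0
  rw [map_sub, map_pow, h4, hroot α hα]

end Irreducible

namespace Br

open Polynomial

/-- A splitting of a cyclic algebra is described by a norm equation. -/
theorem exists_dvd_of_action {M V : Type*} [Field M] {p : ℕ} [hp : Fact p.Prime] [CharP M p]
    [AddCommGroup V] [Module M V] [FiniteDimensional M V] {w t : M} {I J : Module.End M V}
    (h : IsSymPair p w t I J) (hd : Module.finrank M V = p)
    (hirr : Irreducible (X ^ p - X - C w : M[X])) :
    ∃ f : M[X], f.degree < p ∧
      (X ^ p - X - C w : M[X]) ∣ (∏ m ∈ Finset.range p, f.comp (X - C (m : M))) - C t := by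
  have : Module.Finite M (degreeLT M p) := Module.Finite.equiv (degreeLTEquiv M p).symm
  have : Nontrivial V := Module.nontrivial_of_finrank_pos (R := M) (by rw [hd]; exact hp.out.pos)
  obtain ⟨e, he⟩ := exists_ne (0 : V)
  have hker : ∀ f : M[X], aeval I f e = 0 → (X ^ p - X - C w : M[X]) ∣ f := by
    intro f hf
    by_contra hnd
    obtain ⟨u, v, huv⟩ := (hirr.coprime_iff_not_dvd (n := f)).2 hnd
    have := congrArg (fun q => aeval I q e) huv
    simp [map_add, map_mul, hf, h.left] at this
    exact he this.symm
  let φ : degreeLT M p →ₗ[M] V :=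
    (LinearMap.applyₗ e) ∘ₗ (aeval I).toLinearMap ∘ₗ (degreeLT M p).subtype
  have hφ : ∀ f, φ f = aeval I (f : M[X]) e := fun f => rfl
  have hinj : Function.Injective φ := by
    rw [← LinearMap.ker_eq_bot, LinearMap.ker_eq_bot']
    intro f hf
    have h1 := hker _ (hφ f ▸ hf)
    have h2 := mem_degreeLT.1 f.2
    rw [← IsSymPair.degree_poly (p := p) w] at h2
    exact Subtype.ext (eq_zero_of_dvd_of_degree_lt h1 h2)
  have hsurj : Function.Surjective φ :=
    (LinearMap.injective_iff_surjective_of_finrank_eq_finrank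
      (by rw [hd, (degreeLTEquiv M p).finrank_eq, Module.finrank_fin_fun])).1 hinj
  obtain ⟨f, hf⟩ := hsurj (J e)
  rw [hφ] at hf
  refine ⟨f, mem_degreeLT.1 f.2, hker _ ?_⟩
  have hpow : ∀ n : ℕ, (J ^ n) e =
      aeval I (∏ m ∈ Finset.range n, (f : M[X]).comp (X - C (m : M))) e := by
    intro n
    induction n with
    | zero => simp
    | succ n ih =>
      have h3 : J * aeval I (∏ m ∈ Finset.range n, (f : M[X]).comp (X - C (m : M))) =
        aeval I (∏ m ∈ Finset.range n, (f : M[X]).comp (X - C ((m + 1 : ℕ) : M))) * J := by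
        rw [h.mul_aeval, Polynomial.prod_comp]
        congr 3
        funext m
        rw [comp_assoc]
        congr 1
        simp only [sub_comp, X_comp, C_comp, Nat.cast_succ, C_add, C_1]
        ring
      rw [pow_succ', Module.End.mul_apply, ih, ← Module.End.mul_apply, h3, Module.End.mul_apply,
        ← hf, Finset.prod_range_succ', ← Module.End.mul_apply, ← map_mul]
      simp
  rw [map_sub, LinearMap.sub_apply, ← hpow, h.right]
  simp

theorem exists_coeffs_of_sym_eq_zero {F M : Type} [Field F] [Field M] [Algebra F M] {p : ℕ}
    [hp : Fact p.Prime] [CharP F p] [CharP M p] (w : F) (t : M) (ht : t ≠ 0)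
    (h0 : sym p (algebraMap F M w) t = 0) :
    ∃ y : Fin p → M, ∀ E : IntermediateField F M, (∀ k, y k ∈ E) →
      ∃ ht : t ∈ E, haveI : CharP E p := charP_of_injective_algebraMap (algebraMap F E).injective p
        sym p (algebraMap F E w) (⟨t, ht⟩ : E) = 0 := by
  by_cases hw : ∃ x : M, x ^ p - x = algebraMap F M w
  · obtain ⟨x, hx⟩ := hw
    refine ⟨fun k => if (k : ℕ) = 0 then x else t, fun E hE => ?_⟩
    have hxE : x ∈ E := by simpa using hE ⟨0, hp.out.pos⟩
    have htE : t ∈ E := by simpa using hE ⟨1, hp.out.one_lt⟩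
    have : CharP E p := charP_of_injective_algebraMap (algebraMap F E).injective p
    refine ⟨htE, ?_⟩
    have : algebraMap F E w = (⟨x, hxE⟩ : E) ^ p - ⟨x, hxE⟩ := Subtype.ext hx.symm
    rw [this, sym_pow_sub_self]
  push Not at hw
  have hirr := irreducible_X_pow_sub_X_sub_C hw
  have : NeZero t := ⟨ht⟩
  rw [sym_eq] at h0
  obtain ⟨n, hn, ⟨e⟩⟩ := isSplitAlg_of_mk_eq_zero h0
  have hnp : n = p := by
    have := e.toLinearEquiv.finrank_eq
    rw [SymbolAlg.finrank, Module.finrank_matrix] at this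
    simp only [Fintype.card_fin, Module.finrank_self, mul_one, ← sq] at this
    exact (Nat.pow_left_injective two_ne_zero this).symm
  have hpair := (SymbolAlg.isSymPair p (algebraMap F M w) t).map
    ((Matrix.toLinAlgEquiv' : Matrix (Fin n) (Fin n) M ≃ₐ[M] _).toAlgHom.comp e.toAlgHom)
  obtain ⟨f, hf, hdvd⟩ := exists_dvd_of_action hpair (by simp [hnp]) hirr
  refine ⟨fun k => f.coeff k, fun E hE => ?_⟩
  have : CharP E p := charP_of_injective_algebraMap (algebraMap F E).injective p
  obtain ⟨g, hg⟩ : ∃ g : E[X], g.map (algebraMap E M) = f := by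
    refine (mem_lifts f).1 ((lifts_iff_coeff_lifts f).2 fun k => ?_)
    by_cases hk : k < p
    · exact ⟨⟨_, hE ⟨k, hk⟩⟩, rfl⟩
    · refine ⟨0, ?_⟩
      rw [map_zero, coeff_eq_zero_of_degree_lt (hf.trans_le (by exact_mod_cast not_lt.1 hk))]
  set N : E[X] := ∏ m ∈ Finset.range p, g.comp (X - C (m : E)) with hN
  set q : E[X] := X ^ p - X - C (algebraMap F E w) with hq
  have hqm : q.Monic := IsSymPair.monic_poly _
  have hqmap : q.map (algebraMap E M) = X ^ p - X - C (algebraMap F M w) := by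
    simp [hq]
  have hNmap : N.map (algebraMap E M) = ∏ m ∈ Finset.range p, f.comp (X - C (m : M)) := by
    rw [hN, Polynomial.map_prod]
    refine Finset.prod_congr rfl fun m _ => ?_
    rw [map_comp, hg]
    simp
  have hr : (N %ₘ q).map (algebraMap E M) = C t := by
    rw [map_modByMonic _ hqm, hNmap, hqmap]
    have h1 := (modByMonic_eq_zero_iff_dvd (IsSymPair.monic_poly (p := p) (algebraMap F M w))).2 hdvd
    rw [sub_modByMonic, sub_eq_zero] at h1
    rw [h1, modByMonic_eq_self_iff (IsSymPair.monic_poly _), IsSymPair.degree_poly]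
    exact degree_C_le.trans_lt (by exact_mod_cast hp.out.pos)
  have htE : algebraMap E M ((N %ₘ q).coeff 0) = t := by
    rw [← coeff_map, hr, coeff_C_zero]
  have htE' : t ∈ E := htE ▸ ((N %ₘ q).coeff 0).2
  have hr' : N %ₘ q = C ⟨t, htE'⟩ := by
    refine Polynomial.map_injective _ (algebraMap E M).injective ?_
    rw [hr, map_C]
    rfl
  refine ⟨htE', sym_eq_zero_of_adjoinRoot _ _ (AdjoinRoot.mk _ g) fun σ hσ => ?_⟩
  have h2 : ∀ m, σ^[m] (AdjoinRoot.mk q g) = AdjoinRoot.mk q (g.comp (X - C (m : E))) := by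
    intro m
    rw [← AlgHom.coe_pow, ← AdjoinRoot.aeval_eq, ← Polynomial.aeval_algHom_apply, AlgHom.coe_pow,
      hσ, ← AdjoinRoot.aeval_eq, aeval_comp]
    simp
    rfl
  rw [Finset.prod_congr rfl fun m _ => h2 m, ← map_prod, ← hN]
  have h3 := congrArg (AdjoinRoot.mk q) (modByMonic_add_div N q)
  rw [map_add, map_mul, AdjoinRoot.mk_self, zero_mul, add_zero, hr'] at h3
  rw [← h3]
  rfl

end Br

section Euler

variable {F K : Type*} [Field F] [Field K] [Algebra F K] {p : ℕ} [hp : Fact p.Prime]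

theorem natDegree_minpoly_of_finrank_eq_prime (hd : Module.finrank F K = p) {t : K}
    (ht : t ∉ (algebraMap F K).range) : (minpoly F t).natDegree = p := by
  have : FiniteDimensional F K := Module.finite_of_finrank_pos (hd ▸ hp.out.pos)
  have hi := IsIntegral.of_finite F t
  rw [← IntermediateField.adjoin.finrank hi]
  refine ((Nat.dvd_prime hp.out).1
    (hd ▸ Dvd.intro _ (Module.finrank_mul_finrank F (IntermediateField.adjoin F {t}) K))).resolve_left
    fun h1 => ht ?_
  exact IntermediateField.mem_bot.1
    (IntermediateField.adjoin_simple_eq_bot_iff.1 (IntermediateField.finrank_eq_one_iff.1 h1))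

theorem exists_basis_pow (hd : Module.finrank F K = p) {t : K}
    (ht : t ∉ (algebraMap F K).range) : ∃ b : Module.Basis (Fin p) F K, ∀ k, b k = t ^ (k : ℕ) := by
  have hli := linearIndependent_pow (K := F) t
  rw [natDegree_minpoly_of_finrank_eq_prime hd ht] at hli
  have : Nonempty (Fin p) := ⟨⟨0, hp.out.pos⟩⟩
  refine ⟨basisOfLinearIndependentOfCardEqFinrank hli (by simp [hd]), fun k => ?_⟩
  simp

theorem exists_euler_derivation [CharP F p] (hd : Module.finrank F K = p) {t : K}
    (ht : t ∉ (algebraMap F K).range) {f : F} (hf : t ^ p = algebraMap F K f) :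
    ∃ θ : K →ₗ[F] K, θ t = t ∧ (∀ x y, θ (x * y) = θ x * y + x * θ y) ∧
      ∀ x, θ x = 0 → x ∈ (algebraMap F K).range := by
  obtain ⟨b, hb⟩ := exists_basis_pow hd ht
  let θ : K →ₗ[F] K := b.constr F fun k => ((k : ℕ) : F) • t ^ (k : ℕ)
  have hθb : ∀ k : Fin p, θ (t ^ (k : ℕ)) = ((k : ℕ) : F) • t ^ (k : ℕ) := fun k => by
    rw [← hb, Module.Basis.constr_basis, hb]
  have hθ : ∀ n : ℕ, θ (t ^ n) = (n : F) • t ^ n := fun n => by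
    have h1 : t ^ n = f ^ (n / p) • t ^ (n % p) := by
      conv_lhs => rw [← Nat.div_add_mod n p]
      rw [pow_add, pow_mul, hf, Algebra.smul_def, map_pow]
    have h2 : (n : F) = ((n % p : ℕ) : F) := by
      conv_lhs => rw [← Nat.div_add_mod n p]
      simp
    rw [h1, map_smul, hθb ⟨n % p, Nat.mod_lt _ hp.out.pos⟩, h2, smul_comm]
  refine ⟨θ, by simpa using hθ 1, ?_, ?_⟩
  · let L : K →ₗ[F] K →ₗ[F] K := (LinearMap.mul F K).compr₂ θ
    let R : K →ₗ[F] K →ₗ[F] K := (LinearMap.mul F K).comp θ + (LinearMap.mul F K).compl₂ θ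
    have : L = R := b.ext fun k => b.ext fun l => by
      simp only [L, R, hb, LinearMap.compr₂_apply, LinearMap.add_apply, LinearMap.comp_apply,
        LinearMap.compl₂_apply, LinearMap.mul_apply', ← pow_add, hθ]
      rw [smul_mul_assoc, mul_smul_comm, ← pow_add, ← add_smul, Nat.cast_add]
    intro x y
    exact congrArg (fun T => T x y) this
  · intro x hx
    have hz : ∀ k : Fin p, ((k : ℕ) : F) * b.repr x k = 0 := by
      have h3 : θ x = ∑ k, (b.repr x k * ((k : ℕ) : F)) • b k := by
        conv_lhs => rw [← b.sum_repr x]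
        rw [map_sum]
        refine Finset.sum_congr rfl fun k _ => ?_
        rw [map_smul, hb, hθ, smul_smul]
      intro k
      rw [mul_comm]
      exact Fintype.linearIndependent_iff.1 b.linearIndependent _ (h3.symm.trans hx) k
    refine ⟨b.repr x ⟨0, hp.out.pos⟩, ?_⟩
    conv_rhs => rw [← b.sum_repr x]
    rw [Finset.sum_eq_single ⟨0, hp.out.pos⟩, hb, pow_zero, Algebra.smul_def, mul_one]
    · intro k _ hk
      have : ((k : ℕ) : F) ≠ 0 := by
        rw [Ne, CharP.cast_eq_zero_iff F p]
        intro h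
        exact hk (Fin.ext (Nat.eq_zero_of_dvd_of_lt h k.2))
      rw [(mul_eq_zero.1 (hz k)).resolve_left this, zero_smul]
    · simp

end Euler

/-- A linear derivation of a matrix algebra is inner. -/
theorem Matrix.exists_eq_commutator_of_leibniz {K : Type*} [Field K] {n : ℕ} [NeZero n]
    (δ : Matrix (Fin n) (Fin n) K →ₗ[K] Matrix (Fin n) (Fin n) K)
    (hδ : ∀ x y, δ (x * y) = δ x * y + x * δ y) : ∃ x, ∀ m, δ m = x * m - m * x := by
  refine ⟨∑ k, δ (single k 0 1) * single 0 k 1, fun m => ?_⟩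
  let T : Matrix (Fin n) (Fin n) K →ₗ[K] Matrix (Fin n) (Fin n) K :=
    LinearMap.mulLeft K (∑ k, δ (single k 0 1) * single 0 k 1) -
      LinearMap.mulRight K (∑ k, δ (single k 0 1) * single 0 k 1)
  suffices δ = T from congrArg (fun L => L m) this
  refine Matrix.ext_linearMap K fun i j => LinearMap.ext_ring ?_
  simp only [LinearMap.comp_apply, T, LinearMap.sub_apply, LinearMap.mulLeft_apply,
    LinearMap.mulRight_apply, singleLinearMap_apply]
  have h1 : (∑ k, δ (single k 0 1) * single 0 k 1) * single i j 1 =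
      δ (single i 0 1) * single 0 j 1 := by
    rw [Finset.sum_mul, Finset.sum_eq_single i]
    · rw [mul_assoc, single_mul_single_same, mul_one]
    · intro k _ hk
      rw [mul_assoc, single_mul_single_of_ne _ _ _ _ hk, mul_zero]
    · simp
  have h2 : single i j 1 * (∑ k, δ (single k 0 1) * single 0 k 1) =
      δ (single i 0 1) * single 0 j 1 - δ (single i j 1) := by
    have h3 : ∀ k, single i j (1 : K) * (δ (single k 0 1) * single 0 k 1) =
        δ (single i j 1 * single k 0 1) * single 0 k 1 - δ (single i j 1) * single k k 1 := by
      intro k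
      rw [hδ, add_mul, mul_assoc (δ _) (single k 0 1), single_mul_single_same, mul_one, mul_assoc]
      abel
    rw [Finset.mul_sum, Finset.sum_congr rfl fun k _ => h3 k, Finset.sum_sub_distrib,
      ← Finset.mul_sum, sum_single_one, mul_one, Finset.sum_eq_single j]
    · rw [single_mul_single_same, mul_one]
    · intro k _ hk
      rw [single_mul_single_of_ne _ _ _ _ hk.symm, map_zero, zero_mul]
    · simp
  rw [h1, h2, sub_sub_cancel]

theorem isSimpleRing_end (F V : Type*) [Field F] [AddCommGroup V] [Module F V]
    [FiniteDimensional F V] [Nontrivial V] : IsSimpleRing (Module.End F V) :=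
  have : Nonempty (Module.Free.ChooseBasisIndex F V) :=
    (Module.Free.chooseBasis F V).index_nonempty
  isSimpleRing_of_ringEquiv (algEquivMatrix (Module.Free.chooseBasis F V)).symm.toRingEquiv

namespace Br

/-- A Brauer class split by a purely inseparable extension `F(t)` of degree `p` with `t ^ p = f`
is the class of a single symbol with second slot `f`. -/
theorem exists_eq_sym_of_res_eq_zero {F K : Type} [Field F] [Field K] [Algebra F K] {p : ℕ}
    [hp : Fact p.Prime] [CharP F p] (hd : Module.finrank F K = p) {t : K}
    (ht : t ∉ (algebraMap F K).range) {f : F} (hf : t ^ p = algebraMap F K f) {α : Br F}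
    (h : res (algebraMap F K) α = 0) : ∃ a, α = sym p a f := by
  have : FiniteDimensional F K := Module.finite_of_finrank_pos (hd ▸ hp.out.pos)
  obtain ⟨θ, hθt, hθ, hθ0⟩ := exists_euler_derivation hd ht hf
  obtain ⟨b, hb⟩ := exists_basis_pow hd ht
  have hf0 : f ≠ 0 := by
    rintro rfl
    rw [map_zero] at hf
    exact ht ⟨0, by rw [map_zero, pow_eq_zero_iff hp.out.ne_zero |>.1 hf]⟩
  induction α using ind with | h A =>
  rw [res_mk] at h
  obtain ⟨n, hn, ⟨e⟩⟩ := isSplitAlg_of_mk_eq_zero h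
  have : NeZero n := ⟨hn.ne'⟩
  have hθ1 : θ 1 = 0 := by simpa using hθ 1 1
  let θA : K ⊗[F] A →ₗ[F] K ⊗[F] A := LinearMap.rTensor A θ
  have hθA : ∀ x y, θA (x * y) = θA x * y + x * θA y := by
    intro x y
    induction x with
    | zero => simp
    | add x x' hx hx' => rw [add_mul, map_add, hx, hx', map_add, add_mul, add_mul]; abel
    | tmul k c =>
      induction y with
      | zero => simp
      | add y y' hy hy' => rw [mul_add, map_add, hy, hy', map_add, mul_add, mul_add]; abel
      | tmul k' c' => simp [θA, hθ, TensorProduct.add_tmul]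
  have hθAs : ∀ (k : K) x, θA (k • x) = θ k • x + k • θA x := by
    intro k x
    have h1 : ∀ (k : K) (x : K ⊗[F] A), k • x = (k ⊗ₜ[F] (1 : A)) * x := fun k x => by
      rw [Algebra.smul_def]; rfl
    rw [h1, hθA, h1, h1]
    rfl
  have hθM : ∀ x y : Matrix (Fin n) (Fin n) K, (x * y).map θ = x.map θ * y + x * y.map θ := by
    intro x y
    ext i j
    simp [Matrix.mul_apply, hθ, Finset.sum_add_distrib]
  let δ : Matrix (Fin n) (Fin n) K →ₗ[K] Matrix (Fin n) (Fin n) K :=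
    { toFun := fun m => e (θA (e.symm m)) - m.map θ
      map_add' := fun x y => by
        rw [map_add, map_add, map_add, Matrix.map_add _ (map_add θ)]
        abel
      map_smul' := fun k x => by
        have h1 : (k • x).map θ = θ k • x + k • x.map θ := by
          ext i j
          simp [hθ]
        rw [map_smul, hθAs, map_add, map_smul, map_smul, AlgEquiv.apply_symm_apply, h1,
          RingHom.id_apply, smul_sub]
        abel }
  have hδ : ∀ x y, δ (x * y) = δ x * y + x * δ y := by
    intro x y
    simp only [δ, LinearMap.coe_mk, AddHom.coe_mk, map_mul, hθA, map_add,
      AlgEquiv.apply_symm_apply, hθM, sub_mul, mul_sub]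
    abel
  obtain ⟨x, hx⟩ := Matrix.exists_eq_commutator_of_leibniz δ hδ
  let μ : Matrix (Fin n) (Fin n) K →ₐ[F] Module.End F (Fin n → K) :=
    (Algebra.lsmul F F (Fin n → K)).comp
      ((Matrix.toLinAlgEquiv' : _ ≃ₐ[K] Module.End K (Fin n → K)).toAlgHom.restrictScalars F)
  have hμ : ∀ m v, μ m v = m.mulVec v := fun m v => rfl
  let D : Module.End F (Fin n → K) := θ.compLeft (Fin n)
  have hD : ∀ m, D * μ m = μ (m.map θ) + μ m * D := by
    intro m
    refine LinearMap.ext fun v => ?_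
    funext i
    simp only [Module.End.mul_apply, LinearMap.add_apply, hμ, Pi.add_apply]
    simp [D, Matrix.mulVec, dotProduct, hθ, Finset.sum_add_distrib]
  let I := D + μ x
  let κ : K →ₐ[F] Module.End F (Fin n → K) := Algebra.lsmul F F (Fin n → K)
  have hκμ : ∀ k, κ k = μ (algebraMap K _ k) := fun k => by
    refine LinearMap.ext fun v => ?_
    rw [hμ, Algebra.algebraMap_eq_smul_one, Matrix.smul_mulVec, Matrix.one_mulVec]
    rfl
  have hcomm : ∀ a : A, Commute I (μ (e (1 ⊗ₜ a))) := by
    intro a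
    have h1 := hx (e (1 ⊗ₜ a))
    have h2 : θA (1 ⊗ₜ a) = 0 := by simp [θA, hθ1]
    simp only [δ, LinearMap.coe_mk, AddHom.coe_mk, AlgEquiv.symm_apply_apply, h2, map_zero,
      zero_sub] at h1
    have h3 := hD (e (1 ⊗ₜ a))
    rw [neg_eq_iff_eq_neg.1 h1] at h3
    simp only [Commute, SemiconjBy, I, add_mul, mul_add, h3, map_neg, map_sub, map_mul]
    abel
  have hIκ : ∀ k, I * κ k = κ k * I + κ (θ k) := by
    intro k
    have h1 : (algebraMap K (Matrix (Fin n) (Fin n) K) k).map θ = algebraMap K _ (θ k) := by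
      ext i j
      by_cases hij : i = j <;> simp [Matrix.algebraMap_matrix_apply, hij]
    have h2 : μ x * κ k = κ k * μ x := by
      rw [hκμ, ← map_mul, ← map_mul, Algebra.commutes]
    simp only [I, add_mul, mul_add, h2]
    rw [hκμ, hκμ, hD, h1]
    abel
  have hrel : κ t * I = (I - 1) * κ t := by
    rw [sub_mul, hIκ, hθt, one_mul, add_sub_cancel_right]
  let z := I ^ p - I
  have : CharP (Module.End F (Fin n → K)) p :=
    charP_of_injective_algebraMap (algebraMap F _).injective p
  have hzt : Commute z (κ t) := by
    have h1 : SemiconjBy (κ t) (I ^ p) ((I - 1) ^ p) := SemiconjBy.pow_right hrel p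
    rw [sub_pow_char_of_commute p (Commute.one_right I), one_pow] at h1
    have h2 : SemiconjBy (κ t) (I ^ p - I) ((I ^ p - 1) - (I - 1)) := h1.sub_right hrel
    rw [sub_sub_sub_cancel_right] at h2
    exact h2.symm
  have hzA : ∀ a : A, Commute z (μ (e (1 ⊗ₜ a))) := fun a =>
    ((hcomm a).pow_left p).sub_left (hcomm a)
  have hzK : ∀ k, Commute z (κ k) := by
    intro k
    rw [← b.sum_repr k, map_sum]
    refine Commute.sum_right _ _ _ fun j _ => ?_
    rw [map_smul, hb, map_pow]
    exact (hzt.pow_right _).smul_right _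
  have hzM : ∀ m, Commute z (μ m) := by
    intro m
    obtain ⟨u, rfl⟩ := e.surjective m
    induction u with
    | zero => simp
    | add u v hu hv => rw [map_add, map_add]; exact hu.add_right hv
    | tmul k c =>
      have : k ⊗ₜ[F] c = algebraMap K (K ⊗[F] A) k * (1 ⊗ₜ c) := by simp
      rw [this, map_mul, AlgEquiv.commutes, map_mul, ← hκμ]
      exact (hzK k).mul_right (hzA c)
  let zK : Module.End K (Fin n → K) :=
    { z with
      map_smul' := fun k v => congrArg (fun g => g v) (hzK k).eq }
  have hzc : zK ∈ Subalgebra.center K (Module.End K (Fin n → K)) := by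
    rw [Subalgebra.mem_center_iff]
    intro g
    obtain ⟨m, rfl⟩ := Matrix.toLinAlgEquiv'.surjective g
    refine LinearMap.ext fun v => ?_
    exact (congrArg (fun g => g v) (hzM m).eq).symm
  rw [Algebra.IsCentral.center_eq_bot, Algebra.mem_bot] at hzc
  obtain ⟨c, hc⟩ := hzc
  have hzκ : z = κ c := by
    refine LinearMap.ext fun v => ?_
    exact (congrArg (fun g => g v) hc).symm
  have hθc : θ c = 0 := by
    have h1 : Commute I z := ((Commute.refl I).pow_right p).sub_right (Commute.refl I)
    have h2 := hIκ c
    rw [← hzκ, h1.eq, left_eq_add] at h2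
    have h3 := congrFun (congrArg (fun g => g (fun _ => 1)) h2) 0
    simpa [κ] using h3
  obtain ⟨a, ha⟩ := hθ0 c hθc
  have hpair : IsSymPair p a f I (κ t) :=
    { left := by
        change z = _
        rw [hzκ, ← ha, AlgHom.commutes]
      right := by rw [← map_pow, hf, AlgHom.commutes]
      rel := hrel }
  have hdim : n ^ 2 = Module.finrank F A := by
    have := e.toLinearEquiv.finrank_eq
    rw [Module.finrank_matrix, Module.finrank_baseChange] at this
    simp [← sq] at this
    exact this.symm
  have : IsSimpleRing (Module.End F (Fin n → K)) := isSimpleRing_end F _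
  have key := sym_add_mk hpair hf0
    (μ.comp ((e.toAlgHom.restrictScalars F).comp Algebra.TensorProduct.includeRight))
    hcomm (fun a => (hκμ t ▸ (Algebra.commute_algebraMap_left t _).map μ)) (by
      rw [Module.finrank_linearMap, Module.finrank_pi_fintype]
      simp [hd, ← hdim]
      ring)
  refine ⟨-a, ?_⟩
  rw [sym_neg_left, eq_neg_iff_add_eq_zero, add_comm, key]
  exact mk_eq_zero_of_end AlgEquiv.refl

end Br

section Pow

variable {F K : Type*} [Field F] [Field K] [Algebra F K] {p : ℕ} [hp : Fact p.Prime] [CharP F p]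

theorem pow_mem_range_of_mem_adjoin {S : Set K} (hS : ∀ s ∈ S, s ^ p ∈ (algebraMap F K).range)
    {x : K} (hx : x ∈ IntermediateField.adjoin F S) : x ^ p ∈ (algebraMap F K).range := by
  have : CharP K p := charP_of_injective_algebraMap (algebraMap F K).injective p
  induction hx using IntermediateField.adjoin_induction with
  | mem s hs => exact hS s hs
  | algebraMap a => exact ⟨a ^ p, by rw [map_pow]⟩
  | add x y _ _ hx hy => rw [add_pow_char]; exact add_mem hx hy
  | inv x _ hx =>
    obtain ⟨a, ha⟩ := hx
    exact ⟨a⁻¹, by rw [map_inv₀, ha, inv_pow]⟩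
  | mul x y _ _ hx hy => rw [mul_pow]; exact mul_mem hx hy

theorem finrank_adjoin_of_pow_eq {t : K} (ht : t ∉ (algebraMap F K).range) {f : F}
    (hf : t ^ p = algebraMap F K f) :
    Module.finrank F (IntermediateField.adjoin F {t}) = p := by
  have : CharP K p := charP_of_injective_algebraMap (algebraMap F K).injective p
  have hirr : Irreducible (Polynomial.X ^ p - Polynomial.C f) := by
    refine X_pow_sub_C_irreducible_of_prime hp.out fun b hb => ht ⟨b, ?_⟩
    refine frobenius_inj K p ?_
    rw [frobenius_def, frobenius_def, hf, ← map_pow, hb]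
  have hm := minpoly.eq_of_irreducible_of_monic hirr (x := t) (by simp [hf])
    (Polynomial.monic_X_pow_sub_C _ hp.out.ne_zero)
  rw [IntermediateField.adjoin.finrank ⟨_, Polynomial.monic_X_pow_sub_C f hp.out.ne_zero,
    by simp [hf]⟩, ← hm, Polynomial.natDegree_X_pow_sub_C]

end Pow

namespace Br

theorem res_id {F : Type} [Field F] (x : Br F) : res (RingHom.id F) x = x := by
  induction x using ind with | h A =>
  change res (algebraMap F F) _ = _
  rw [res_mk]
  exact mk_congr (Algebra.TensorProduct.lid F A)

theorem res_injective_of_surjective {F K : Type} [Field F] [Field K] (f : F →+* K)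
    (hf : Function.Surjective f) : Function.Injective (res f) := by
  let e := RingEquiv.ofBijective f ⟨f.injective, hf⟩
  refine Function.LeftInverse.injective (g := res (e.symm : K →+* F)) fun x => ?_
  rw [← res_comp]
  have : (e.symm : K →+* F).comp f = RingHom.id F := RingHom.ext fun a => e.symm_apply_apply a
  rw [this, res_id]

theorem eq_zero_of_res_eq_zero_of_le_bot {F Ω : Type} [Field F] [Field Ω] [Algebra F Ω]
    {E : IntermediateField F Ω} (hE : E ≤ ⊥) {α : Br F} (h : res (algebraMap F E) α = 0) :
    α = 0 := by
  refine res_injective_of_surjective _ ?_ (h.trans (map_zero _).symm)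
  intro z
  obtain ⟨a, ha⟩ := IntermediateField.mem_bot.1 (hE z.2)
  exact ⟨a, Subtype.ext ha⟩

theorem exists_eq_sym_of_res_adjoin_simple_eq_zero {F Ω : Type} [Field F] [Field Ω] [Algebra F Ω]
    {p : ℕ} [hp : Fact p.Prime] [CharP F p] (y : Ω) (f : F) (hyf : y ^ p = algebraMap F Ω f)
    {α : Br F} (h : res (algebraMap F (IntermediateField.adjoin F {y})) α = 0) :
    ∃ a, α = sym p a f := by
  by_cases hy : y ∈ (algebraMap F Ω).range
  · refine ⟨0, ?_⟩
    rw [sym_zero_left]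
    exact eq_zero_of_res_eq_zero_of_le_bot
      (IntermediateField.adjoin_simple_eq_bot_iff.2 (IntermediateField.mem_bot.2 hy)).le h
  · have hgen : IntermediateField.AdjoinSimple.gen F y ∉
        (algebraMap F (IntermediateField.adjoin F {y})).range := by
      rintro ⟨a, ha⟩
      exact hy ⟨a, congrArg Subtype.val ha⟩
    refine exists_eq_sym_of_res_eq_zero (finrank_adjoin_of_pow_eq hy hyf) hgen ?_ h
    refine Subtype.ext ?_
    rw [IntermediateField.coe_pow, IntermediateField.AdjoinSimple.coe_gen, hyf]
    rfl

theorem exists_eq_sum_sym_of_res_adjoin_eq_zero {F Ω : Type} [Field F] [Field Ω] [Algebra F Ω]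
    {p : ℕ} [hp : Fact p.Prime] [CharP F p] {r : ℕ} (y : Fin r → Ω) (f : Fin r → F)
    (hyf : ∀ j, y j ^ p = algebraMap F Ω (f j)) {α : Br F}
    (h : res (algebraMap F (IntermediateField.adjoin F (Set.range y))) α = 0) :
    ∃ x : Fin r → F, α = ∑ j, sym p (x j) (f j) := by
  induction r generalizing F with
  | zero =>
    refine ⟨Fin.elim0, ?_⟩
    rw [Finset.univ_eq_empty, Finset.sum_empty]
    refine eq_zero_of_res_eq_zero_of_le_bot ?_ h
    rw [Set.range_eq_empty, IntermediateField.adjoin_empty]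
  | succ r ih =>
    let F₁ := IntermediateField.adjoin F {y 0}
    have : CharP F₁ p := charP_of_injective_algebraMap (algebraMap F F₁).injective p
    have hpow : ∀ x : F₁, ∃ c : F, algebraMap F F₁ c = x ^ p := fun x => by
      obtain ⟨c, hc⟩ := pow_mem_range_of_mem_adjoin (p := p) (F := F) (S := {y 0})
        (by rintro _ rfl; exact ⟨_, (hyf 0).symm⟩) x.2
      exact ⟨c, Subtype.ext hc⟩
    have hle : ∀ z ∈ IntermediateField.adjoin F (Set.range y),
        z ∈ IntermediateField.adjoin F₁ (Set.range fun j : Fin r => y j.succ) := by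
      intro z hz
      have : IntermediateField.adjoin F (Set.range y) ≤ (IntermediateField.adjoin F₁
          (Set.range fun j : Fin r => y j.succ)).restrictScalars F := by
        rw [IntermediateField.adjoin_le_iff]
        rintro _ ⟨j, rfl⟩
        induction j using Fin.cases with
        | zero =>
          exact (IntermediateField.adjoin F₁ (Set.range fun j : Fin r => y j.succ)).algebraMap_mem
            ⟨y 0, IntermediateField.mem_adjoin_simple_self F (y 0)⟩
        | succ j => exact IntermediateField.subset_adjoin F₁ _ ⟨j, rfl⟩
      exact this hz
    let ι : IntermediateField.adjoin F (Set.range y) →+*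
        IntermediateField.adjoin F₁ (Set.range fun j : Fin r => y j.succ) :=
      Subring.inclusion (S := (IntermediateField.adjoin F (Set.range y)).toSubalgebra.toSubring)
        (T := (IntermediateField.adjoin F₁
          (Set.range fun j : Fin r => y j.succ)).toSubalgebra.toSubring) hle
    have h1 : res (algebraMap F₁ (IntermediateField.adjoin F₁
        (Set.range fun j : Fin r => y j.succ))) (res (algebraMap F F₁) α) = 0 := by
      have := congrArg (res ι) h
      rw [map_zero, ← res_comp] at this
      rw [← res_comp]
      exact this
    obtain ⟨x, hx⟩ := ih (fun j => y j.succ) (fun j => algebraMap F F₁ (f j.succ))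
      (fun j => hyf j.succ) h1
    choose c hc using fun j => hpow (x j)
    have h2 : res (algebraMap F F₁) (α - ∑ j, sym p (c j) (f j.succ)) = 0 := by
      rw [map_sub, map_sum, hx, sub_eq_zero]
      refine Finset.sum_congr rfl fun j _ => ?_
      rw [res_sym, hc, sym_pow_left]
    obtain ⟨a, ha⟩ := exists_eq_sym_of_res_adjoin_simple_eq_zero (y 0) (f 0) (hyf 0) h2
    refine ⟨Fin.cons a c, ?_⟩
    rw [Fin.sum_univ_succ]
    simp only [Fin.cons_zero, Fin.cons_succ]
    rw [← ha, sub_add_cancel]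

end Br

namespace Br

/-- A Brauer class is a sum of at most `r` classes of cyclic algebras of degree `p`. -/
def IsSymSum {F : Type} [Field F] (p : ℕ) [Fact p.Prime] [CharP F p] (r : ℕ) (α : Br F) : Prop :=
  ∃ a b : Fin r → F, α = ∑ i, sym p (a i) (b i)

section

variable {p : ℕ} [hp : Fact p.Prime]

theorem IsSymSum.mono {F : Type} [Field F] [CharP F p] {r s : ℕ} {α : Br F}
    (h : IsSymSum p r α) (hrs : r ≤ s) : IsSymSum p s α := by
  obtain ⟨k, rfl⟩ := Nat.exists_eq_add_of_le hrs
  obtain ⟨a, b, rfl⟩ := h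
  refine ⟨Fin.append a 0, Fin.append b 0, ?_⟩
  rw [Fin.sum_univ_add]
  simp

/-- Symbols whose second slots are polynomials in `t` with `p`-th powers as coefficients add up to
a single symbol with second slot `t`. -/
theorem sum_sym_eq_sym {K L : Type} [Field K] [Field L] [CharP K p] [CharP L p] (ψ : K →+* L)
    {m : ℕ} {a b : Fin m → K} {f : Fin m → Fin p → K} {t : K} (ht : t ≠ 0)
    (hb : ∀ i, b i = ∑ k, f i k * t ^ (k : ℕ)) (hf : ∀ i k, ∃ g, g ^ p = ψ (f i k)) :
    ∑ i, sym p (ψ (a i)) (ψ (b i)) =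
      sym p (ψ (∑ i, a i / b i * ∑ k : Fin p, ((k : ℕ) : K) * (f i k * t ^ (k : ℕ)))) (ψ t) := by
  rw [map_sum, sym_sum_left]
  refine Finset.sum_congr rfl fun i _ => ?_
  by_cases hbi : b i = 0
  · rw [hbi, map_zero, sym_zero_right, div_zero, zero_mul, map_zero, sym_zero_left]
  choose g hg using hf i
  have h1 : ψ (b i) = ∑ k : Fin p, g k ^ p * ψ t ^ (k : ℕ) := by
    rw [hb, map_sum]
    simp [hg]
  have h2 : ψ (b i) ≠ 0 := (_root_.map_ne_zero ψ).2 hbi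
  rw [h1] at h2
  rw [map_mul, map_div₀, h1, sym_sum_pow_mul _ _ _ _ _ ((_root_.map_ne_zero ψ).2 ht) h2]
  simp [hg]

theorem isSymSum_of_notMem_range {F K M : Type} [Field F] [Field K] [Field M] [CharP F p]
    [Algebra F K] [Algebra F M] (ψ : K →ₐ[F] M) (hd : Module.finrank F K = p)
    (hM : ∀ y : M, y ^ p ∈ (algebraMap F M).range) (hr : ∀ f : F, ∃ g : M, g ^ p = algebraMap F M f)
    {α : Br F} (hα : res (algebraMap F M) α = 0) {m : ℕ} [CharP K p] {a b : Fin m → K}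
    (h : res (algebraMap F K) α = ∑ i, sym p (a i) (b i)) {i₀ : Fin m}
    (hi₀ : b i₀ ∉ (algebraMap F K).range) : IsSymSum p (m * p) α := by
  have : CharP M p := charP_of_injective_algebraMap (algebraMap F M).injective p
  have ht : b i₀ ≠ 0 := fun h0 => hi₀ (h0 ▸ zero_mem _)
  obtain ⟨B, hB⟩ := exists_basis_pow hd hi₀
  let f : Fin m → Fin p → F := fun i k => B.repr (b i) k
  have hf₀ : ∀ k, f i₀ k = 0 ∨ f i₀ k = 1 := by
    intro k
    have h1 : b i₀ = B ⟨1, hp.out.one_lt⟩ := by simp [hB]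
    simp only [f]
    conv => enter [1, 1, 1, 2]; rw [h1]
    conv => enter [2, 1, 1, 2]; rw [h1]
    rw [B.repr_self, Finsupp.single_apply]
    split_ifs <;> simp
  have hb : ∀ i, b i = ∑ k, algebraMap F K (f i k) * b i₀ ^ (k : ℕ) := by
    intro i
    conv_lhs => rw [← B.sum_repr (b i)]
    refine Finset.sum_congr rfl fun k _ => ?_
    rw [hB, Algebra.smul_def]
  let w := ∑ i, a i / b i * ∑ k : Fin p, ((k : ℕ) : K) * (algebraMap F K (f i k) * b i₀ ^ (k : ℕ))
  have key : ∀ (L : Type) [Field L] [CharP L p] (φ : K →+* L),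
      (∀ i, i ≠ i₀ → ∀ k, ∃ g, g ^ p = φ (algebraMap F K (f i k))) →
      res (φ.comp (algebraMap F K)) α = sym p (φ w) (φ (b i₀)) := by
    intro L _ _ φ hφ
    rw [res_comp, h, map_sum]
    simp only [res_sym]
    refine sum_sym_eq_sym φ ht hb fun i k => ?_
    by_cases hi : i = i₀
    · subst hi
      rcases hf₀ k with h0 | h0
      · exact ⟨0, by simp [h0, hp.out.ne_zero]⟩
      · exact ⟨1, by simp [h0]⟩
    · exact hφ i hi k
  obtain ⟨w', hw'⟩ : ∃ w' : F, algebraMap F M w' = ψ w ^ p := hM (ψ w)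
  have h0 : sym p (algebraMap F M w') (ψ (b i₀)) = 0 := by
    rw [hw', sym_pow_left, ← hα, ← ψ.comp_algebraMap]
    refine (key M (ψ : K →+* M) fun i _ k => ?_).symm
    obtain ⟨g, hg⟩ := hr (f i k)
    exact ⟨g, by rw [hg]; exact (ψ.commutes _).symm⟩
  obtain ⟨y, hy⟩ := exists_coeffs_of_sym_eq_zero w' (ψ (b i₀)) (by simpa using ht) h0
  choose g hg using fun (i : Fin m) (k : Fin p) => hr (f i k)
  let z : Fin (m * p) → M := fun j =>
    let ik := finProdFinEquiv.symm j
    if ik.1 = i₀ then y ik.2 else g ik.1 ik.2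
  choose c hc using fun j => hM (z j)
  suffices hE : res (algebraMap F (IntermediateField.adjoin F (Set.range z))) α = 0 by
    obtain ⟨x, hx⟩ := exists_eq_sum_sym_of_res_adjoin_eq_zero z c (fun j => (hc j).symm) hE
    exact ⟨x, c, hx⟩
  have hyE : ∀ k, y k ∈ IntermediateField.adjoin F (Set.range z) := fun k =>
    IntermediateField.subset_adjoin F _ ⟨finProdFinEquiv (i₀, k), by
      simp only [z, Equiv.symm_apply_apply]; simp⟩
  have hgE : ∀ i, i ≠ i₀ → ∀ k, g i k ∈ IntermediateField.adjoin F (Set.range z) := fun i hi k =>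
    IntermediateField.subset_adjoin F _ ⟨finProdFinEquiv (i, k), by
      simp only [z, Equiv.symm_apply_apply]; simp [hi]⟩
  generalize IntermediateField.adjoin F (Set.range z) = E at hyE hgE
  have : CharP E p := charP_of_injective_algebraMap (algebraMap F E).injective p
  obtain ⟨htE, hsE⟩ := hy E hyE
  have hψE : ∀ x, ψ x ∈ E := by
    intro x
    rw [← B.sum_repr x, map_sum]
    refine sum_mem fun k _ => ?_
    rw [map_smul, hB, map_pow]
    exact E.smul_mem (pow_mem htE _)
  let φ : K →+* E := (ψ : K →+* M).codRestrict E hψE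
  have hφ : φ.comp (algebraMap F K) = algebraMap F E :=
    RingHom.ext fun x => Subtype.ext (ψ.commutes x)
  rw [← hφ, key E φ fun i hi k => ⟨⟨g i k, hgE i hi k⟩, Subtype.ext ?_⟩]
  · rw [← sym_pow_left, ← hsE]
    congr 1
    exact Subtype.ext hw'.symm
  · exact (hg i k).trans (ψ.commutes _).symm

end

end Br

/-- A copy of the field `F`, viewed as an `F`-algebra through the Frobenius endomorphism. -/
def FrobeniusCopy (_p : ℕ) (F : Type) : Type := F

namespace FrobeniusCopy

variable (p : ℕ) (F : Type) [Field F]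

instance : Field (FrobeniusCopy p F) := inferInstanceAs (Field F)

variable [hp : Fact p.Prime] [CharP F p]

instance : Algebra F (FrobeniusCopy p F) :=
  RingHom.toAlgebra (S := FrobeniusCopy p F) (frobenius F p)

theorem exists_algHom {K : Type} [Field K] [Algebra F K]
    (hK : ∀ x : K, x ^ p ∈ (algebraMap F K).range) : Nonempty (K →ₐ[F] FrobeniusCopy p F) := by
  have : CharP K p := charP_of_injective_algebraMap (algebraMap F K).injective p
  choose ψ hψ using hK
  have hi := (algebraMap F K).injective
  exact ⟨
    { toFun := ψ
      map_one' := hi (by rw [hψ, one_pow]; exact (map_one _).symm)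
      map_mul' := fun x y => hi (by
        rw [hψ, mul_pow, ← hψ, ← hψ]; exact (map_mul (algebraMap F K) _ _).symm)
      map_zero' := hi (by rw [hψ, zero_pow hp.out.ne_zero]; exact (map_zero _).symm)
      map_add' := fun x y => hi (by
        rw [hψ, add_pow_char, ← hψ, ← hψ]; exact (map_add (algebraMap F K) _ _).symm)
      commutes' := fun a => hi (by rw [hψ, ← map_pow]; rfl) }⟩

end FrobeniusCopy

namespace Br

variable {p : ℕ} [hp : Fact p.Prime]

theorem isSymSum_mul_of_finrank_eq {F K : Type} [Field F] [Field K] [Algebra F K] [CharP F p]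
    [CharP K p] (hd : Module.finrank F K = p) (hK : ∀ x : K, x ^ p ∈ (algebraMap F K).range)
    {α : Br F} (hα : res (frobenius F p) α = 0) {m : ℕ} (hm : 0 < m)
    (h : IsSymSum p m (res (algebraMap F K) α)) : IsSymSum p (m * p) α := by
  obtain ⟨a, b, h⟩ := h
  by_cases hb : ∀ i, b i ∈ (algebraMap F K).range
  · choose b' hb' using hb
    choose c hc using fun i => hK (a i)
    obtain ⟨t, ht⟩ : ∃ t : K, t ∉ (algebraMap F K).range := by
      by_contra! hall
      have := (finrank_eq_one_iff_of_nonzero' (K := F) (1 : K) one_ne_zero).2 fun x => by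
        obtain ⟨c, hc⟩ := hall x
        exact ⟨c, by rw [← hc, Algebra.smul_def, mul_one]⟩
      exact hp.out.one_lt.ne' (hd.symm.trans this)
    obtain ⟨f, hf⟩ := hK t
    have h0 : res (algebraMap F K) (α - ∑ i, sym p (c i) (b' i)) = 0 := by
      rw [map_sub, map_sum, h, sub_eq_zero]
      refine Finset.sum_congr rfl fun i _ => ?_
      rw [res_sym, hc, hb', sym_pow_left]
    obtain ⟨x, hx⟩ := exists_eq_sym_of_res_eq_zero hd ht hf.symm h0
    refine IsSymSum.mono (r := m + 1) ⟨Fin.snoc c x, Fin.snoc b' f, ?_⟩ ?_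
    · rw [Fin.sum_univ_castSucc]
      simp only [Fin.snoc_castSucc, Fin.snoc_last]
      rw [← hx, add_sub_cancel]
    · have := hp.out.two_le
      nlinarith
  · push Not at hb
    obtain ⟨i₀, hi₀⟩ := hb
    obtain ⟨ψ⟩ := FrobeniusCopy.exists_algHom p F hK
    exact isSymSum_of_notMem_range ψ hd (fun y => ⟨y, rfl⟩) (fun f => ⟨f, rfl⟩) hα h hi₀

theorem IsSymSum.res {F K : Type} [Field F] [Field K] [CharP F p] [CharP K p] (f : F →+* K)
    {r : ℕ} {α : Br F} (h : IsSymSum p r α) : IsSymSum p r (Br.res f α) := by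
  obtain ⟨a, b, rfl⟩ := h
  exact ⟨fun i => f (a i), fun i => f (b i), by simp [map_sum, res_sym]⟩

theorem isSymSum_mul_finrank (n : ℕ) {F K : Type} [Field F] [Field K] [Algebra F K] [CharP F p]
    [CharP K p] [FiniteDimensional F K] [IsPurelyInseparable F K] (hn : Module.finrank F K = n)
    {α : Br F} (hα : res (frobenius F p) α = 0) {m : ℕ} (hm : 0 < m)
    (h : IsSymSum p m (res (algebraMap F K) α)) : IsSymSum p (n * m) α := by
  induction n using Nat.strong_induction_on generalizing F with
  | _ n ih =>
  have hn0 : 0 < n := hn ▸ Module.finrank_pos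
  by_cases hsurj : Function.Surjective (algebraMap F K)
  · let e := RingEquiv.ofBijective (algebraMap F K) ⟨(algebraMap F K).injective, hsurj⟩
    have h1 := h.res (e.symm : K →+* F)
    have h2 : (e.symm : K →+* F).comp (algebraMap F K) = RingHom.id F :=
      RingHom.ext fun a => e.symm_apply_apply a
    rw [← res_comp, h2, res_id] at h1
    exact h1.mono (by nlinarith)
  obtain ⟨t, ht, f, hf⟩ : ∃ t : K, t ∉ (algebraMap F K).range ∧ t ^ p ∈ (algebraMap F K).range := by
    obtain ⟨x, hx⟩ := not_forall.1 hsurj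
    classical
    have hex := IsPurelyInseparable.pow_mem F p x
    have hpos : Nat.find hex ≠ 0 := fun h0 => hx (by
      have := Nat.find_spec hex
      rw [h0, pow_zero, pow_one] at this
      exact this)
    obtain ⟨k, hk⟩ := Nat.exists_eq_succ_of_ne_zero hpos
    refine ⟨x ^ p ^ k, Nat.find_min hex (by omega), ?_⟩
    rw [← pow_mul, ← pow_succ]
    have := Nat.find_spec hex
    rwa [hk] at this
  let F₁ := IntermediateField.adjoin F {t}
  have : CharP F₁ p := charP_of_injective_algebraMap (algebraMap F F₁).injective p
  have hd : Module.finrank F F₁ = p := finrank_adjoin_of_pow_eq ht hf.symm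
  have hmul := Module.finrank_mul_finrank F F₁ K
  have : IsPurelyInseparable F₁ K := IsPurelyInseparable.tower_top F F₁ K
  have hpos : 0 < Module.finrank F₁ K := Module.finrank_pos
  rw [hd, hn] at hmul
  have hlt : Module.finrank F₁ K < n := by
    have := hp.out.two_le
    nlinarith
  have hα₁ : res (frobenius F₁ p) (res (algebraMap F F₁) α) = 0 := by
    rw [← res_comp, ← RingHom.frobenius_comm, res_comp, hα, map_zero]
  have h1 := ih _ hlt rfl hα₁ (by rwa [← res_comp, ← IsScalarTower.algebraMap_eq])
  have h2 := isSymSum_mul_of_finrank_eq hd (fun x => by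
    obtain ⟨c, hc⟩ := pow_mem_range_of_mem_adjoin (p := p) (F := F) (S := {t})
      (by rintro _ rfl; exact ⟨_, hf⟩) x.2
    exact ⟨c, Subtype.ext hc⟩) hα (Nat.mul_pos hpos hm) h1
  rwa [mul_right_comm, mul_comm (Module.finrank F₁ K), hmul] at h2

end Br

/-- Finite-dimensional central simple algebras over a separably closed field are matrix algebras. -/
theorem exists_algEquiv_matrix_of_isSepClosed (S A : Type) [Field S] [IsSepClosed S] [Ring A]
    [Algebra S A] [Algebra.IsCentral S A] [IsSimpleRing A] [FiniteDimensional S A] :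
    ∃ n : ℕ, 0 < n ∧ Nonempty (A ≃ₐ[S] Matrix (Fin n) (Fin n) S) := by
  have : IsArtinianRing A := .of_finite S A
  obtain ⟨n, hn, D, _, _, _, ⟨e⟩⟩ :=
    IsSimpleRing.exists_algEquiv_matrix_divisionRing_finite S A
  have hcen : Algebra.IsCentral S D := ⟨fun d hd => by
    have h1 : e.symm (Matrix.scalar (Fin n) d) ∈ Subalgebra.center S A := by
      rw [Subalgebra.mem_center_iff]
      intro b
      apply e.injective
      rw [map_mul, map_mul, e.apply_symm_apply]
      exact (Matrix.scalar_commute d (fun r => (Subalgebra.mem_center_iff.1 hd r).symm) _).eq.symm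
    obtain ⟨s, hs⟩ := Algebra.mem_bot.1 (Algebra.IsCentral.out h1)
    have h2 := congrArg e hs
    rw [e.apply_symm_apply, AlgEquiv.commutes] at h2
    refine Algebra.mem_bot.2 ⟨s, ?_⟩
    have h3 := congrFun (congrFun h2 0) 0
    simpa [Matrix.algebraMap_matrix_apply] using h3⟩
  have hbot : (⊥ : Subalgebra S D) = ⊤ := by
    by_contra hne
    obtain ⟨x, hx, hsep⟩ := JacobsonNoether.exists_separable_and_not_isCentral' hne
    have hint : IsIntegral S x := Algebra.IsIntegral.isIntegral x
    have hdeg := IsSepClosed.degree_eq_one_of_irreducible S (minpoly.irreducible hint) hsep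
    exact hx (Algebra.mem_bot.2 (minpoly.mem_range_of_degree_eq_one S x hdeg))
  have hbij : Function.Bijective (Algebra.ofId S D) :=
    ⟨(algebraMap S D).injective, fun d =>
      Algebra.mem_bot.1 (hbot ▸ (Algebra.mem_top : d ∈ (⊤ : Subalgebra S D)))⟩
  exact ⟨n, Nat.pos_of_ne_zero hn.out,
    ⟨e.trans (AlgEquiv.mapMatrix (AlgEquiv.ofBijective _ hbij).symm)⟩⟩

open Function in
/-- The sum over a set on which `σ` acts without fixed points is a norm. -/
theorem exists_sum_eq_sum_iterate {p : ℕ} (hp : p.Prime) {X M : Type} [Fintype X] [DecidableEq X]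
    [AddCommGroup M] (g : M → M) (σ : X → X) (hσ : σ^[p] = id) (φ : X → M)
    (hφ : ∀ x, φ (σ x) = g (φ x)) (hfix : ∀ x, σ x = x → φ x = 0)
    (hg : ∀ w w', g (w + w') = g w + g w') :
    ∃ w, ∑ x, φ x = ∑ k ∈ Finset.range p, g^[k] w := by
  have hgk : ∀ k w w', g^[k] (w + w') = g^[k] w + g^[k] w' := by
    intro k
    induction k with
    | zero => simp
    | succ k ih => intro w w'; simp only [iterate_succ_apply', ih, hg]
  have hφk : ∀ k x, φ (σ^[k] x) = g^[k] (φ x) := by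
    intro k x
    induction k with
    | zero => rfl
    | succ k ih => rw [iterate_succ_apply', iterate_succ_apply', hφ, ih]
  have key : ∀ n : ℕ, ∀ s : Finset X, s.card = n → (∀ x ∈ s, σ x ∈ s) →
      ∃ w, ∑ x ∈ s, φ x = ∑ k ∈ Finset.range p, g^[k] w := by
    intro n
    induction n using Nat.strong_induction_on with
    | _ n ih =>
      intro s hs hinv
      by_cases hall : ∀ x ∈ s, σ x = x
      · refine ⟨0, ?_⟩
        have h0 : ∀ k, g^[k] 0 = 0 := fun k => by simpa using hgk k 0 0
        rw [Finset.sum_eq_zero fun x hx => hfix x (hall x hx)]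
        simp [h0]
      · push Not at hall
        obtain ⟨x, hx, hne⟩ := hall
        have hper : minimalPeriod σ x = p := by
          have hd : minimalPeriod σ x ∣ p := by
            apply IsPeriodicPt.minimalPeriod_dvd
            change σ^[p] x = x
            rw [hσ]; rfl
          refine ((Nat.dvd_prime hp).1 hd).resolve_left fun h1 => hne ?_
          exact minimalPeriod_eq_one_iff_isFixedPt.1 h1
        have hinj : Set.InjOn (fun k => σ^[k] x) (Finset.range p : Set ℕ) := by
          intro k hk l hl h
          rw [Finset.coe_range, Set.mem_Iio] at hk hl
          exact (iterate_eq_iterate_iff_of_lt_minimalPeriod (hper ▸ hk) (hper ▸ hl)).1 h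
        have hmem : ∀ k, σ^[k] x ∈ s := by
          intro k
          induction k with
          | zero => exact hx
          | succ k ih => rw [iterate_succ_apply']; exact hinv _ ih
        let O := (Finset.range p).image fun k => σ^[k] x
        have hO : O ⊆ s := by
          intro y hy
          obtain ⟨k, -, rfl⟩ := Finset.mem_image.1 hy
          exact hmem k
        have hxO : x ∈ O := Finset.mem_image.2 ⟨0, Finset.mem_range.2 hp.pos, rfl⟩
        have hlt : (s \ O).card < n := by
          rw [← hs]
          exact Finset.card_lt_card (Finset.sdiff_ssubset hO ⟨x, hxO⟩)
        obtain ⟨w, hw⟩ := ih _ hlt (s \ O) rfl (by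
          intro y hy
          obtain ⟨hys, hyO⟩ := Finset.mem_sdiff.1 hy
          refine Finset.mem_sdiff.2 ⟨hinv y hys, fun h => hyO ?_⟩
          obtain ⟨k, -, hk⟩ := Finset.mem_image.1 h
          refine Finset.mem_image.2 ⟨(k + (p - 1)) % p,
            Finset.mem_range.2 (Nat.mod_lt _ hp.pos), ?_⟩
          nth_rw 2 [← hper]
          rw [iterate_mod_minimalPeriod_eq, add_comm, iterate_add_apply]
          rw [hk, ← iterate_succ_apply, Nat.succ_eq_add_one, Nat.sub_add_cancel hp.one_lt.le, hσ]
          rfl)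
        refine ⟨w + φ x, ?_⟩
        rw [← Finset.sum_sdiff hO, hw, Finset.sum_image hinj]
        simp only [hgk, hφk, Finset.sum_add_distrib]
  exact key _ Finset.univ rfl fun x _ => Finset.mem_univ _

/-- The kernel of a linear map keeps its dimension under extension of scalars. -/
theorem finrank_ker_baseChange {F S V W : Type} [Field F] [Field S] [Algebra F S] [AddCommGroup V]
    [Module F V] [AddCommGroup W] [Module F W] (f : V →ₗ[F] W) :
    Module.finrank S (LinearMap.ker (f.baseChange S)) = Module.finrank F (LinearMap.ker f) := by
  have h := Module.Flat.ker_lTensor_eq S S f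
  have h' : LinearMap.ker (f.baseChange S) =
      LinearMap.range ((LinearMap.ker f).subtype.baseChange S) := h
  rw [h', LinearMap.finrank_range_of_inj, Module.finrank_baseChange]
  exact Module.Flat.lTensor_preserves_injective_linearMap _ (LinearMap.ker f).injective_subtype

namespace PiTensorProduct

variable {F A : Type} [Field F] [Ring A] [Algebra F A] {ι : Type} [Fintype ι]

/-- The algebra endomorphism permuting the factors of a tensor power. -/
noncomputable def permAlgHom (ρ : Equiv.Perm ι) : (⨂[F] _ : ι, A) →ₐ[F] ⨂[F] _ : ι, A :=
  liftAlgHom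
    { toFun := fun a => tprod F (a ∘ ρ)
      map_update_add' := fun {_} a i x y => by
        simp only [Function.update_comp_equiv]
        convert (tprod F).map_update_add (a ∘ ρ) (ρ.symm i) x y
      map_update_smul' := fun {_} a i c x => by
        simp only [Function.update_comp_equiv]
        convert (tprod F).map_update_smul (a ∘ ρ) (ρ.symm i) c x }
    rfl (fun a b => by simp; rfl)

omit [Fintype ι] in
@[simp]
theorem permAlgHom_tprod (ρ : Equiv.Perm ι) (a : ι → A) :
    permAlgHom ρ (tprod F a) = tprod F (a ∘ ρ) :=
  lift.tprod _

omit [Fintype ι] in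
theorem permAlgHom_iterate_tprod (ρ : Equiv.Perm ι) (k : ℕ) (a : ι → A) :
    (permAlgHom (F := F) ρ)^[k] (tprod F a) = tprod F (a ∘ ρ^[k]) := by
  induction k with
  | zero => rfl
  | succ k ih =>
    rw [Function.iterate_succ_apply', ih, permAlgHom_tprod, Function.iterate_succ]; rfl

omit [Fintype ι] in
theorem permAlgHom_iterate_eq_self (ρ : Equiv.Perm ι) (k : ℕ) (hk : ρ^[k] = id)
    (x : ⨂[F] _ : ι, A) : (permAlgHom (F := F) ρ)^[k] x = x := by
  have h : (permAlgHom (F := F) (A := A) ρ) ^ k = 1 := by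
    apply AlgHom.ext
    intro x
    induction x using PiTensorProduct.induction_on with
    | smul_tprod r a =>
      rw [map_smul, map_smul, AlgHom.coe_pow, permAlgHom_iterate_tprod, hk]; rfl
    | add x y hx hy => rw [map_add, map_add, hx, hy]
  rw [← AlgHom.coe_pow, h]; rfl

variable {S : Type} [Field S] [Algebra F S] {n : ℕ}

/-- The product of matrix entries, as a multilinear form. -/
noncomputable def entryMultilinear (f : A →ₐ[F] Matrix (Fin n) (Fin n) S) (x y : ι → Fin n) :
    MultilinearMap F (fun _ : ι => A) S :=
  (MultilinearMap.mkPiAlgebra F ι S).compLinearMap fun i =>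
    (Matrix.entryLinearMap F S (x i) (y i)).comp f.toLinearMap

theorem entryMultilinear_apply (f : A →ₐ[F] Matrix (Fin n) (Fin n) S) (x y : ι → Fin n)
    (a : ι → A) : entryMultilinear f x y a = ∏ i, f (a i) (x i) (y i) := by
  simp [entryMultilinear]

/-- The tensor power of a matrix representation. -/
noncomputable def matrixAlgHom [DecidableEq ι] (f : A →ₐ[F] Matrix (Fin n) (Fin n) S) :
    (⨂[F] _ : ι, A) →ₐ[F] Matrix (ι → Fin n) (ι → Fin n) S :=
  liftAlgHom
    { toFun := fun a => Matrix.of fun x y => entryMultilinear f x y a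
      map_update_add' := fun {_} a i u v => by
        ext x y
        exact (entryMultilinear f x y).map_update_add a i u v
      map_update_smul' := fun {_} a i c u => by
        ext x y
        exact (entryMultilinear f x y).map_update_smul a i c u }
    (by
      ext x y
      simp [entryMultilinear_apply, Matrix.one_apply, Finset.prod_ite_zero, funext_iff])
    (fun a b => by
      ext x y
      simp only [MultilinearMap.coe_mk, Matrix.of_apply, entryMultilinear_apply, Pi.mul_apply, map_mul, Matrix.mul_apply]
      rw [Finset.prod_univ_sum]
      simp only [Finset.prod_mul_distrib, Fintype.piFinset_univ])

@[simp]
theorem matrixAlgHom_tprod [DecidableEq ι] (f : A →ₐ[F] Matrix (Fin n) (Fin n) S) (a : ι → A)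
    (x y : ι → Fin n) : matrixAlgHom f (tprod F a) x y = ∏ i, f (a i) (x i) (y i) := by
  have h : matrixAlgHom f (tprod F a) = Matrix.of fun x y => entryMultilinear f x y a :=
    lift.tprod _
  rw [h, ← entryMultilinear_apply]
  rfl

theorem matrixAlgHom_permAlgHom [DecidableEq ι] (f : A →ₐ[F] Matrix (Fin n) (Fin n) S)
    (ρ : Equiv.Perm ι) (b : ⨂[F] _ : ι, A) :
    matrixAlgHom f (permAlgHom ρ b) =
      (matrixAlgHom f b).submatrix (fun x => x ∘ ρ.symm) (fun x => x ∘ ρ.symm) := by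
  induction b using PiTensorProduct.induction_on with
  | smul_tprod r a =>
    ext x y
    simp only [map_smul, permAlgHom_tprod, Matrix.submatrix_apply, Matrix.smul_apply,
      matrixAlgHom_tprod]
    congr 1
    exact Fintype.prod_equiv ρ _ _ fun i => by simp
  | add x y hx hy => simp only [map_add, hx, hy]; rfl

end PiTensorProduct

section Perm

variable {S X : Type} [Field S] [Fintype X] [DecidableEq X]

omit [Fintype X] [DecidableEq X] in
theorem funLeft_pow_apply (τ : Equiv.Perm X) (k : ℕ) (v : X → S) (x : X) :
    (LinearMap.funLeft S S τ ^ k) v x = v (τ^[k] x) := by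
  induction k generalizing v with
  | zero => rfl
  | succ k ih =>
    rw [pow_succ, Module.End.mul_apply, ih, LinearMap.funLeft_apply, Function.iterate_succ_apply']

/-- A vector fixed by a permutation of prime order and vanishing at its fixed points is a norm. -/
theorem mem_range_norm_of_vanish {p : ℕ} (hp : p.Prime) (τ : Equiv.Perm X) (hτ : τ^[p] = id)
    (v : X → S) (hv : LinearMap.funLeft S S τ v = v) (h0 : ∀ x, τ x = x → v x = 0) :
    v ∈ LinearMap.range (∑ k ∈ Finset.range p, LinearMap.funLeft S S τ ^ k) := by
  have hvx : ∀ x, v (τ x) = v x := fun x => congrFun hv x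
  obtain ⟨w, hw⟩ := exists_sum_eq_sum_iterate hp (LinearMap.funLeft S S τ) τ.symm
    (by
      funext x
      have h : ∀ k, τ.symm^[k] (τ^[k] x) = x :=
        fun k => (Function.LeftInverse.iterate τ.symm_apply_apply k) x
      have h' := h p
      rw [hτ] at h'
      exact h')
    (fun x => Pi.single x (v x))
    (fun x => by
      funext y
      rw [LinearMap.funLeft_apply]
      by_cases h : τ y = x
      · subst h; simp [hvx]
      · rw [Pi.single_eq_of_ne h, Pi.single_eq_of_ne]
        rintro rfl
        exact h (τ.apply_symm_apply x))
    (fun x hx => by rw [h0 x (by rw [← hx, τ.apply_symm_apply, hx])]; simp)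
    (fun a b => map_add _ a b)
  refine ⟨w, ?_⟩
  rw [Finset.univ_sum_single] at hw
  rw [hw, LinearMap.sum_apply]
  exact Finset.sum_congr rfl fun k _ => by rw [Module.End.coe_pow]

theorem range_norm_le_ker {V : Type} [AddCommGroup V] [Module S V] {p : ℕ} (g : Module.End S V)
    (hg : g ^ p = 1) :
    LinearMap.range (∑ k ∈ Finset.range p, g ^ k) ≤ LinearMap.ker (g - 1) := by
  rw [LinearMap.range_le_ker_iff]
  have h := mul_geom_sum g p
  rw [hg, sub_self] at h
  exact h

theorem finrank_fixed_bounds {p : ℕ} (hp : p.Prime) [CharP S p] (τ : Equiv.Perm X)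
    (hτ : τ^[p] = id) (x₀ : X) (hx₀ : τ x₀ = x₀) :
    Fintype.card X < Module.finrank S (LinearMap.ker (LinearMap.funLeft S S τ - 1)) +
        Module.finrank S (LinearMap.ker (∑ k ∈ Finset.range p, LinearMap.funLeft S S τ ^ k)) ∧
      Module.finrank S (LinearMap.ker (LinearMap.funLeft S S τ - 1)) +
        Module.finrank S (LinearMap.ker (∑ k ∈ Finset.range p, LinearMap.funLeft S S τ ^ k)) ≤
          Fintype.card X + Fintype.card {x // τ x = x} := by
  have hpow : LinearMap.funLeft S S τ ^ p = 1 :=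
    LinearMap.ext fun v => funext fun x => by rw [funLeft_pow_apply, hτ]; rfl
  have hle := range_norm_le_ker _ hpow
  have hrn := LinearMap.finrank_range_add_finrank_ker
    (∑ k ∈ Finset.range p, LinearMap.funLeft S S τ ^ k)
  rw [Module.finrank_pi] at hrn
  have hmem : ∀ v, v ∈ LinearMap.ker (LinearMap.funLeft S S τ - 1) ↔
      LinearMap.funLeft S S τ v = v := fun v => by
    rw [LinearMap.mem_ker, LinearMap.sub_apply, sub_eq_zero]; rfl
  constructor
  · have hlt : LinearMap.range (∑ k ∈ Finset.range p, LinearMap.funLeft S S τ ^ k) <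
        LinearMap.ker (LinearMap.funLeft S S τ - 1) := by
      refine lt_of_le_not_ge hle fun h => ?_
      have h1 : (Pi.single x₀ 1 : X → S) ∈ LinearMap.ker (LinearMap.funLeft S S τ - 1) := by
        rw [hmem]
        funext y
        rw [LinearMap.funLeft_apply]
        by_cases hy : y = x₀
        · rw [hy, hx₀]
        · rw [Pi.single_eq_of_ne hy, Pi.single_eq_of_ne]
          exact fun h => hy (τ.injective (h.trans hx₀.symm))
      obtain ⟨w, hw⟩ := h h1
      have h2 := congrFun hw x₀
      rw [LinearMap.sum_apply, Finset.sum_apply, Pi.single_eq_same] at h2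
      have h3 : ∀ k, τ^[k] x₀ = x₀ := fun k => Function.iterate_fixed hx₀ k
      simp only [funLeft_pow_apply, h3] at h2
      simp at h2
    have := Submodule.finrank_lt_finrank_of_lt hlt
    lia
  · let ev : LinearMap.ker (LinearMap.funLeft S S τ - 1) →ₗ[S] ({x // τ x = x} → S) :=
      (LinearMap.funLeft S S Subtype.val).comp (Submodule.subtype _)
    have h1 := LinearMap.finrank_range_add_finrank_ker ev
    have h2 : Module.finrank S (LinearMap.range ev) ≤ Fintype.card {x // τ x = x} := by
      refine (Submodule.finrank_le _).trans_eq ?_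
      rw [Module.finrank_pi]
    have h3 : Module.finrank S (LinearMap.ker ev) ≤ Module.finrank S
        (LinearMap.range (∑ k ∈ Finset.range p, LinearMap.funLeft S S τ ^ k)) := by
      rw [← Submodule.finrank_map_subtype_eq]
      refine Submodule.finrank_mono ?_
      rintro _ ⟨v, hv, rfl⟩
      refine mem_range_norm_of_vanish hp τ hτ _ ((hmem _).1 v.2) fun x hx => ?_
      exact congrFun (LinearMap.mem_ker.1 hv) ⟨x, hx⟩
    lia

end Perm

section Transfer

variable {F S V W : Type} [Field F] [Field S] [Algebra F S] [AddCommGroup V] [Module F V]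
  [AddCommGroup W] [Module S W]

/-- The image of an endomorphism under extension of scalars and transport of structure. -/
noncomputable def transportEnd (T : (S ⊗[F] V) ≃ₗ[S] W) : Module.End F V →+* Module.End S W :=
  ((T.conjAlgEquiv S : Module.End S (S ⊗[F] V) →+* Module.End S W)).comp
    (Module.End.baseChangeHom F S V).toRingHom

theorem transportEnd_apply (T : (S ⊗[F] V) ≃ₗ[S] W) (f : Module.End F V) (v : S ⊗[F] V) :
    transportEnd T f (T v) = T (f.baseChange S v) := by
  change T (f.baseChange S (T.symm (T v))) = _
  rw [T.symm_apply_apply]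

theorem finrank_ker_transportEnd (T : (S ⊗[F] V) ≃ₗ[S] W) (f : Module.End F V) :
    Module.finrank S (LinearMap.ker (transportEnd T f)) = Module.finrank F (LinearMap.ker f) := by
  rw [← finrank_ker_baseChange (S := S) f]
  have h : LinearMap.ker (transportEnd T f) =
      (LinearMap.ker (f.baseChange S)).map (T : (S ⊗[F] V) →ₗ[S] W) := by
    ext w
    obtain ⟨v, rfl⟩ := T.surjective w
    simp [transportEnd_apply]
  rw [h]
  exact LinearEquiv.finrank_map_eq T _

end Transfer

section SkolemNoether

variable {F S B V W : Type} [Field F] [Field S] [Algebra F S] [Ring B] [Algebra F B]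
  [Algebra.IsCentral F B] [IsSimpleRing B] [FiniteDimensional F B]
  [AddCommGroup V] [Module F V] [FiniteDimensional F V] [Nontrivial V]
  [AddCommGroup W] [Module S W] [Module F W] [IsScalarTower F S W] [FiniteDimensional S W]
  [Nontrivial W]

omit [Algebra.IsCentral F B] [IsSimpleRing B] [FiniteDimensional F B] [FiniteDimensional S W]
  [Nontrivial W] in
/-- The extension of scalars of a representation over a larger field. -/
noncomputable def extendScalarsHom (β : B →ₐ[F] Module.End S W) :
    (S ⊗[F] B) →ₐ[S] Module.End S W :=
  Algebra.TensorProduct.lift (Algebra.ofId S (Module.End S W)) β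
    fun s b => Algebra.commute_algebraMap_left s (β b)

omit [Algebra.IsCentral F B] [IsSimpleRing B] [FiniteDimensional F B] [FiniteDimensional S W]
  [Nontrivial W] in
theorem extendScalarsHom_tmul (β : B →ₐ[F] Module.End S W) (s : S) (b : B) :
    extendScalarsHom β (s ⊗ₜ b) = algebraMap S (Module.End S W) s * β b :=
  Algebra.TensorProduct.lift_tmul _ _ _ _ _

/-- A representation of the right dimension becomes bijective after extending scalars. -/
theorem bijective_extendScalarsHom (β : B →ₐ[F] Module.End S W)
    (h : Module.finrank F B = Module.finrank S W ^ 2) :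
    Function.Bijective (extendScalarsHom β) :=
  bijective_of_finrank_eq _ (by
    rw [Module.finrank_baseChange, h, Module.finrank_linearMap, sq])

theorem exists_transportEnd_eq (e : B ≃ₐ[F] Module.End F V) (β : B →ₐ[F] Module.End S W)
    (h : Module.finrank F B = Module.finrank S W ^ 2) :
    ∃ T : (S ⊗[F] V) ≃ₗ[S] W, ∀ b, transportEnd T (e b) = β b := by
  have hβ := bijective_extendScalarsHom β h
  have hγ := bijective_extendScalarsHom (S := S)
    ((Module.End.baseChangeHom F S V).comp e.toAlgHom) (by
      rw [Module.finrank_baseChange, e.toLinearEquiv.finrank_eq, Module.finrank_linearMap, sq])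
  obtain ⟨T, hT⟩ := AlgEquiv.eq_linearEquivConjAlgEquiv
    ((AlgEquiv.ofBijective _ hγ).symm.trans (AlgEquiv.ofBijective _ hβ))
  refine ⟨T, fun b => ?_⟩
  have h1 : T.conjAlgEquiv S (AlgEquiv.ofBijective _ hγ (1 ⊗ₜ b)) = β b := by
    rw [← hT, AlgEquiv.trans_apply, AlgEquiv.symm_apply_apply, AlgEquiv.coe_ofBijective,
      extendScalarsHom_tmul, map_one, one_mul]
  rw [← h1, AlgEquiv.coe_ofBijective, extendScalarsHom_tmul, map_one, one_mul]
  rfl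

theorem exists_eq_algebraMap_of_commute (β : B →ₐ[F] Module.End S W)
    (h : Module.finrank F B = Module.finrank S W ^ 2) (M : Module.End S W)
    (hM : ∀ b, β b * M = M * β b) : ∃ s, M = algebraMap S (Module.End S W) s := by
  have hβ := bijective_extendScalarsHom β h
  have hc : M ∈ Subalgebra.center S (Module.End S W) := by
    rw [Subalgebra.mem_center_iff]
    intro x
    obtain ⟨y, rfl⟩ := hβ.2 x
    induction y with
    | zero => simp
    | tmul s b =>
      rw [extendScalarsHom_tmul, mul_assoc, hM, ← mul_assoc, ← mul_assoc]
      congr 1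
      exact Algebra.commutes s M
    | add x y hx hy => rw [map_add, add_mul, mul_add, hx, hy]
  obtain ⟨s, hs⟩ := Algebra.mem_bot.1 (Algebra.IsCentral.out hc)
  exact ⟨s, hs.symm⟩

/-- An automorphism of `B = End F V` of order dividing `p` which is implemented by an operator of
order `p` over a separable extension is implemented by such an operator over `F`. -/
theorem exists_operator_of_transport {p : ℕ} [Fact p.Prime] [CharP F p] [Algebra.IsSeparable F S]
    (e : B ≃ₐ[F] Module.End F V) (β : B →ₐ[F] Module.End S W)
    (h : Module.finrank F B = Module.finrank S W ^ 2) (c : B →ₐ[F] B) (hc : ∀ b, c^[p] b = b)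
    (Q : Module.End S W) (hQ : Q ^ p = 1) (hQβ : ∀ b, β (c b) * Q = Q * β b) :
    ∃ (g : Module.End F V) (T : (S ⊗[F] V) ≃ₗ[S] W), transportEnd T g = Q ∧
      ∀ b, e (c b) * g = g * e b := by
  obtain ⟨T, hT⟩ := exists_transportEnd_eq e β h
  have hcb : Function.Bijective c := bijective_of_finrank_eq c rfl
  obtain ⟨g₀, hg₀⟩ := AlgEquiv.eq_linearEquivConjAlgEquiv
    (e.symm.trans ((AlgEquiv.ofBijective c hcb).trans e))
  let G : Module.End F V := g₀.toLinearMap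
  let G' : Module.End F V := g₀.symm.toLinearMap
  have hGG' : G * G' = 1 := LinearMap.ext fun v => g₀.apply_symm_apply v
  have hG'G : G' * G = 1 := LinearMap.ext fun v => g₀.symm_apply_apply v
  have hconj : ∀ b, e (c b) = G * e b * G' := fun b => by
    have h1 := congrArg (fun E => E (e b)) hg₀
    simp only [AlgEquiv.trans_apply, AlgEquiv.symm_apply_apply, AlgEquiv.coe_ofBijective] at h1
    rw [h1]
    rfl
  have hG : ∀ b, e (c b) * G = G * e b := fun b => by
    rw [hconj, mul_assoc, hG'G, mul_one]
  have hG' : ∀ b, G' * e (c b) = e b * G' := fun b => by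
    rw [hconj, ← mul_assoc, ← mul_assoc, hG'G, one_mul]
  have hGk : ∀ k b, e (c^[k] b) * G ^ k = G ^ k * e b := by
    intro k
    induction k with
    | zero => intro b; simp
    | succ k ih =>
      intro b
      rw [Function.iterate_succ_apply', pow_succ', ← mul_assoc, hG, mul_assoc, ih, mul_assoc]
  obtain ⟨l, hl⟩ : ∃ l : F, G ^ p = algebraMap F (Module.End F V) l := by
    have hcen : G ^ p ∈ Subalgebra.center F (Module.End F V) := by
      rw [Subalgebra.mem_center_iff]
      intro x
      obtain ⟨b, rfl⟩ := e.surjective x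
      have := hGk p b
      rwa [hc] at this
    obtain ⟨l, hl⟩ := Algebra.mem_bot.1 (Algebra.IsCentral.out hcen)
    exact ⟨l, hl.symm⟩
  have hsmul : ∀ (a : F) (f : Module.End F V),
      transportEnd T (a • f) = algebraMap F S a • transportEnd T f := by
    intro a f
    refine LinearMap.ext fun w => ?_
    obtain ⟨v, rfl⟩ := T.surjective w
    rw [LinearMap.smul_apply, transportEnd_apply, transportEnd_apply, LinearMap.baseChange_smul,
      ← map_smul, LinearMap.smul_apply, algebraMap_smul]
  obtain ⟨m, hm⟩ := exists_eq_algebraMap_of_commute β h (transportEnd T G' * Q) (fun b => by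
    rw [mul_assoc, ← hQβ, ← mul_assoc, ← mul_assoc, ← hT, ← hT, ← map_mul, ← map_mul, hG'])
  have hQm : Q = m • transportEnd T G := by
    have h1 : transportEnd T G * (transportEnd T G' * Q) = Q := by
      rw [← mul_assoc, ← map_mul, hGG', map_one, one_mul]
    rw [← h1, hm, ← Algebra.commutes, Algebra.smul_def]
  have hone : m ^ p * algebraMap F S l = 1 := by
    have h1 := hQ
    rw [hQm, smul_pow, ← map_pow, hl, Algebra.algebraMap_eq_smul_one, hsmul, map_one,
      smul_smul] at h1
    obtain ⟨w, hw⟩ := exists_ne (0 : W)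
    have h2 := congrArg (fun f : Module.End S W => f w) h1
    simp only [LinearMap.smul_apply, Module.End.one_apply] at h2
    exact smul_left_injective S hw (h2.trans (one_smul S w).symm)
  have hmem : m ∈ perfectClosure F S := by
    rw [mem_perfectClosure_iff_pow_mem p]
    refine ⟨1, l⁻¹, ?_⟩
    rw [pow_one, map_inv₀]
    exact (eq_inv_of_mul_eq_one_left hone).symm
  rw [perfectClosure.eq_bot_of_isSeparable, IntermediateField.mem_bot] at hmem
  obtain ⟨a, rfl⟩ := hmem
  refine ⟨a • G, T, by rw [hsmul, ← hQm], fun b => ?_⟩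
  rw [mul_smul_comm, hG, smul_mul_assoc]

end SkolemNoether

section Rotation

variable {p : ℕ} [NeZero p]

theorem addRight_one_iterate : (Equiv.addRight (1 : Fin p))^[p] = id := by
  funext x
  have h := congrFun (add_right_iterate (1 : Fin p) p) x
  have h2 : p • (1 : Fin p) = 0 := by
    simpa using card_nsmul_eq_zero (x := (1 : Fin p))
  rw [h2, add_zero] at h
  exact h

theorem comp_addRight_one_eq_iff {Y : Type} (r : Fin p → Y) :
    r ∘ Equiv.addRight (1 : Fin p) = r ↔ ∃ y, Function.const (Fin p) y = r := by
  constructor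
  · intro h
    refine ⟨r 0, funext fun k => ?_⟩
    have key : ∀ m (hm : m < p), r ⟨m, hm⟩ = r 0 := by
      intro m
      induction m with
      | zero => intro hm; rfl
      | succ m ih =>
        intro hm
        rw [← ih (Nat.lt_of_succ_lt hm)]
        have h1 : (⟨m + 1, hm⟩ : Fin p) = ⟨m, Nat.lt_of_succ_lt hm⟩ + 1 := by
          apply Fin.ext
          rw [Fin.val_add, Fin.val_one', Nat.add_mod_mod, Nat.mod_eq_of_lt hm]
        rw [h1]
        exact congrFun h ⟨m, Nat.lt_of_succ_lt hm⟩
    exact (key k k.2).symm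
  · rintro ⟨y, rfl⟩
    rfl

theorem comp_iterate_addRight_one {Y : Type} :
    (fun r : Fin p → Y => r ∘ Equiv.addRight (1 : Fin p))^[p] = id := by
  have key : ∀ k, (fun r : Fin p → Y => r ∘ Equiv.addRight (1 : Fin p))^[k] =
      fun r => r ∘ (Equiv.addRight (1 : Fin p))^[k] := by
    intro k
    induction k with
    | zero => rfl
    | succ k ih => rw [Function.iterate_succ', ih, Function.iterate_succ]; rfl
  rw [key, addRight_one_iterate]
  rfl

/-- The map `a ↦ a ⊗ ⋯ ⊗ a` is additive up to norms for the rotation of the factors. -/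
theorem PiTensorProduct.tprod_const_add {F A : Type} [Field F] [Ring A] [Algebra F A]
    (hp : p.Prime) (a b : A) :
    ∃ w : ⨂[F] _ : Fin p, A,
      tprod F (fun _ : Fin p => a + b) = tprod F (fun _ => a) + tprod F (fun _ => b) +
        ∑ k ∈ Finset.range p, (permAlgHom (Equiv.addRight (1 : Fin p)))^[k] w := by
  classical
  let t : (Fin p → Fin 2) → ⨂[F] _ : Fin p, A := fun r => tprod F (![a, b] ∘ r)
  obtain ⟨w, hw⟩ := exists_sum_eq_sum_iterate hp
    (permAlgHom (F := F) (A := A) (Equiv.addRight (1 : Fin p)))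
    (fun r : Fin p → Fin 2 => r ∘ Equiv.addRight (1 : Fin p)) comp_iterate_addRight_one
    (fun r => if r ∘ Equiv.addRight (1 : Fin p) = r then 0 else t r)
    (fun r => by
      have h : (r ∘ Equiv.addRight (1 : Fin p)) ∘ Equiv.addRight (1 : Fin p) =
          r ∘ Equiv.addRight (1 : Fin p) ↔ r ∘ Equiv.addRight (1 : Fin p) = r :=
        (Equiv.surjective _).injective_comp_right.eq_iff
      simp only [h]
      split_ifs with h1
      · rw [map_zero]
      · rw [permAlgHom_tprod]; rfl)
    (fun r hr => if_pos hr) (fun x y => map_add _ x y)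
  refine ⟨w, ?_⟩
  rw [← hw]
  have h1 : tprod F (fun _ : Fin p => a + b) = ∑ r, t r := by
    have h := (tprod F (s := fun _ : Fin p => A)).map_sum
      (fun (_ : Fin p) (j : Fin 2) => (![a, b] : Fin 2 → A) j)
    simp only [Fin.sum_univ_two] at h
    exact h
  have h2 : tprod F (fun _ : Fin p => a) + tprod F (fun _ => b) =
      ∑ r, if r ∘ Equiv.addRight (1 : Fin p) = r then t r else 0 := by
    rw [← Finset.sum_filter]
    have h3 : (Finset.univ.filter fun r : Fin p → Fin 2 => r ∘ Equiv.addRight (1 : Fin p) = r) =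
        Finset.univ.image (Function.const (Fin p)) := by
      ext r
      rw [Finset.mem_filter, comp_addRight_one_eq_iff]
      simp only [Finset.mem_univ, true_and, Finset.mem_image]
    rw [h3, Finset.sum_image Function.const_injective.injOn, Fin.sum_univ_two]
    rfl
  rw [h1, h2, ← Finset.sum_add_distrib]
  exact Finset.sum_congr rfl fun r _ => by split_ifs <;> simp

end Rotation

section Tate

variable {F V : Type} [Field F] [AddCommGroup V] [Module F V]

/-- The degree zero Tate cohomology of an operator `g` of order dividing `p`. -/
abbrev TateZero (p : ℕ) (g : Module.End F V) : Type :=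
  LinearMap.ker (g - 1) ⧸ (LinearMap.range (∑ k ∈ Finset.range p, g ^ k)).submoduleOf
    (LinearMap.ker (g - 1))

theorem mem_ker_sub_one {g : Module.End F V} {v : V} :
    v ∈ LinearMap.ker (g - 1) ↔ g v = v := by
  rw [LinearMap.mem_ker, LinearMap.sub_apply, sub_eq_zero]; rfl

theorem finrank_tateZero [FiniteDimensional F V] {p : ℕ} (g : Module.End F V) (hg : g ^ p = 1) :
    Module.finrank F (TateZero p g) + Module.finrank F V =
      Module.finrank F (LinearMap.ker (g - 1)) +
        Module.finrank F (LinearMap.ker (∑ k ∈ Finset.range p, g ^ k)) := by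
  have h1 := Submodule.finrank_quotient_add_finrank
    ((LinearMap.range (∑ k ∈ Finset.range p, g ^ k)).submoduleOf (LinearMap.ker (g - 1)))
  have h2 := LinearMap.finrank_range_add_finrank_ker (∑ k ∈ Finset.range p, g ^ k)
  have h3 := (Submodule.submoduleOfEquivOfLe (range_norm_le_ker g hg)).finrank_eq
  rw [h3] at h1
  unfold TateZero
  lia

/-- The action on Tate cohomology of an operator commuting with `g`. -/
noncomputable def tateMap (p : ℕ) {g f : Module.End F V} (h : f * g = g * f) :
    Module.End F (TateZero p g) :=
  Submodule.mapQ _ _ (f.restrict (p := LinearMap.ker (g - 1)) (q := LinearMap.ker (g - 1))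
    fun v hv => by
      rw [mem_ker_sub_one] at hv ⊢
      rw [← Module.End.mul_apply, ← h, Module.End.mul_apply, hv]) (by
    rintro ⟨v, hv⟩ hvr
    obtain ⟨w, hw⟩ := Submodule.mem_comap.1 hvr
    refine Submodule.mem_comap.2 (Submodule.mem_comap.2 ⟨f w, ?_⟩)
    have hc : Commute f (∑ k ∈ Finset.range p, g ^ k) :=
      Commute.sum_right _ _ _ fun k _ => (show Commute f g from h).pow_right k
    rw [← Module.End.mul_apply, ← hc.eq, Module.End.mul_apply, hw]
    rfl)

theorem TateZero.mk_eq_mk_iff {p : ℕ} {g : Module.End F V} (v w : LinearMap.ker (g - 1)) :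
    (Submodule.Quotient.mk v : TateZero p g) = Submodule.Quotient.mk w ↔
      ∃ u, (∑ k ∈ Finset.range p, g ^ k) u = v - w := by
  rw [Submodule.Quotient.eq]
  rfl

end Tate

section FrobeniusRep

variable {p : ℕ} [NeZero p] {F A V : Type} [Field F] [Ring A] [Algebra F A]
  [AddCommGroup V] [Module F V]

open PiTensorProduct

/-- An algebra acts Frobenius-semilinearly on the Tate cohomology of the rotation operator on a
representation of its `p`-th tensor power. -/
theorem exists_ringHom_tateZero (hp : p.Prime) (e : (⨂[F] _ : Fin p, A) →ₐ[F] Module.End F V)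
    (g : Module.End F V)
    (hg : ∀ b, e (permAlgHom (Equiv.addRight (1 : Fin p)) b) * g = g * e b) :
    ∃ θ : A →+* Module.End F (TateZero p g),
      ∀ l, θ (algebraMap F A l) = algebraMap F _ (l ^ p) := by
  have hcomm : ∀ a : A, e (tprod F fun _ => a) * g = g * e (tprod F fun _ => a) := fun a => by
    have h := hg (tprod F fun _ => a)
    rwa [permAlgHom_tprod] at h
  have hpow : ∀ k b, e ((permAlgHom (Equiv.addRight (1 : Fin p)))^[k] b) * g ^ k =
      g ^ k * e b := by
    intro k
    induction k with
    | zero => intro b; simp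
    | succ k ih =>
      intro b
      rw [Function.iterate_succ_apply', pow_succ', ← mul_assoc, hg, mul_assoc, ih, mul_assoc]
  have hfix : ∀ k (v : LinearMap.ker (g - 1)), (g ^ k) (v : V) = v := by
    intro k v
    induction k with
    | zero => rfl
    | succ k ih =>
      rw [pow_succ, Module.End.mul_apply, mem_ker_sub_one.1 v.2, ih]
  refine ⟨{ toFun := fun a => tateMap p (hcomm a)
            map_one' := ?_, map_mul' := ?_, map_zero' := ?_, map_add' := ?_ }, ?_⟩
  · refine LinearMap.ext fun x => ?_
    obtain ⟨v, rfl⟩ := Submodule.Quotient.mk_surjective _ x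
    have h1 : e (tprod F fun _ => (1 : A)) = 1 := map_one e
    refine congrArg Submodule.Quotient.mk (Subtype.ext ?_)
    exact LinearMap.congr_fun h1 v
  · intro a b
    refine LinearMap.ext fun x => ?_
    obtain ⟨v, rfl⟩ := Submodule.Quotient.mk_surjective _ x
    have h1 : e (tprod F fun _ => a * b) =
        e (tprod F fun _ => a) * e (tprod F fun _ => b) := by
      rw [← map_mul, tprod_mul_tprod]; rfl
    refine congrArg Submodule.Quotient.mk (Subtype.ext ?_)
    exact LinearMap.congr_fun h1 v
  · refine LinearMap.ext fun x => ?_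
    obtain ⟨v, rfl⟩ := Submodule.Quotient.mk_surjective _ x
    have h1 : e (tprod F fun _ => (0 : A)) = 0 := by
      have h2 : tprod F (fun _ : Fin p => (0 : A)) = 0 :=
        (PiTensorProduct.tprod F).map_coord_zero (m := fun _ : Fin p => (0 : A)) 0 rfl
      rw [h2, map_zero]
    refine congrArg Submodule.Quotient.mk (Subtype.ext ?_)
    exact LinearMap.congr_fun h1 v
  · intro a b
    refine LinearMap.ext fun x => ?_
    obtain ⟨v, rfl⟩ := Submodule.Quotient.mk_surjective _ x
    obtain ⟨w, hw⟩ := tprod_const_add (F := F) hp a b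
    have h1 := LinearMap.congr_fun (congrArg e hw) (v : V)
    rw [map_add, map_add, map_sum, LinearMap.add_apply, LinearMap.add_apply,
      LinearMap.sum_apply] at h1
    have h2 : ∀ k, e ((permAlgHom (Equiv.addRight (1 : Fin p)))^[k] w) (v : V) =
        (g ^ k) (e w v) := fun k => by
      rw [← Module.End.mul_apply, ← hpow, Module.End.mul_apply, hfix]
    have key : ∀ h3 h4 h5,
        (Submodule.Quotient.mk ⟨e (tprod F fun _ => a + b) v, h3⟩ : TateZero p g) =
        Submodule.Quotient.mk (⟨e (tprod F fun _ => a) v, h4⟩ + ⟨e (tprod F fun _ => b) v, h5⟩) := by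
      intro h3 h4 h5
      rw [TateZero.mk_eq_mk_iff]
      refine ⟨e w v, ?_⟩
      rw [LinearMap.sum_apply]
      simp only [h2] at h1
      change _ = e (tprod F fun _ => a + b) v - (e (tprod F fun _ => a) v + e (tprod F fun _ => b) v)
      rw [h1, add_sub_cancel_left]
    exact key _ _ _
  · intro l
    refine LinearMap.ext fun x => ?_
    obtain ⟨v, rfl⟩ := Submodule.Quotient.mk_surjective _ x
    have h1 : e (tprod F fun _ => algebraMap F A l) = (l ^ p) • 1 := by
      have h2 := (tprod F (s := fun _ : Fin p => A)).map_smul_univ (fun _ => l) (fun _ => (1 : A))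
      simp only [Finset.prod_const, Finset.card_univ, Fintype.card_fin] at h2
      simp only [Algebra.algebraMap_eq_smul_one]
      rw [h2, map_smul]
      congr 1
      exact map_one e
    rw [Module.algebraMap_end_apply]
    refine congrArg Submodule.Quotient.mk (Subtype.ext ?_)
    exact LinearMap.congr_fun h1 v

end FrobeniusRep

section

variable {F : Type} [Field F] (p : ℕ) [Fact p.Prime] [CharP F p]
  {A : Type} [Ring A] [Algebra F A] [Algebra.IsCentral F A] [IsSimpleRing A]
  [FiniteDimensional F A]

open PiTensorProduct

/-- If the `p`-th tensor power of `A` is split, then `A` has a Frobenius-semilinear representation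
of dimension at most the degree of `A`. -/
theorem exists_frobenius_representation_of_isSepClosed (S : Type) [Field S] [Algebra F S]
    [IsSepClosed S] [Algebra.IsSeparable F S] (h : IsSplitAlg F (⨂[F] _ : Fin p, A)) :
    ∃ (n d : ℕ) (θ : A →+* Matrix (Fin d) (Fin d) F), Module.finrank F A = n ^ 2 ∧ 0 < d ∧ d ≤ n ∧
      ∀ l, θ (algebraMap F A l) = Matrix.scalar (Fin d) (l ^ p) := by
  classical
  have hp : p.Prime := Fact.out
  have : NeZero p := ⟨hp.ne_zero⟩
  have : CharP S p := charP_of_injective_algebraMap (algebraMap F S).injective p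
  obtain ⟨n, hn, ⟨α⟩⟩ := exists_algEquiv_matrix_of_isSepClosed S (S ⊗[F] A)
  have hfin : Module.finrank F A = n ^ 2 := by
    rw [← Module.finrank_baseChange (R := S), α.toLinearEquiv.finrank_eq, Module.finrank_matrix]
    simp [sq]
  obtain ⟨_, _, -⟩ := Br.piTensor_csa p (fun _ => A) (F := F)
  obtain ⟨N, hN, ⟨e₀⟩⟩ := h
  have : Nonempty (Fin N) := ⟨⟨0, hN⟩⟩
  have : Nonempty (Fin n) := ⟨⟨0, hn⟩⟩
  let e : (⨂[F] _ : Fin p, A) ≃ₐ[F] Module.End F (Fin N → F) :=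
    e₀.trans Matrix.toLinAlgEquiv'
  let f : A →ₐ[F] Matrix (Fin n) (Fin n) S :=
    (α.toAlgHom.restrictScalars F).comp Algebra.TensorProduct.includeRight
  let β : (⨂[F] _ : Fin p, A) →ₐ[F] Module.End S ((Fin p → Fin n) → S) :=
    ((Matrix.toLinAlgEquiv' (R := S)).toAlgHom.restrictScalars F).comp (matrixAlgHom f)
  let ρ : Equiv.Perm (Fin p) := Equiv.addRight 1
  let τ : Equiv.Perm (Fin p → Fin n) := Equiv.arrowCongr ρ (Equiv.refl _)
  have hτ : τ^[p] = id := by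
    have h1 : (τ.symm)^[p] = id := comp_iterate_addRight_one (p := p) (Y := Fin n)
    funext x
    have h2 := (Function.LeftInverse.iterate τ.symm_apply_apply p) x
    rw [h1] at h2
    exact h2
  have hfixτ : ∀ x, τ x = x ↔ ∃ y, Function.const (Fin p) y = x := fun x => by
    rw [← comp_addRight_one_eq_iff, ← Equiv.eq_symm_apply, eq_comm]
    rfl
  have hcard : Fintype.card {x // τ x = x} = n := by
    have e1 : Fin n ≃ {x // τ x = x} := Equiv.ofBijective
      (fun y => ⟨Function.const (Fin p) y, (hfixτ _).2 ⟨y, rfl⟩⟩)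
      ⟨fun y z h => Function.const_injective (congrArg Subtype.val h), fun x => by
        obtain ⟨y, hy⟩ := (hfixτ x.1).1 x.2
        exact ⟨y, Subtype.ext hy⟩⟩
    rw [← Fintype.card_congr e1, Fintype.card_fin]
  have hdim : Module.finrank F (⨂[F] _ : Fin p, A) =
      Module.finrank S ((Fin p → Fin n) → S) ^ 2 := by
    rw [Br.finrank_piTensorProduct, Module.finrank_pi]
    simp [hfin, ← pow_mul, mul_comm]
  obtain ⟨g, T, hT, hg⟩ := exists_operator_of_transport (p := p) e β hdim (permAlgHom ρ)
    (permAlgHom_iterate_eq_self ρ p addRight_one_iterate) (LinearMap.funLeft S S τ)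
    (LinearMap.ext fun v => funext fun x => by rw [funLeft_pow_apply, hτ]; rfl)
    (fun b => by
      refine LinearMap.ext fun v => funext fun x => ?_
      change (Matrix.mulVec (matrixAlgHom f (permAlgHom ρ b)) (v ∘ τ)) x =
        (Matrix.mulVec (matrixAlgHom f b) v) (τ x)
      rw [matrixAlgHom_permAlgHom]
      exact Fintype.sum_equiv τ _ _ fun y => rfl)
  have hgp : g ^ p = 1 := by
    have : IsSimpleRing (Module.End F (Fin N → F)) := isSimpleRing_end F _
    apply (transportEnd T).injective
    rw [map_pow, hT, map_one]
    exact LinearMap.ext fun v => funext fun x => by rw [funLeft_pow_apply, hτ]; rfl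
  obtain ⟨x₀, hx₀⟩ : ∃ x, τ x = x := ⟨_, (hfixτ _).2 ⟨⟨0, hn⟩, rfl⟩⟩
  have hb := finrank_fixed_bounds (S := S) hp τ hτ x₀ hx₀
  have hk1 := finrank_ker_transportEnd T (g - 1)
  have hk2 := finrank_ker_transportEnd T (∑ k ∈ Finset.range p, g ^ k)
  have ht1 : transportEnd T (g - 1) = LinearMap.funLeft S S τ - 1 := by
    rw [map_sub, hT, map_one]
  have ht2 : transportEnd T (∑ k ∈ Finset.range p, g ^ k) =
      ∑ k ∈ Finset.range p, LinearMap.funLeft S S τ ^ k := by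
    rw [map_sum]
    exact Finset.sum_congr rfl fun k _ => by rw [map_pow, hT]
  rw [ht1] at hk1
  rw [ht2] at hk2
  rw [hk1, hk2, hcard, ← finrank_tateZero g hgp] at hb
  have hVX : Module.finrank F (Fin N → F) = Fintype.card (Fin p → Fin n) := by
    rw [← Module.finrank_baseChange (R := S), T.finrank_eq, Module.finrank_pi]
  rw [hVX] at hb
  obtain ⟨θ, hθ⟩ := exists_ringHom_tateZero hp e.toAlgHom g hg
  let b := Module.finBasis F (TateZero p g)
  refine ⟨n, Module.finrank F (TateZero p g),
    ((LinearMap.toMatrixAlgEquiv b : _ →+* _)).comp θ, hfin, by lia, by lia, fun l => ?_⟩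
  rw [RingHom.comp_apply, hθ]
  exact (LinearMap.toMatrixAlgEquiv b).commutes (l ^ p)

namespace Br

/-- The Frobenius pull-back of a class whose `p`-th tensor power is split vanishes. -/
theorem res_frobenius_eq_zero (h : IsSplitAlg F (⨂[F] _ : Fin p, A)) :
    res (frobenius F p) (mk F A) = 0 := by
  obtain ⟨n, d, θ, hfin, hd, hdn, hθ⟩ := exists_frobenius_representation_of_isSepClosed p
    (SeparableClosure F) h
  let K := FrobeniusCopy p F
  have hres : res (frobenius F p) (mk F A) = mk K (K ⊗[F] A) := res_mk (K := K) A
  let θ' : A →ₐ[F] Matrix (Fin d) (Fin d) K :=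
    { (θ : A →+* Matrix (Fin d) (Fin d) K) with commutes' := fun l => hθ l }
  let Θ : K ⊗[F] A →ₐ[K] Matrix (Fin d) (Fin d) K :=
    Algebra.TensorProduct.lift (Algebra.ofId K _) θ' fun s b =>
      Algebra.commute_algebraMap_left s (θ' b)
  have : Nonempty (Fin d) := ⟨⟨0, hd⟩⟩
  have hinj : Function.Injective Θ.toLinearMap := RingHom.injective (Θ : K ⊗[F] A →+* Matrix (Fin d) (Fin d) K)
  have hle := LinearMap.finrank_le_finrank_of_injective hinj
  have hmat : Module.finrank K (Matrix (Fin d) (Fin d) K) = d ^ 2 := by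
    rw [Module.finrank_matrix]; simp [sq]
  rw [Module.finrank_baseChange, hfin, hmat] at hle
  have hnd : n = d := le_antisymm ((Nat.pow_le_pow_iff_left two_ne_zero).1 hle) hdn
  rw [hres]
  exact mk_eq_zero_of_matrix (AlgEquiv.ofBijective Θ
    (bijective_of_finrank_eq Θ (by rw [Module.finrank_baseChange, hfin, hmat, hnd])))

end Br

end

namespace Br

variable {F A : Type} [Field F] {p : ℕ} [Fact p.Prime] [CharP F p] [Ring A] [Algebra F A]
  [Algebra.IsCentral F A] [IsSimpleRing A] [FiniteDimensional F A] {m : ℕ}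

theorem isSymSum_of_symbolLengthLE (h : SymbolLengthLE p F A m) : IsSymSum p m (mk F A) := by
  have hp : p.Prime := Fact.out
  obtain ⟨k, hkm, D, _, _, hD, hbr⟩ := h
  choose a b hb hfin x y hx hy hxy hadj using hD
  have hnt : ∀ i, Nontrivial (D i) := fun i =>
    Module.nontrivial_of_finrank_pos (R := F) (by rw [hfin]; exact pow_pos hp.pos 2)
  have hpair : ∀ i, IsSymPair p (a i) (b i) (x i) (y i) := fun i => ⟨hx i, hy i, hxy i⟩
  have hfd : ∀ i, FiniteDimensional F (D i) := fun i => (hpair i).finiteDimensional (hadj i)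
  have hs : ∀ i, IsSimpleRing (D i) := fun i => (hpair i).isSimpleRing (hb i) (hadj i)
  have hc : ∀ i, Algebra.IsCentral F (D i) := fun i => (hpair i).isCentral (hb i) (hadj i)
  obtain ⟨_, _, hmk⟩ := piTensor_csa k D (F := F)
  refine IsSymSum.mono ⟨a, b, ?_⟩ hkm
  rw [mk_eq_iff.2 hbr, hmk]
  exact Finset.sum_congr rfl fun i _ => mk_eq_sym (hpair i) (hb i) (hfin i)

theorem symbolLengthLE_of_isSymSum (h : IsSymSum p m (mk F A)) : SymbolLengthLE p F A m := by
  classical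
  obtain ⟨a, b, hab⟩ := h
  let a' : Fin m → F := fun i => if b i = 0 then 0 else a i
  let b' : Fin m → F := fun i => if b i = 0 then 1 else b i
  have hb' : ∀ i, NeZero (b' i) := fun i => ⟨by
    dsimp only [b']
    split_ifs with h
    · exact one_ne_zero
    · exact h⟩
  have hsym : ∀ i, sym p (a i) (b i) = sym p (a' i) (b' i) := fun i => by
    dsimp only [a', b']
    split_ifs with h
    · rw [h, sym_zero_right, sym_one_right]
    · rfl
  refine ⟨m, le_rfl, fun i => SymbolAlg p (a' i) (b' i), fun i => inferInstance,
    fun i => inferInstance, fun i => ⟨a' i, b' i, NeZero.ne _, SymbolAlg.finrank p _ _,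
      SymbolAlg.i p _ _, SymbolAlg.j p _ _, (SymbolAlg.isSymPair p _ _).left,
      (SymbolAlg.isSymPair p _ _).right, (SymbolAlg.isSymPair p _ _).rel,
      SymbolAlg.adjoin_eq_top p _ _⟩, ?_⟩
  obtain ⟨_, _, hmk⟩ := piTensor_csa m (fun i => SymbolAlg p (a' i) (b' i)) (F := F)
  rw [← mk_eq_iff, hmk, hab]
  exact Finset.sum_congr rfl fun i _ => by rw [hsym, sym_eq]

end Br

/-- If `A` is central simple of exponent `p` over `F` of characteristic `p`,
and `K/F` is a finite purely inseparable extension such that `A_K` is not split, then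
`λ_p(A) ≤ [K:F] * λ_p(A_K)`. -/
theorem statement4 (p : ℕ) (hp : p.Prime) (F : Type) [Field F] [CharP F p]
    (A : Type) [Ring A] [Algebra F A] (hA : IsCSA F A) (hexp : HasExponent F A p)
    (K : Type) [Field K] [Algebra F K] [FiniteDimensional F K] [IsPurelyInseparable F K]
    (hns : ¬ IsSplitAlg K (K ⊗[F] A))
    (m : ℕ) (h : SymbolLengthLE p K (K ⊗[F] A) m) :
    SymbolLengthLE p F A (Module.finrank F K * m) := by
  have : Fact p.Prime := ⟨hp⟩
  obtain ⟨_, _, _⟩ := hA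
  have : CharP K p := charP_of_injective_algebraMap (algebraMap F K).injective p
  have hsum := Br.isSymSum_of_symbolLengthLE h
  have hm : 0 < m := by
    refine Nat.pos_of_ne_zero fun h0 => hns (Br.isSplitAlg_of_mk_eq_zero ?_)
    subst h0
    obtain ⟨a, b, hab⟩ := hsum
    rw [hab, Finset.univ_eq_empty, Finset.sum_empty]
  refine Br.symbolLengthLE_of_isSymSum (Br.isSymSum_mul_finrank _ rfl
    (Br.res_frobenius_eq_zero p hexp.2.1) hm ?_)
  rwa [Br.res_mk]
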